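/- arXiv:1808.08611 — 4 statements merged into one kernel-verified Lean document; each statement's English description precedes it below -/
import Mathlib

section
/- Let A be a finite-dimensional C*-algebra, i.e. a complex *-algebra *-isomorphic to a finite product M_{n_1}(ℂ) × ⋯ × M_{n_m}(ℂ), and let D ⊆ A be a unital commutative *-subalgebra spanned over ℂ by finitely many pairwise orthogonal self-adjoint idempotents summing to 1. Then the amalgamated free product A ∗_D A is residually finite-dimensional. -/
noncomputable section

/-- A complex *-algebra is residually finite-dimensional (RFD) if it admits an
injective unital *-algebra homomorphism into a product of matrix algebras. -/
def IsRFD (A : Type) [Ring A] [Algebra ℂ A] [StarRing A] : Prop :=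
  ∃ (I : Type) (n : I → ℕ)
    (φ : A →⋆ₐ[ℂ] ∀ i, Matrix (Fin (n i)) (Fin (n i)) ℂ),
    Function.Injective φ

/-- A complex *-algebra is a finite-dimensional C*-algebra iff it is *-isomorphic to a
finite product of complex matrix algebras. -/
def IsFinDimCStar (A : Type) [Ring A] [Algebra ℂ A] [StarRing A] : Prop :=
  ∃ (m : ℕ) (n : Fin m → ℕ),
    Nonempty (A ≃⋆ₐ[ℂ] ∀ i, Matrix (Fin (n i)) (Fin (n i)) ℂ)

/-- `D` is spanned over ℂ by finitely many pairwise orthogonal self-adjoint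
idempotents summing to `1` (i.e. `D` is a finite-dimensional commutative
C*-algebra). -/
def IsSpannedByOrthProjections (D : Type) [Ring D] [Algebra ℂ D] [StarRing D] : Prop :=
  ∃ (m : ℕ) (p : Fin m → D),
    (∀ i, star (p i) = p i) ∧ (∀ i, p i * p i = p i) ∧
    (∀ i j, i ≠ j → p i * p j = 0) ∧ (∑ i, p i = 1) ∧
    Submodule.span ℂ (Set.range p) = ⊤

/-- The amalgamated free product `A ∗_D B` of unital complex *-algebras: the pushout
of `A ← D → B` in the category of unital complex *-algebras (equivalently, the
quotient of the free product `A ∗ B` by the ideal generated by `ι_A(d) - ι_B(d)`,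
`d ∈ D`, with the induced star), characterized by its universal property. -/
structure StarAlgPushout (D A B : Type)
    [Ring D] [Algebra ℂ D] [StarRing D] [StarModule ℂ D]
    [Ring A] [Algebra ℂ A] [StarRing A] [StarModule ℂ A]
    [Ring B] [Algebra ℂ B] [StarRing B] [StarModule ℂ B]
    (f : D →⋆ₐ[ℂ] A) (g : D →⋆ₐ[ℂ] B) where
  carrier : Type
  [ringP : Ring carrier]
  [algP : Algebra ℂ carrier]
  [starP : StarRing carrier]
  [smodP : StarModule ℂ carrier]
  inl : A →⋆ₐ[ℂ] carrier
  inr : B →⋆ₐ[ℂ] carrier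
  comm : inl.comp f = inr.comp g
  univ : ∀ (T : Type) [Ring T] [Algebra ℂ T] [StarRing T] [StarModule ℂ T]
      (jA : A →⋆ₐ[ℂ] T) (jB : B →⋆ₐ[ℂ] T),
      jA.comp f = jB.comp g →
      ∃! φ : carrier →⋆ₐ[ℂ] T, φ.comp inl = jA ∧ φ.comp inr = jB

attribute [instance] StarAlgPushout.ringP StarAlgPushout.algP StarAlgPushout.starP
  StarAlgPushout.smodP

namespace AmalgamatedSquare

open Matrix

section LinearAlgebra

/-- If the common kernel of a family of functionals lies in `W`, then modulo `W` the identity is a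
finite sum of rank-one maps `v ↦ f i v • e`. -/
theorem exists_finite_frame {V σ : Type} [AddCommGroup V] [Module ℂ V] [FiniteDimensional ℂ V]
    (W : Submodule ℂ V) (f : σ → Module.Dual ℂ V) (hf : ∀ v, (∀ i, f i v = 0) → v ∈ W) :
    ∃ (β : Type) (_ : Fintype β) (i : β → σ) (e : β → V),
      ∀ v, v - ∑ b, f (i b) v • e b ∈ W := by
  classical
  obtain ⟨β, i, -, hspan, hli⟩ := exists_linearIndependent' ℂ f
  have : Finite β := hli.finite
  let _ : Fintype β := Fintype.ofFinite β
  let F : V →ₗ[ℂ] (β → ℂ) := LinearMap.pi fun b => f (i b)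
  have hker : ∀ v, F v = 0 → v ∈ W := by
    intro v hv
    refine hf v fun j => ?_
    have hj : f j ∈ Submodule.span ℂ (Set.range (f ∘ i)) :=
      hspan ▸ Submodule.subset_span ⟨j, rfl⟩
    have hle : Submodule.span ℂ (Set.range (f ∘ i)) ≤ LinearMap.ker (Module.Dual.eval ℂ V v) := by
      rw [Submodule.span_le]
      rintro _ ⟨b, rfl⟩
      exact congrFun hv b
    exact hle hj
  obtain ⟨R, hR⟩ := F.rangeRestrict.exists_rightInverse_of_surjective F.range_rangeRestrict
  obtain ⟨G, hG⟩ := R.exists_extend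
  refine ⟨β, inferInstance, i, fun b => G (Pi.single b 1), fun v => hker _ ?_⟩
  have hsum : ∑ b, f (i b) v • G (Pi.single b 1) = G (F v) := by
    conv_rhs => rw [pi_eq_sum_univ' (F v)]
    simp only [map_sum, map_smul]
    rfl
  have h1 : G (F v) = R (F.rangeRestrict v) := LinearMap.congr_fun hG (F.rangeRestrict v)
  have h2 : F (R (F.rangeRestrict v)) = F v :=
    congrArg Subtype.val (LinearMap.congr_fun hR (F.rangeRestrict v))
  rw [hsum, map_sub, h1, h2, sub_self]

variable {h : Type} [Fintype h]

theorem exists_smul_unit {x : h → ℂ} (hx : x ≠ 0) :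
    ∃ c : ℂ, c ≠ 0 ∧ star (c • x) ⬝ᵥ (c • x) = 1 := by
  have hpos : star x ⬝ᵥ x = ((∑ i, ‖x i‖ ^ 2 : ℝ) : ℂ) := by
    simp [dotProduct, Complex.conj_mul']
  set r : ℝ := ∑ i, ‖x i‖ ^ 2 with hr
  have h0 : r ≠ 0 := by
    intro h
    rw [h] at hpos
    open ComplexOrder in exact hx (dotProduct_star_self_eq_zero.1 (by simpa using hpos))
  have hr0 : 0 < r := lt_of_le_of_ne (by positivity) (Ne.symm h0)
  refine ⟨((Real.sqrt r)⁻¹ : ℝ), by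
    simpa using (Real.sqrt_pos.2 hr0).ne', ?_⟩
  rw [star_smul, smul_dotProduct, dotProduct_smul, hpos, smul_eq_mul, smul_eq_mul,
    Complex.star_def, Complex.conj_ofReal]
  norm_cast
  have := Real.mul_self_sqrt hr0.le
  have hs := (Real.sqrt_pos.2 hr0).ne'
  field_simp
  nlinarith

theorem dotProduct_eq_zero_of_unit {K : Set (h → ℂ)} (hK : ∀ (c : ℂ), ∀ x ∈ K, c • x ∈ K)
    (M : Matrix h h ℂ) {L : Set (h → ℂ)} (hL : ∀ (c : ℂ), ∀ x ∈ L, c • x ∈ L)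
    (H : ∀ y ∈ L, ∀ x ∈ K, star y ⬝ᵥ x = 0 → star y ⬝ᵥ y = 1 → star x ⬝ᵥ x = 1 →
      star y ⬝ᵥ (M *ᵥ x) = 0) :
    ∀ y ∈ L, ∀ x ∈ K, star y ⬝ᵥ x = 0 → star y ⬝ᵥ (M *ᵥ x) = 0 := by
  intro y hy x hx hyx
  by_cases hy0 : y = 0
  · simp [hy0]
  by_cases hx0 : x = 0
  · simp [hx0]
  obtain ⟨c, hc, hc1⟩ := exists_smul_unit hy0
  obtain ⟨d, hd, hd1⟩ := exists_smul_unit hx0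
  have := H _ (hL c y hy) _ (hK d x hx) (by
    rw [star_smul, smul_dotProduct, dotProduct_smul, hyx]; simp) hc1 hd1
  rw [star_smul, mulVec_smul, smul_dotProduct, dotProduct_smul] at this
  simpa [hc, hd] using this

/-- A compression `Q * M * Q` is scalar as soon as its matrix coefficients vanish at all pairs
of orthogonal vectors in the range of the projection `Q`. -/
theorem exists_compression_eq_smul [DecidableEq h] (Q M : Matrix h h ℂ) (hQ : Qᴴ = Q)
    (hQQ : Q * Q = Q)
    (H : ∀ y x : h → ℂ, Q *ᵥ y = y → Q *ᵥ x = x → star y ⬝ᵥ x = 0 → star y ⬝ᵥ (M *ᵥ x) = 0) :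
    ∃ c : ℂ, Q * M * Q = c • Q := by
  have hrange : ∀ x, Q *ᵥ (Q *ᵥ x) = Q *ᵥ x := fun x => by rw [mulVec_mulVec, hQQ]
  by_cases hQ0 : ∀ x, Q *ᵥ x = 0
  · have : Q = 0 := by
      apply Matrix.ext_of_mulVec_single
      intro i; rw [hQ0, zero_mulVec]
    exact ⟨0, by simp [this]⟩
  push Not at hQ0
  obtain ⟨x₀, hx₀⟩ := hQ0
  obtain ⟨c, hc, hc1⟩ := exists_smul_unit hx₀
  set z := c • (Q *ᵥ x₀) with hz
  have hzQ : Q *ᵥ z = z := by rw [hz, mulVec_smul, hrange]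
  have hreal : ∀ x : h → ℂ, star (star x ⬝ᵥ x) = star x ⬝ᵥ x := fun x => by
    rw [← star_dotProduct_star, star_star]
  have hswap : ∀ x y : h → ℂ, star (star x ⬝ᵥ y) = star y ⬝ᵥ x := fun x y => by
    rw [← star_dotProduct_star, star_star]
  have key : ∀ y x : h → ℂ, Q *ᵥ y = y → Q *ᵥ x = x →
      (star y ⬝ᵥ (M *ᵥ x)) * (star x ⬝ᵥ x) = (star y ⬝ᵥ x) * (star x ⬝ᵥ (M *ᵥ x)) := by
    intro y x hy hx
    have := H ((star x ⬝ᵥ x) • y - (star x ⬝ᵥ y) • x) x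
      (by rw [mulVec_sub, mulVec_smul, mulVec_smul, hx, hy]) hx
      (by simp only [star_sub, star_smul, sub_dotProduct, smul_dotProduct, hreal, hswap,
            smul_eq_mul]; ring)
    simp only [star_sub, star_smul, sub_dotProduct, smul_dotProduct, hreal, hswap,
            smul_eq_mul] at this
    linear_combination this
  set l := star z ⬝ᵥ (M *ᵥ z) with hl
  have hyz : ∀ y, Q *ᵥ y = y → star y ⬝ᵥ (M *ᵥ z) = l * (star y ⬝ᵥ z) := by
    intro y hy
    have := key y z hy hzQ
    rw [hc1] at this
    linear_combination this
  have hperp : ∀ y x, Q *ᵥ y = y → Q *ᵥ x = x → star z ⬝ᵥ x = 0 →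
      star y ⬝ᵥ (M *ᵥ x) = l * (star y ⬝ᵥ x) := by
    intro y x hy hx hzx
    by_cases hx0 : x = 0
    · simp [hx0]
    have hxx : star x ⬝ᵥ x ≠ 0 := by
      open ComplexOrder in exact fun h => hx0 (dotProduct_star_self_eq_zero.1 h)
    have hxz : star x ⬝ᵥ z = 0 := by rw [← hswap, hzx, star_zero]
    have h1 := H (z - x) ((star x ⬝ᵥ x) • z + x) (by rw [mulVec_sub, hzQ, hx])
      (by rw [mulVec_add, mulVec_smul, hzQ, hx])
      (by simp only [star_sub, sub_dotProduct, dotProduct_add, dotProduct_smul, smul_eq_mul,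
            hzx, hxz, hc1]; ring)
    simp only [star_sub, sub_dotProduct, dotProduct_add, mulVec_add, mulVec_smul, dotProduct_smul,
      smul_eq_mul, ← hl, H z x hzQ hx hzx, H x z hx hzQ hxz] at h1
    have h2 := key y x hy hx
    apply mul_right_cancel₀ hxx
    linear_combination h2 - (star y ⬝ᵥ x) * h1
  have hall : ∀ y x, Q *ᵥ y = y → Q *ᵥ x = x →
      star y ⬝ᵥ (M *ᵥ x) = l * (star y ⬝ᵥ x) := by
    intro y x hy hx
    have h1 := hperp y (x - (star z ⬝ᵥ x) • z) hy
      (by rw [mulVec_sub, mulVec_smul, hzQ, hx])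
      (by rw [dotProduct_sub, dotProduct_smul, hc1]; simp)
    simp only [mulVec_sub, mulVec_smul, dotProduct_sub, dotProduct_smul, smul_eq_mul,
      hyz y hy] at h1
    linear_combination h1
  refine ⟨l, ?_⟩
  ext i j
  have h1 := hall (Q *ᵥ Pi.single i 1) (Q *ᵥ Pi.single j 1) (hrange _) (hrange _)
  rw [star_mulVec, hQ, ← dotProduct_mulVec, ← dotProduct_mulVec, mulVec_mulVec, mulVec_mulVec,
    mulVec_mulVec, hQQ] at h1
  simpa [Pi.star_single] using h1

end LinearAlgebra

section Words

variable {A R : Type} [Ring A] [Algebra ℂ A] [StarRing A] [Ring R] [Algebra ℂ R] [StarRing R]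

/-- Prepend a term to a sequence. -/
def seqCons {α : Type} (x : α) (s : ℕ → α) : ℕ → α
  | 0 => x
  | n + 1 => s n

/-- The product of the first `n` letters of `a`, mapped alternately by `j c` and `j (!c)`. -/
def altWord (j : Bool → A →⋆ₐ[ℂ] R) : Bool → ℕ → (ℕ → A) → R
  | _, 0, _ => 1
  | c, n + 1, a => j c (a 0) * altWord j (!c) n fun k => a (k + 1)

/-- The span of the alternating words with `n` letters, the first of which is mapped by `j c`. -/
def wordSpan (j : Bool → A →⋆ₐ[ℂ] R) (c : Bool) (n : ℕ) : Submodule ℂ R :=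
  Submodule.span ℂ (Set.range (altWord j c n))

variable (j : Bool → A →⋆ₐ[ℂ] R)

theorem altWord_mem (c : Bool) (n : ℕ) (a : ℕ → A) : altWord j c n a ∈ wordSpan j c n :=
  Submodule.subset_span ⟨a, rfl⟩

theorem mul_mem_of_altWord_mem {c d : Bool} {m n : ℕ} (x : R)
    (hx : ∀ a, x * altWord j c m a ∈ wordSpan j d n) {y : R} (hy : y ∈ wordSpan j c m) :
    x * y ∈ wordSpan j d n := by
  induction hy using Submodule.span_induction with
  | mem y hy => obtain ⟨a, rfl⟩ := hy; exact hx a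
  | zero => simp
  | add y z _ _ hy hz => rw [mul_add]; exact add_mem hy hz
  | smul r y _ hy => rw [mul_smul_comm]; exact Submodule.smul_mem _ _ hy

theorem mul_mem_wordSpan_succ (c : Bool) (n : ℕ) (x : A) {y : R} (hy : y ∈ wordSpan j (!c) n) :
    j c x * y ∈ wordSpan j c (n + 1) :=
  mul_mem_of_altWord_mem j _ (fun a => altWord_mem j c (n + 1) (seqCons x a)) hy

theorem exists_eq_sum_altWord (c : Bool) (n : ℕ) {x : R} (hx : x ∈ wordSpan j c (n + 1)) :
    ∃ (m : ℕ) (w : Fin m → ℕ → A), x = ∑ t, altWord j c (n + 1) (w t) := by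
  obtain ⟨m, f, v, rfl⟩ := Submodule.mem_span_set'.1 hx
  choose a ha using fun t => (v t).2
  refine ⟨m, fun t => seqCons (f t • a t 0) fun k => a t (k + 1),
    Finset.sum_congr rfl fun t _ => ?_⟩
  rw [← ha, altWord, altWord, ← smul_mul_assoc, ← map_smul]
  rfl

theorem altWord_append_one (c : Bool) (n : ℕ) (a : ℕ → A) :
    altWord j c (n + 1) (fun k => if k < n then a k else 1) = altWord j c n a := by
  induction n generalizing c a with
  | zero => simp [altWord]
  | succ n ih =>
    change j c _ * altWord j (!c) (n + 1) _ = j c _ * altWord j (!c) n _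
    rw [← ih]
    simp

theorem wordSpan_le_succ (c : Bool) (n : ℕ) : wordSpan j c n ≤ wordSpan j c (n + 1) := by
  refine Submodule.span_le.2 ?_
  rintro _ ⟨a, rfl⟩
  rw [← altWord_append_one]
  exact altWord_mem j c _ _

theorem mul_mem_wordSpan (c : Bool) (n : ℕ) (x : A) {y : R} (hy : y ∈ wordSpan j c (n + 1)) :
    j c x * y ∈ wordSpan j c (n + 1) := by
  refine mul_mem_of_altWord_mem j _ (fun a => ?_) hy
  rw [altWord, ← mul_assoc, ← map_mul]
  exact altWord_mem j c (n + 1) (seqCons (x * a 0) fun k => a (k + 1))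

theorem altWord_zero_sub_mem (D : Submodule ℂ A) (hD : ∀ c, ∀ d ∈ D, j c d = j (!c) d) (c : Bool)
    (n : ℕ) (x : A) (a a' : ℕ → A) (ha : ∀ k, a k - a' k ∈ D) :
    j (!c) x * (altWord j c n a - altWord j c n a') ∈ wordSpan j (!c) n := by
  induction n generalizing c x a a' with
  | zero => simp [altWord]
  | succ n ih =>
    set u := altWord j (!c) n fun k => a (k + 1)
    set u' := altWord j (!c) n fun k => a' (k + 1)
    have hsplit : j (!c) x * (altWord j c (n + 1) a - altWord j c (n + 1) a') =
        j (!c) (x * (a 0 - a' 0)) * u + j (!c) x * (j c (a' 0) * (u - u')) := by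
      rw [altWord, altWord, map_mul, ← hD c _ (ha 0), map_sub]
      noncomm_ring
    rw [hsplit]
    refine add_mem (mul_mem_wordSpan j _ _ _ (wordSpan_le_succ j _ _ (altWord_mem j _ _ _))) ?_
    refine mul_mem_wordSpan_succ j _ _ _ ?_
    have := ih (!c) (a' 0) _ _ fun k => ha (k + 1)
    simpa using this

/-- Words in the letters `∑ b, f b (a k) • e b` expand into words in the letters `e b`. -/
theorem sum_mul_altWord_eq_zero {β τ : Type} [Fintype β] [Nonempty β] [Fintype τ]
    (f : β → A →ₗ[ℂ] ℂ) (e : β → A) (c : Bool) (n : ℕ) (y : τ → R) (a : τ → ℕ → A)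
    (H : ∀ b : ℕ → β, ∑ t, (∏ k ∈ Finset.range n, f (b k) (a t k)) •
      (y t * altWord j c n fun k => e (b k)) = 0) :
    ∑ t, y t * altWord j c n (fun k => ∑ b, f b (a t k) • e b) = 0 := by
  induction n generalizing c y a with
  | zero => simpa [altWord] using H fun _ => Classical.arbitrary β
  | succ n ih =>
    have hexp : ∀ t, y t * altWord j c (n + 1) (fun k => ∑ b, f b (a t k) • e b) =
        ∑ b₀, (f b₀ (a t 0) • (y t * j c (e b₀))) *
          altWord j (!c) n (fun k => ∑ b, f b (a t (k + 1)) • e b) := by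
      intro t
      rw [altWord, map_sum, Finset.sum_mul, Finset.mul_sum]
      refine Finset.sum_congr rfl fun b _ => ?_
      rw [map_smul, smul_mul_assoc, smul_mul_assoc, mul_smul_comm, mul_assoc]
    simp_rw [hexp]
    rw [Finset.sum_comm]
    refine Finset.sum_eq_zero fun b₀ _ => ih (!c) (fun t => f b₀ (a t 0) • (y t * j c (e b₀)))
      (fun t k => a t (k + 1)) fun b => ?_
    rw [← H (seqCons b₀ b)]
    refine Finset.sum_congr rfl fun t _ => ?_
    rw [Finset.prod_range_succ', altWord, smul_mul_assoc, smul_smul, mul_assoc]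
    rfl

theorem altWord_eq_zero_of_not_composable {ι β : Type} (p : ι → A)
    (hp : ∀ i, j true (p i) = j false (p i)) (hpp : ∀ i k, i ≠ k → p i * p k = 0)
    (s r : β → ι) (e : β → A) (hs : ∀ b, p (s b) * e b = e b) (hr : ∀ b, e b * p (r b) = e b)
    (c : Bool) (n : ℕ) (b : ℕ → β) (k : ℕ) (hk : k + 1 < n) (hb : r (b k) ≠ s (b (k + 1))) :
    altWord j c n (fun k => e (b k)) = 0 := by
  induction n generalizing c b k with
  | zero => omega
  | succ n ih =>
    rw [altWord]
    cases k with
    | zero =>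
      obtain ⟨n, rfl⟩ : ∃ m, n = m + 1 := ⟨n - 1, by omega⟩
      have hcp : ∀ i, j (!c) (p i) = j c (p i) := by cases c <;> simp [hp]
      rw [altWord, ← mul_assoc]
      have : j c (e (b 0)) * j (!c) (e (b (0 + 1))) = 0 := by
        rw [← hr (b 0), ← hs (b (0 + 1)), map_mul, map_mul, hcp, mul_assoc,
          ← mul_assoc (j c (p _)), ← map_mul, hpp _ _ hb]
        simp
      rw [this, zero_mul]
    | succ k =>
      rw [ih (!c) (fun k => b (k + 1)) k (by omega) hb, mul_zero]

end Words

section Frames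

variable {A h ι : Type} [Ring A] [Algebra ℂ A] [StarRing A] [Fintype h] [DecidableEq h]

theorem mulVec_eq_ite [DecidableEq ι] (p : ι → A) (horth : ∀ i k, i ≠ k → p i * p k = 0)
    (π : A →⋆ₐ[ℂ] Matrix h h ℂ) {s : ι} {y : h → ℂ} (hy : π (p s) *ᵥ y = y) (i : ι) :
    π (p i) *ᵥ y = if i = s then y else 0 := by
  split_ifs with hi
  · rw [hi, hy]
  · rw [← hy, mulVec_mulVec, ← map_mul, horth _ _ hi, map_zero, zero_mulVec]

variable [Fintype ι]

/-- A finite set of rank-one maps summing to the identity of `A` modulo the span of the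
projections `p`, given by matrix coefficients of `π` at orthogonal unit vectors. -/
structure Frame (p : ι → A) (π : A →⋆ₐ[ℂ] Matrix h h ℂ) (β : Type) [Fintype β] where
  s : β → ι
  r : β → ι
  η : β → h → ℂ
  ξ : β → h → ℂ
  e : β → A
  proj_η : ∀ b, π (p (s b)) *ᵥ η b = η b
  proj_ξ : ∀ b, π (p (r b)) *ᵥ ξ b = ξ b
  orth : ∀ b, star (η b) ⬝ᵥ ξ b = 0
  unit_η : ∀ b, star (η b) ⬝ᵥ η b = 1
  unit_ξ : ∀ b, star (ξ b) ⬝ᵥ ξ b = 1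
  left_mul : ∀ b, p (s b) * e b = e b
  mul_right : ∀ b, e b * p (r b) = e b
  sub_mem : ∀ a, a - ∑ b, (star (η b) ⬝ᵥ (π a *ᵥ ξ b)) • e b ∈ Submodule.span ℂ (Set.range p)

/-- The functional `a ↦ ⟨y, π a x⟩`. -/
def coeff (π : A →⋆ₐ[ℂ] Matrix h h ℂ) (y x : h → ℂ) : A →ₗ[ℂ] ℂ where
  toFun a := star y ⬝ᵥ (π a *ᵥ x)
  map_add' a b := by rw [map_add, add_mulVec, dotProduct_add]
  map_smul' c a := by rw [map_smul, smul_mulVec, dotProduct_smul]; rfl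

theorem mem_span_of_coeff_eq_zero (p : ι → A) (hstar : ∀ i, star (p i) = p i)
    (hidem : ∀ i, p i * p i = p i) (horth : ∀ i k, i ≠ k → p i * p k = 0) (hsum : ∑ i, p i = 1)
    (π : A →⋆ₐ[ℂ] Matrix h h ℂ) (hπ : Function.Injective π) (a : A)
    (H : ∀ (s r : ι) (y x : h → ℂ), π (p s) *ᵥ y = y → π (p r) *ᵥ x = x → star y ⬝ᵥ x = 0 →
      star y ⬝ᵥ y = 1 → star x ⬝ᵥ x = 1 → star y ⬝ᵥ (π a *ᵥ x) = 0) :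
    a ∈ Submodule.span ℂ (Set.range p) := by
  have hπstar : ∀ s, (π (p s))ᴴ = π (p s) := fun s => by
    rw [← star_eq_conjTranspose, ← map_star, hstar]
  have hπidem : ∀ s, π (p s) * π (p s) = π (p s) := fun s => by rw [← map_mul, hidem]
  have H' : ∀ (s r : ι) (y x : h → ℂ), π (p s) *ᵥ y = y → π (p r) *ᵥ x = x →
      star y ⬝ᵥ x = 0 → star y ⬝ᵥ (π a *ᵥ x) = 0 := fun s r y x hy hx =>
    dotProduct_eq_zero_of_unit (K := {x | π (p r) *ᵥ x = x}) (L := {y | π (p s) *ᵥ y = y})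
      (fun c x (hx : _ = _) => by simp [mulVec_smul, hx]) _
      (fun c x (hx : _ = _) => by simp [mulVec_smul, hx])
      (fun y hy x hx => H s r y x hy hx) y hy x hx
  have hoff : ∀ s r, s ≠ r → p s * a * p r = 0 := by
    intro s r hsr
    apply hπ
    rw [map_zero, map_mul, map_mul]
    ext i k
    have h1 := H' s r (π (p s) *ᵥ Pi.single i 1) (π (p r) *ᵥ Pi.single k 1)
      (by rw [mulVec_mulVec, hπidem]) (by rw [mulVec_mulVec, hπidem])
      (by rw [star_mulVec, hπstar, ← dotProduct_mulVec, mulVec_mulVec, ← map_mul, horth s r hsr]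
          simp)
    rw [star_mulVec, hπstar, ← dotProduct_mulVec, mulVec_mulVec, mulVec_mulVec] at h1
    simpa [Pi.star_single] using h1
  have hdiag : ∀ s, p s * a * p s ∈ Submodule.span ℂ (Set.range p) := by
    intro s
    obtain ⟨c, hc⟩ := exists_compression_eq_smul (π (p s)) (π a) (hπstar s) (hπidem s) (H' s s)
    have : p s * a * p s = c • p s := hπ (by rw [map_mul, map_mul, hc, map_smul])
    rw [this]
    exact Submodule.smul_mem _ _ (Submodule.subset_span ⟨s, rfl⟩)
  have hdecomp : a = ∑ s, p s * a * p s := by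
    calc a = (∑ s, p s) * a * ∑ r, p r := by rw [hsum, one_mul, mul_one]
      _ = ∑ s, ∑ r, p s * a * p r := by simp_rw [Finset.sum_mul, Finset.mul_sum]
      _ = ∑ s, p s * a * p s := Finset.sum_congr rfl fun s _ =>
          Finset.sum_eq_single s (fun r _ hr => hoff s r hr.symm) (by simp)
  rw [hdecomp]
  exact Submodule.sum_mem _ fun s _ => hdiag s

theorem exists_frame (p : ι → A) (hstar : ∀ i, star (p i) = p i)
    (hidem : ∀ i, p i * p i = p i) (horth : ∀ i k, i ≠ k → p i * p k = 0) (hsum : ∑ i, p i = 1)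
    (π : A →⋆ₐ[ℂ] Matrix h h ℂ) (hπ : Function.Injective π) :
    ∃ (β : Type) (_ : Fintype β), Nonempty (Frame p π β) := by
  classical
  let W := Submodule.span ℂ (Set.range p)
  let σ := {q : (ι × ι) × (h → ℂ) × (h → ℂ) // π (p q.1.1) *ᵥ q.2.1 = q.2.1 ∧
    π (p q.1.2) *ᵥ q.2.2 = q.2.2 ∧ star q.2.1 ⬝ᵥ q.2.2 = 0 ∧ star q.2.1 ⬝ᵥ q.2.1 = 1 ∧
    star q.2.2 ⬝ᵥ q.2.2 = 1}
  have : FiniteDimensional ℂ A :=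
    FiniteDimensional.of_injective (π : A →ₐ[ℂ] Matrix h h ℂ).toLinearMap hπ
  obtain ⟨β, hβ, i, e, he⟩ := exists_finite_frame W (fun q : σ => coeff π q.1.2.1 q.1.2.2)
    fun a ha => mem_span_of_coeff_eq_zero p hstar hidem horth hsum π hπ a
      fun s r y x h1 h2 h3 h4 h5 => ha ⟨((s, r), y, x), h1, h2, h3, h4, h5⟩
  have hpW : ∀ k l, ∀ w ∈ W, p k * w * p l ∈ W := by
    intro k l w hw
    induction hw using Submodule.span_induction with
    | mem w hw =>
      obtain ⟨m, rfl⟩ := hw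
      by_cases hkm : k = m
      · subst hkm
        rw [hidem]
        by_cases hkl : k = l
        · subst hkl; rw [hidem]; exact Submodule.subset_span ⟨k, rfl⟩
        · rw [horth _ _ hkl]; exact zero_mem _
      · rw [horth _ _ hkm, zero_mul]; exact zero_mem _
    | zero => simp
    | add x y _ _ hx hy => rw [mul_add, add_mul]; exact add_mem hx hy
    | smul c x _ hx =>
      rw [mul_smul_comm, smul_mul_assoc]; exact Submodule.smul_mem _ _ hx
  let s : β → ι := fun b => (i b).1.1.1
  let r : β → ι := fun b => (i b).1.1.2
  let η : β → h → ℂ := fun b => (i b).1.2.1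
  let ξ : β → h → ℂ := fun b => (i b).1.2.2
  have hpη : ∀ b, π (p (s b)) *ᵥ η b = η b := fun b => (i b).2.1
  have hpξ : ∀ b, π (p (r b)) *ᵥ ξ b = ξ b := fun b => (i b).2.2.1
  have hcoef : ∀ a k l b, coeff π (η b) (ξ b) (p k * a * p l) =
      if k = s b ∧ l = r b then coeff π (η b) (ξ b) a else 0 := by
    intro a k l b
    have h1 := mulVec_eq_ite p horth π (hpη b) k
    have h2 := mulVec_eq_ite p horth π (hpξ b) l
    have h3 : coeff π (η b) (ξ b) (p k * a * p l) =
        star (π (p k) *ᵥ η b) ⬝ᵥ (π a *ᵥ (π (p l) *ᵥ ξ b)) := by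
      rw [star_mulVec, ← star_eq_conjTranspose, ← map_star, hstar, ← dotProduct_mulVec,
        mulVec_mulVec, mulVec_mulVec, ← map_mul, ← map_mul]
      rfl
    rw [h3, h1, h2]
    by_cases hk : k = s b <;> by_cases hl : l = r b <;> simp [hk, hl, coeff]
  refine ⟨β, hβ, ⟨⟨s, r, η, ξ, fun b => p (s b) * e b * p (r b), hpη, hpξ,
    fun b => (i b).2.2.2.1, fun b => (i b).2.2.2.2.1,
    fun b => (i b).2.2.2.2.2, fun b => ?_, fun b => ?_, fun a => ?_⟩⟩⟩
  · rw [← mul_assoc, ← mul_assoc, hidem]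
  · rw [mul_assoc, hidem]
  · have hblock : ∀ k l, p k * a * p l - ∑ b, (if k = s b ∧ l = r b then
        coeff π (η b) (ξ b) a else 0) • (p k * e b * p l) ∈ W := by
      intro k l
      have := hpW k l _ (he (p k * a * p l))
      rw [mul_sub, sub_mul, Finset.mul_sum, Finset.sum_mul] at this
      convert this using 2
      · rw [← mul_assoc, ← mul_assoc, hidem, mul_assoc, mul_assoc, mul_assoc, hidem]
      · refine Finset.sum_congr rfl fun b _ => ?_
        rw [mul_smul_comm, smul_mul_assoc]
        exact congrArg (· • _) (hcoef a k l b).symm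
    have hfin := Submodule.sum_mem W fun k (_ : k ∈ Finset.univ) =>
      Submodule.sum_mem W fun l (_ : l ∈ Finset.univ) => hblock k l
    convert hfin using 1
    simp_rw [Finset.sum_sub_distrib]
    congr 1
    · calc a = (∑ s, p s) * a * ∑ r, p r := by rw [hsum, one_mul, mul_one]
        _ = ∑ s, ∑ r, p s * a * p r := by simp_rw [Finset.sum_mul, Finset.mul_sum]
    · symm
      calc _ = ∑ k, ∑ b, ∑ l, (if k = s b ∧ l = r b then coeff π (η b) (ξ b) a else 0) •
            (p k * e b * p l) := Finset.sum_congr rfl fun k _ => Finset.sum_comm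
        _ = ∑ b, ∑ k, ∑ l, (if k = s b ∧ l = r b then coeff π (η b) (ξ b) a else 0) •
            (p k * e b * p l) := Finset.sum_comm
        _ = _ := Finset.sum_congr rfl fun b _ => by
            simp [ite_and, coeff, ite_smul]

end Frames

section Link

variable {h : Type} [Fintype h]

/-- The `j`-th column is the vector with entry `ξ j` at level `j` and `η j` at level `j + 1`. -/
def linkMatrix (g : ℕ) (ξ η : ℕ → h → ℂ) : Matrix (h × Fin (g + 1)) (Fin g) ℂ :=
  Matrix.of fun x j =>
    (if x.2 = j.castSucc then ξ j x.1 else 0) + (if x.2 = j.succ then η j x.1 else 0)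

theorem linkMatrix_conjTranspose_mulVec (g : ℕ) (ξ η : ℕ → h → ℂ) (y : h × Fin (g + 1) → ℂ)
    (j : Fin g) : ((linkMatrix g ξ η)ᴴ *ᵥ y) j =
      star (ξ j) ⬝ᵥ (fun i => y (i, j.castSucc)) + star (η j) ⬝ᵥ (fun i => y (i, j.succ)) := by
  simp only [mulVec, dotProduct, linkMatrix, conjTranspose_apply, of_apply, star_add,
    Fintype.sum_prod_type, add_mul, Finset.sum_add_distrib]
  congr 1 <;> refine Finset.sum_congr rfl fun i _ => ?_ <;>
    simp [apply_ite (starRingEnd ℂ)]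

theorem linkMatrix_conjTranspose_mul_self (g : ℕ) (ξ η : ℕ → h → ℂ)
    (hξ : ∀ j < g, star (ξ j) ⬝ᵥ ξ j = 1) (hη : ∀ j < g, star (η j) ⬝ᵥ η j = 1)
    (horth : ∀ j < g, star (η j) ⬝ᵥ ξ (j + 1) = 0) :
    (linkMatrix g ξ η)ᴴ * linkMatrix g ξ η = (2 : ℂ) • 1 := by
  have horth' : ∀ j < g, star (ξ (j + 1)) ⬝ᵥ η j = 0 := fun j hj => by
    have : star (star (η j) ⬝ᵥ ξ (j + 1)) = star (ξ (j + 1)) ⬝ᵥ η j := by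
      rw [← star_dotProduct_star, star_star]
    rw [← this, horth j hj, star_zero]
  ext j k
  have h1 := linkMatrix_conjTranspose_mulVec g ξ η (fun x => linkMatrix g ξ η x k) j
  change _ = _ at h1
  have h2 : ((linkMatrix g ξ η)ᴴ * linkMatrix g ξ η) j k =
    ((linkMatrix g ξ η)ᴴ *ᵥ fun x => linkMatrix g ξ η x k) j := rfl
  rw [h2, h1]
  simp only [linkMatrix, of_apply, Matrix.smul_apply, one_apply]
  rcases lt_trichotomy j.val k.val with hjk | hjk | hjk
  · have e1 : j.castSucc ≠ k.castSucc := by simp [Fin.ext_iff]; omega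
    have e2 : j.castSucc ≠ k.succ := by simp [Fin.ext_iff]; omega
    have e3 : j.succ ≠ k.succ := by simp [Fin.ext_iff]; omega
    have e4 : j ≠ k := by simp [Fin.ext_iff]; omega
    simp only [e1, e2, e3, e4, if_false, add_zero]
    by_cases e5 : j.succ = k.castSucc
    · have : k.val = j.val + 1 := by simp [Fin.ext_iff] at e5; omega
      simpa [e5, this, dotProduct] using horth j j.2
    · simp [e5, dotProduct]
  · have : j = k := Fin.ext hjk
    subst this
    have e1 : j.castSucc ≠ j.succ := by simp [Fin.ext_iff]
    simp only [e1, e1.symm, if_true, if_false, add_zero, zero_add]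
    have a1 := hξ j j.2
    have a2 := hη j j.2
    change star (ξ j) ⬝ᵥ ξ j + star (η j) ⬝ᵥ η j = _
    rw [a1, a2]; norm_num
  · have e1 : j.castSucc ≠ k.castSucc := by simp [Fin.ext_iff]; omega
    have e2 : j.succ ≠ k.castSucc := by simp [Fin.ext_iff]; omega
    have e3 : j.succ ≠ k.succ := by simp [Fin.ext_iff]; omega
    have e4 : j ≠ k := by simp [Fin.ext_iff]; omega
    simp only [e1, e2, e3, e4, if_false, zero_add]
    by_cases e5 : j.castSucc = k.succ
    · have : j.val = k.val + 1 := by simp [Fin.ext_iff] at e5; omega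
      simpa [e5, this, dotProduct] using horth' k k.2
    · simp [e5, dotProduct]

variable [DecidableEq h]

/-- The reflection in the orthogonal complement of the columns of `linkMatrix g ξ η`. -/
def linkReflection (g : ℕ) (ξ η : ℕ → h → ℂ) :
    Matrix (h × Fin (g + 1)) (h × Fin (g + 1)) ℂ :=
  1 - linkMatrix g ξ η * (linkMatrix g ξ η)ᴴ

theorem star_linkReflection (g : ℕ) (ξ η : ℕ → h → ℂ) :
    star (linkReflection g ξ η) = linkReflection g ξ η := by
  simp [linkReflection, star_eq_conjTranspose]

theorem linkReflection_mul_self (g : ℕ) (ξ η : ℕ → h → ℂ)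
    (hξ : ∀ j < g, star (ξ j) ⬝ᵥ ξ j = 1) (hη : ∀ j < g, star (η j) ⬝ᵥ η j = 1)
    (horth : ∀ j < g, star (η j) ⬝ᵥ ξ (j + 1) = 0) :
    linkReflection g ξ η * linkReflection g ξ η = 1 := by
  have key := linkMatrix_conjTranspose_mul_self g ξ η hξ hη horth
  set V := linkMatrix g ξ η
  have : V * Vᴴ * (V * Vᴴ) = (2 : ℂ) • (V * Vᴴ) := by
    rw [Matrix.mul_assoc, ← Matrix.mul_assoc Vᴴ, key]; simp
  change (1 - V * Vᴴ) * (1 - V * Vᴴ) = 1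
  rw [mul_sub, sub_mul, sub_mul, this, two_smul]
  simp

/-- The diagonal amplification of matrices. -/
def amplify (h κ : Type) [Fintype h] [DecidableEq h] [Fintype κ] [DecidableEq κ] :
    Matrix h h ℂ →⋆ₐ[ℂ] Matrix (h × κ) (h × κ) ℂ where
  toFun M := blockDiagonal fun _ => M
  map_one' := blockDiagonal_one
  map_mul' M N := blockDiagonal_mul (fun _ : κ => M) fun _ => N
  map_zero' := blockDiagonal_zero
  map_add' M N := blockDiagonal_add (fun _ : κ => M) fun _ => N
  commutes' c := by
    rw [Algebra.algebraMap_eq_smul_one, Algebra.algebraMap_eq_smul_one]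
    exact (blockDiagonal_smul c fun _ : κ => (1 : Matrix h h ℂ)).trans
      (congrArg _ blockDiagonal_one)
  map_star' M := (blockDiagonal_conjTranspose fun _ : κ => M).symm

theorem amplify_mulVec {κ : Type} [Fintype κ] [DecidableEq κ] (M : Matrix h h ℂ)
    (y : h × κ → ℂ) (i : h) (l : κ) :
    (amplify h κ M *ᵥ y) (i, l) = (M *ᵥ fun k => y (k, l)) i := by
  change ((blockDiagonal fun _ : κ => M) *ᵥ y) (i, l) = _
  simp only [mulVec, dotProduct, Fintype.sum_prod_type, blockDiagonal_apply]
  refine Finset.sum_congr rfl fun k _ => ?_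
  simp

theorem amplify_mul_linkReflection (g : ℕ) (ξ η : ℕ → h → ℂ) (M : Matrix h h ℂ) (hM : Mᴴ = M)
    (ε : ℕ → Prop) [DecidablePred ε] (hξ : ∀ j < g, M *ᵥ ξ j = if ε j then ξ j else 0)
    (hη : ∀ j < g, M *ᵥ η j = if ε j then η j else 0) :
    amplify h (Fin (g + 1)) M * linkReflection g ξ η =
      linkReflection g ξ η * amplify h (Fin (g + 1)) M := by
  set V := linkMatrix g ξ η with hV
  set S := amplify h (Fin (g + 1)) M with hS
  let Δ : Matrix (Fin g) (Fin g) ℂ := diagonal fun j => if ε j then 1 else 0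
  have hΔ : Δᴴ = Δ := by
    rw [diagonal_conjTranspose]
    congr 1
    ext j
    by_cases hj : ε j <;> simp [hj]
  have hSS : Sᴴ = S := by
    rw [← star_eq_conjTranspose, hS, ← map_star, star_eq_conjTranspose, hM]
  have hSV : S * V = V * Δ := by
    ext ⟨i, l⟩ j
    have h1 : (S * V) (i, l) j = (S *ᵥ fun x => V x j) (i, l) := rfl
    rw [h1, hS, amplify_mulVec, mul_diagonal]
    have h2 : (fun k => V (k, l) j) =
        (if l = j.castSucc then ξ j else 0) + (if l = j.succ then η j else 0) := by
      ext k
      simp only [hV, linkMatrix, of_apply, Pi.add_apply]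
      congr 1 <;> split_ifs <;> rfl
    rw [h2, mulVec_add, apply_ite (M *ᵥ ·), apply_ite (M *ᵥ ·), hξ j j.2, hη j j.2]
    simp only [hV, linkMatrix, of_apply]
    by_cases hj : ε j <;> by_cases h3 : l = j.castSucc <;> by_cases h4 : l = j.succ <;>
      simp only [hj, h3, h4, if_true, if_false, mulVec_zero, ite_self, Pi.zero_apply, Pi.add_apply,
        ite_apply, mul_one, mul_zero, add_zero]
  have hVS : Vᴴ * S = Δ * Vᴴ := by
    have := congrArg conjTranspose hSV
    rwa [conjTranspose_mul, conjTranspose_mul, hSS, hΔ] at this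
  change S * (1 - V * Vᴴ) = (1 - V * Vᴴ) * S
  rw [mul_sub, sub_mul, mul_one, one_mul, ← Matrix.mul_assoc, hSV, Matrix.mul_assoc,
    Matrix.mul_assoc, hVS]

theorem linkReflection_mulVec_of_supported (g : ℕ) (ξ η : ℕ → h → ℂ)
    (y : h × Fin (g + 1) → ℂ) (k : Fin g) (hy : ∀ i (l : Fin (g + 1)), l.val ≤ k → y (i, l) = 0) :
    (∀ i (l : Fin (g + 1)), l.val < k → (linkReflection g ξ η *ᵥ y) (i, l) = 0) ∧
    (fun i => (linkReflection g ξ η *ᵥ y) (i, k.castSucc)) =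
      -(star (η k) ⬝ᵥ fun i => y (i, k.succ)) • ξ k := by
  set w := (linkMatrix g ξ η)ᴴ *ᵥ y with hw
  have hw0 : ∀ j : Fin g, j.val < k → w j = 0 := by
    intro j hj
    rw [hw, linkMatrix_conjTranspose_mulVec]
    have e1 : (fun i => y (i, j.castSucc)) = 0 := by
      ext i; exact hy i _ (by simp; omega)
    have e2 : (fun i => y (i, j.succ)) = 0 := by
      ext i; exact hy i _ (by simp; omega)
    rw [e1, e2, dotProduct_zero, dotProduct_zero, add_zero]
  have hwk : w k = star (η k) ⬝ᵥ fun i => y (i, k.succ) := by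
    rw [hw, linkMatrix_conjTranspose_mulVec]
    have e1 : (fun i => y (i, k.castSucc)) = 0 := by
      ext i; exact hy i _ (by simp)
    rw [e1, dotProduct_zero, zero_add]
  have hu : ∀ x, (linkReflection g ξ η *ᵥ y) x = y x - ∑ j, linkMatrix g ξ η x j * w j := by
    intro x
    rw [linkReflection, sub_mulVec, one_mulVec, ← mulVec_mulVec]
    rfl
  constructor
  · intro i l hl
    rw [hu, hy i l hl.le, Finset.sum_eq_zero, sub_zero]
    intro j _
    rcases lt_or_ge j.val k.val with hj | hj
    · rw [hw0 j hj, mul_zero]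
    · have e1 : l ≠ j.castSucc := by simp [Fin.ext_iff]; omega
      have e2 : l ≠ j.succ := by simp [Fin.ext_iff]; omega
      simp [linkMatrix, e1, e2]
  · ext i
    rw [hu, hy i _ (by simp), Finset.sum_eq_single k]
    · have e2 : k.castSucc ≠ k.succ := by simp [Fin.ext_iff]
      simp [linkMatrix, e2, hwk, mul_comm]
    · intro j _ hjk
      rcases lt_or_ge j.val k.val with hj | hj
      · rw [hw0 j hj, mul_zero]
      · have e0 : j.val ≠ k.val := fun h => hjk (Fin.ext h)
        have e1 : k.castSucc ≠ j.castSucc := by simp [Fin.ext_iff]; omega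
        have e2 : k.castSucc ≠ j.succ := by simp [Fin.ext_iff]; omega
        simp [linkMatrix, e1, e2]
    · simp

/-- The product `M 0 * u * M 1 * u * ⋯ * M (n - 1) * u`. -/
def interlaced {k : Type} [Fintype k] [DecidableEq k] (u : Matrix k k ℂ) :
    ℕ → (ℕ → Matrix k k ℂ) → Matrix k k ℂ
  | 0, _ => 1
  | n + 1, M => M 0 * u * interlaced u n fun i => M (i + 1)

theorem interlaced_linkReflection_mulVec (g : ℕ) (ξ η : ℕ → h → ℂ)
    (hu : linkReflection g ξ η * linkReflection g ξ η = 1) (Ω : h × Fin (g + 1) → ℂ)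
    (hΩ : ∀ i l, Ω (i, l) = if l = Fin.last g then ξ g i else 0) (n k : ℕ) (hk : k + n = g)
    (M : ℕ → Matrix h h ℂ) :
    (∀ i (l : Fin (g + 1)), l.val < k →
      (interlaced (linkReflection g ξ η) (n + 1) (fun i => amplify h _ (M i)) *ᵥ
        (linkReflection g ξ η *ᵥ Ω)) (i, l) = 0) ∧
    ∀ l : Fin (g + 1), l.val = k →
      (fun i => (interlaced (linkReflection g ξ η) (n + 1) (fun i => amplify h _ (M i)) *ᵥ
        (linkReflection g ξ η *ᵥ Ω)) (i, l)) =
      (∏ j ∈ Finset.range n, -(star (η (k + j)) ⬝ᵥ (M (j + 1) *ᵥ ξ (k + j + 1)))) •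
        (M 0 *ᵥ ξ k) := by
  induction n generalizing k M with
  | zero =>
    have h0 : interlaced (linkReflection g ξ η) (0 + 1) (fun i => amplify h _ (M i)) *ᵥ
        (linkReflection g ξ η *ᵥ Ω) = amplify h _ (M 0) *ᵥ Ω := by
      rw [interlaced, interlaced, mul_one, mulVec_mulVec, mul_assoc, hu, mul_one]
    rw [h0]
    constructor
    · intro i l hl
      have e1 : l ≠ Fin.last g := by simp [Fin.ext_iff]; omega
      have e2 : (fun k => Ω (k, l)) = 0 := by ext k; simp [hΩ, e1]
      rw [amplify_mulVec, e2, mulVec_zero]; rfl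
    · intro l hl
      have e1 : l = Fin.last g := by simp [Fin.ext_iff]; omega
      have e2 : (fun k => Ω (k, l)) = ξ g := by ext k; simp [hΩ, e1]
      ext i
      rw [amplify_mulVec, e2]
      obtain rfl : k = g := by omega
      simp
  | succ n ih =>
    obtain ⟨ih1, ih2⟩ := ih (k + 1) (by omega) fun i => M (i + 1)
    set y := interlaced (linkReflection g ξ η) (n + 1) (fun i => amplify h _ (M (i + 1))) *ᵥ
        (linkReflection g ξ η *ᵥ Ω) with hy
    have h0 : interlaced (linkReflection g ξ η) (n + 1 + 1) (fun i => amplify h _ (M i)) *ᵥ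
        (linkReflection g ξ η *ᵥ Ω) =
        amplify h _ (M 0) *ᵥ (linkReflection g ξ η *ᵥ y) := by
      rw [interlaced, ← mulVec_mulVec, ← mulVec_mulVec]
    rw [h0]
    let K : Fin g := ⟨k, by omega⟩
    obtain ⟨r1, r2⟩ := linkReflection_mulVec_of_supported g ξ η y K
      fun i l hl => ih1 i l (by simp [K] at hl; omega)
    constructor
    · intro i l hl
      have e2 : (fun k => (linkReflection g ξ η *ᵥ y) (k, l)) = 0 := by
        ext k; exact r1 k l hl
      rw [amplify_mulVec, e2, mulVec_zero]; rfl
    · intro l hl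
      obtain rfl : l = K.castSucc := Fin.ext hl
      ext i
      rw [amplify_mulVec, r2, ih2 K.succ (by simp [K]), mulVec_smul, dotProduct_smul,
        Finset.prod_range_succ']
      simp only [K, Pi.smul_apply, smul_eq_mul, add_zero, neg_mul, mul_neg, zero_add]
      have e : ∀ j, k + 1 + j = k + (j + 1) := fun j => by omega
      simp only [e]

end Link

section ResidualFiniteness

/-- Reindexing of matrices as a star-algebra homomorphism. -/
def reindexStarAlgHom {k l : Type} [Fintype k] [DecidableEq k] [Fintype l] [DecidableEq l]
    (e : k ≃ l) : Matrix k k ℂ →⋆ₐ[ℂ] Matrix l l ℂ where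
  __ := (reindexAlgEquiv ℂ ℂ e).toAlgHom
  map_star' _ := rfl

theorem isRFD_of_separated {C : Type} [Ring C] [Algebra ℂ C] [StarRing C]
    (H : ∀ x : C, (∀ (k : Type) [Fintype k] [DecidableEq k] (φ : C →⋆ₐ[ℂ] Matrix k k ℂ),
      φ x = 0) → x = 0) : IsRFD C := by
  let Φ : C →⋆ₐ[ℂ] ∀ i : Σ n : ℕ, (C →⋆ₐ[ℂ] Matrix (Fin n) (Fin n) ℂ),
      Matrix (Fin i.1) (Fin i.1) ℂ :=
    { toFun := fun x i => i.2 x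
      map_one' := funext fun i => map_one i.2
      map_mul' := fun x y => funext fun i => map_mul i.2 x y
      map_zero' := funext fun i => map_zero i.2
      map_add' := fun x y => funext fun i => map_add i.2 x y
      commutes' := fun c => funext fun i => AlgHomClass.commutes i.2 c
      map_star' := fun x => funext fun i => map_star i.2 x }
  refine ⟨_, _, Φ, (injective_iff_map_eq_zero Φ).2 fun x hx => H x fun k _ _ φ => ?_⟩
  have := congrFun hx ⟨Fintype.card k, (reindexStarAlgHom (Fintype.equivFin k)).comp φ⟩
  exact (reindexAlgEquiv ℂ ℂ (Fintype.equivFin k)).injective (this.trans (map_zero _).symm)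

theorem exists_injective_matrix_rep {A : Type} [Ring A] [Algebra ℂ A] [StarRing A]
    (hA : IsFinDimCStar A) : ∃ (h : Type) (_ : Fintype h) (_ : DecidableEq h)
      (π : A →⋆ₐ[ℂ] Matrix h h ℂ), Function.Injective π := by
  obtain ⟨m, n, ⟨e⟩⟩ := hA
  let B : (∀ i : Fin m, Matrix (Fin (n i)) (Fin (n i)) ℂ) →⋆ₐ[ℂ]
      Matrix (Σ i, Fin (n i)) (Σ i, Fin (n i)) ℂ :=
    { toFun := fun M => blockDiagonal' M
      map_one' := blockDiagonal'_one
      map_mul' := blockDiagonal'_mul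
      map_zero' := blockDiagonal'_zero
      map_add' := blockDiagonal'_add
      commutes' := fun c => by
        rw [Algebra.algebraMap_eq_smul_one, Algebra.algebraMap_eq_smul_one, blockDiagonal'_smul,
          blockDiagonal'_one]
      map_star' := fun M => (blockDiagonal'_conjTranspose M).symm }
  have hB : Function.Injective B := blockDiagonal'_injective
  exact ⟨_, _, _, B.comp (StarAlgHomClass.toStarAlgHom e), hB.comp (EquivLike.injective e)⟩

end ResidualFiniteness

section Pushout

variable {A D : Type} [Ring A] [Algebra ℂ A] [StarRing A] [StarModule ℂ A]
  [Ring D] [Algebra ℂ D] [StarRing D] [StarModule ℂ D] {ι : D →⋆ₐ[ℂ] A}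
  (P : StarAlgPushout D A A ι ι)

/-- The two canonical maps into the pushout: `inl` at `false` and `inr` at `true`. -/
def incl : Bool → A →⋆ₐ[ℂ] P.carrier
  | false => P.inl
  | true => P.inr

theorem incl_eq_incl_not (c : Bool) (d : D) : incl P c (ι d) = incl P (!c) (ι d) := by
  have := DFunLike.congr_fun P.comm d
  cases c
  · exact this
  · exact this.symm

theorem mem_of_incl_mem (S : StarSubalgebra ℂ P.carrier) (hS : ∀ c a, incl P c a ∈ S)
    (x : P.carrier) : x ∈ S := by
  let i₁ : A →⋆ₐ[ℂ] S := P.inl.codRestrict S (hS false)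
  let i₂ : A →⋆ₐ[ℂ] S := P.inr.codRestrict S (hS true)
  obtain ⟨φ, ⟨h1, h2⟩, -⟩ := P.univ S i₁ i₂ (by
    ext d; exact DFunLike.congr_fun P.comm d)
  have huniq := (P.univ P.carrier P.inl P.inr P.comm).unique
    (y₁ := S.subtype.comp φ) (y₂ := StarAlgHom.id ℂ P.carrier)
    ⟨by rw [StarAlgHom.comp_assoc, h1]; rfl, by rw [StarAlgHom.comp_assoc, h2]; rfl⟩
    ⟨rfl, rfl⟩
  have : (φ x : P.carrier) = x := DFunLike.congr_fun huniq x
  exact this ▸ (φ x).2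

theorem exists_mem_wordSpan (x : P.carrier) : ∃ n, x ∈ wordSpan (incl P) false n := by
  let W := wordSpan (incl P) false
  have hmono : Monotone W := monotone_nat_of_le_succ fun n => wordSpan_le_succ _ _ n
  let Q : P.carrier → Prop := fun z => ∀ n, ∀ y ∈ W n, ∃ m, z * y ∈ W m
  have hincl : ∀ c a, Q (incl P c a) := by
    intro c a n y hy
    cases c
    · exact ⟨n + 1, mul_mem_wordSpan _ _ _ _ (hmono n.le_succ hy)⟩
    · refine ⟨n + 1 + 1 + 1, ?_⟩
      have h1 : y ∈ wordSpan (incl P) true (n + 1) := by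
        have := mul_mem_wordSpan_succ (incl P) true n 1 hy
        rwa [map_one, one_mul] at this
      have h2 := mul_mem_wordSpan_succ (incl P) false (n + 1) 1
        (mul_mem_wordSpan (incl P) true n a h1)
      rw [map_one, one_mul] at h2
      exact hmono (Nat.le_succ _) h2
  let S := StarAlgebra.adjoin ℂ {z | ∃ c a, incl P c a = z}
  have hS : ∀ z ∈ S, Q z ∧ Q (star z) := by
    intro z hz
    induction hz using StarAlgebra.adjoin_induction with
    | mem z hz =>
      obtain ⟨c, a, rfl⟩ := hz
      exact ⟨hincl c a, by rw [← map_star]; exact hincl c _⟩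
    | algebraMap r =>
      have : ∀ r : ℂ, Q (algebraMap ℂ _ r) := fun r n y hy =>
        ⟨n, by rw [← Algebra.smul_def]; exact Submodule.smul_mem _ _ hy⟩
      exact ⟨this r, by rw [← algebraMap_star_comm]; exact this _⟩
    | add y z _ _ hy hz =>
      have : ∀ y z, Q y → Q z → Q (y + z) := fun y z hy hz n w hw => by
        obtain ⟨k, hk⟩ := hy n w hw
        obtain ⟨l, hl⟩ := hz n w hw
        exact ⟨max k l, by
          rw [add_mul]
          exact add_mem (hmono (le_max_left _ _) hk) (hmono (le_max_right _ _) hl)⟩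
      exact ⟨this _ _ hy.1 hz.1, by rw [star_add]; exact this _ _ hy.2 hz.2⟩
    | mul y z _ _ hy hz =>
      have : ∀ y z, Q y → Q z → Q (y * z) := fun y z hy hz n w hw => by
        obtain ⟨k, hk⟩ := hz n w hw
        obtain ⟨l, hl⟩ := hy k _ hk
        exact ⟨l, by rwa [mul_assoc]⟩
      exact ⟨this _ _ hy.1 hz.1, by rw [star_mul]; exact this _ _ hz.2 hy.2⟩
    | star z _ hz => exact ⟨hz.2, by rw [star_star]; exact hz.1⟩
  obtain ⟨n, hn⟩ := (hS x (mem_of_incl_mem P S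
    (fun c a => StarAlgebra.subset_adjoin ℂ _ ⟨c, a, rfl⟩) x)).1 0 1
    (altWord_mem (incl P) false 0 0)
  exact ⟨n, by rwa [mul_one] at hn⟩

/-- Conjugation by a self-adjoint involution. -/
def conjInvolution {k : Type} [Fintype k] [DecidableEq k] (u : Matrix k k ℂ) (hu : star u = u)
    (huu : u * u = 1) : Matrix k k ℂ →⋆ₐ[ℂ] Matrix k k ℂ where
  toFun M := u * M * u
  map_one' := by rw [mul_one, huu]
  map_mul' M N := by
    have : u * M * u * (u * N * u) = u * M * (u * u) * N * u := by noncomm_ring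
    rw [this, huu, mul_one, mul_assoc u M N]
  map_zero' := by rw [mul_zero, zero_mul]
  map_add' M N := by rw [mul_add, add_mul]
  commutes' c := by
    rw [← Algebra.commutes, mul_assoc, huu, mul_one]
  map_star' M := by rw [star_mul, star_mul, hu, mul_assoc]

theorem sum_interlaced_eq_zero {k τ : Type} [Fintype k] [DecidableEq k] [Fintype τ] (n : ℕ)
    (w : τ → ℕ → A)
    (hw : ∀ φ : P.carrier →⋆ₐ[ℂ] Matrix k k ℂ, φ (∑ t, altWord (incl P) false n (w t)) = 0)
    (σ : A →⋆ₐ[ℂ] Matrix k k ℂ) (u : Matrix k k ℂ) (hu : star u = u) (huu : u * u = 1)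
    (hcomm : ∀ d, σ (ι d) * u = u * σ (ι d)) :
    ∑ t, interlaced u n (fun i => σ (w t i)) = 0 := by
  obtain ⟨φ, ⟨h1, h2⟩, -⟩ := P.univ _ σ ((conjInvolution u hu huu).comp σ) (by
    ext1 d
    change σ (ι d) = u * σ (ι d) * u
    rw [← hcomm, mul_assoc, huu, mul_one])
  have hl : ∀ a, φ (incl P false a) = σ a := fun a => DFunLike.congr_fun h1 a
  have hr : ∀ a, φ (incl P true a) = u * σ a * u := fun a => DFunLike.congr_fun h2 a
  have key : ∀ n c, ∃ v, ∀ a, (cond c u 1) * φ (altWord (incl P) c n a) * v =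
      interlaced u n fun i => σ (a i) := by
    intro n
    induction n with
    | zero =>
      intro c
      refine ⟨cond c u 1, fun a => ?_⟩
      cases c <;> simp [altWord, interlaced, huu]
    | succ n ih =>
      intro c
      obtain ⟨v, hv⟩ := ih (!c)
      refine ⟨v, fun a => ?_⟩
      rw [altWord, interlaced, ← hv, map_mul]
      cases c
      · simp only [cond_false, Bool.not_false, cond_true, hl, one_mul]
        simp only [mul_assoc]
        rw [← mul_assoc u u, huu, one_mul]
      · simp only [cond_true, Bool.not_true, cond_false, hr, one_mul]
        simp only [mul_assoc]
        rw [← mul_assoc u u, huu, one_mul]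
  obtain ⟨v, hv⟩ := key n false
  simp_rw [← hv]
  rw [← Finset.sum_mul, ← Finset.mul_sum, ← map_sum, hw, mul_zero, zero_mul]

end Pushout

section Separation

variable {A D : Type} [Ring A] [Algebra ℂ A] [StarRing A] [StarModule ℂ A]
  [Ring D] [Algebra ℂ D] [StarRing D] [StarModule ℂ D] {ι : D →⋆ₐ[ℂ] A}
  (P : StarAlgPushout D A A ι ι)
  {h κ : Type} [Fintype h] [DecidableEq h]

theorem sum_smul_mulVec_eq_zero (p : κ → A) (hstar : ∀ i, star (p i) = p i)
    (horth : ∀ i k, i ≠ k → p i * p k = 0)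
    (hspan : ∀ d, ι d ∈ Submodule.span ℂ (Set.range p))
    (π : A →⋆ₐ[ℂ] Matrix h h ℂ) {τ : Type} [Fintype τ] (g : ℕ) (w : τ → ℕ → A)
    (hw : ∀ (k : Type) [Fintype k] [DecidableEq k] (φ : P.carrier →⋆ₐ[ℂ] Matrix k k ℂ),
      φ (∑ t, altWord (incl P) false (g + 1) (w t)) = 0)
    (s : ℕ → κ) (ξ η : ℕ → h → ℂ)
    (hξ : ∀ j < g, star (ξ j) ⬝ᵥ ξ j = 1) (hη : ∀ j < g, star (η j) ⬝ᵥ η j = 1)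
    (hηξ : ∀ j < g, star (η j) ⬝ᵥ ξ (j + 1) = 0)
    (hpξ : ∀ j < g, π (p (s j)) *ᵥ ξ j = ξ j) (hpη : ∀ j < g, π (p (s j)) *ᵥ η j = η j) :
    π (∑ t, (∏ j ∈ Finset.range g, coeff π (η j) (ξ (j + 1)) (w t (j + 1))) • w t 0) *ᵥ ξ 0 =
      0 := by
  classical
  have huu := linkReflection_mul_self g ξ η hξ hη hηξ
  have hcomm : ∀ a ∈ Submodule.span ℂ (Set.range p),
      amplify h (Fin (g + 1)) (π a) * linkReflection g ξ η =
        linkReflection g ξ η * amplify h (Fin (g + 1)) (π a) := by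
    intro a ha
    induction ha using Submodule.span_induction with
    | mem a ha =>
      obtain ⟨i, rfl⟩ := ha
      exact amplify_mul_linkReflection g ξ η _
        (by rw [← star_eq_conjTranspose, ← map_star, hstar]) (fun j => i = s j)
        (fun j hj => mulVec_eq_ite p horth π (hpξ j hj) i)
        (fun j hj => mulVec_eq_ite p horth π (hpη j hj) i)
    | zero => simp
    | add x y _ _ hx hy => rw [map_add, map_add, add_mul, mul_add, hx, hy]
    | smul c x _ hx => rw [map_smul, map_smul, smul_mul_assoc, mul_smul_comm, hx]
  have hsum := sum_interlaced_eq_zero P (g + 1) w (hw _)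
    ((amplify h (Fin (g + 1))).comp π) _ (star_linkReflection g ξ η) huu
    fun d => hcomm _ (hspan d)
  let Ω : h × Fin (g + 1) → ℂ := fun x => if x.2 = Fin.last g then ξ g x.1 else 0
  have hlevel : ∀ t, (fun i => (interlaced (linkReflection g ξ η) (g + 1)
      (fun i => amplify h _ (π (w t i))) *ᵥ (linkReflection g ξ η *ᵥ Ω)) (i, 0)) =
      (-1 : ℂ) ^ g • (π ((∏ j ∈ Finset.range g, coeff π (η j) (ξ (j + 1)) (w t (j + 1))) • w t 0)
        *ᵥ ξ 0) := by
    intro t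
    rw [(interlaced_linkReflection_mulVec g ξ η huu Ω (fun _ _ => rfl) g 0 (zero_add g)
      fun i => π (w t i)).2 0 rfl, Finset.prod_neg, Finset.card_range, map_smul, smul_mulVec,
      smul_smul]
    simp only [zero_add]
    rfl
  have hzero : ∑ t, (-1 : ℂ) ^ g •
      (π ((∏ j ∈ Finset.range g, coeff π (η j) (ξ (j + 1)) (w t (j + 1))) • w t 0) *ᵥ ξ 0) =
      0 := by
    simp_rw [← hlevel]
    ext i
    have := congrFun (congrArg (· *ᵥ (linkReflection g ξ η *ᵥ Ω)) hsum) (i, 0)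
    simp only [sum_mulVec, Finset.sum_apply, zero_mulVec] at this
    rw [Finset.sum_apply]
    exact this
  rw [← Finset.smul_sum, smul_eq_zero_iff_right (pow_ne_zero _ (by norm_num))] at hzero
  rw [map_sum, sum_mulVec, hzero]

theorem sum_smul_mul_proj_eq_zero (p : κ → A) (hstar : ∀ i, star (p i) = p i)
    (hidem : ∀ i, p i * p i = p i) (horth : ∀ i k, i ≠ k → p i * p k = 0)
    (hspan : ∀ d, ι d ∈ Submodule.span ℂ (Set.range p))
    (π : A →⋆ₐ[ℂ] Matrix h h ℂ) (hπ : Function.Injective π) {β : Type} [Fintype β]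
    (F : Frame p π β) {τ : Type} [Fintype τ] (g : ℕ) (w : τ → ℕ → A)
    (hw : ∀ (k : Type) [Fintype k] [DecidableEq k] (φ : P.carrier →⋆ₐ[ℂ] Matrix k k ℂ),
      φ (∑ t, altWord (incl P) false (g + 1) (w t)) = 0)
    (b : ℕ → β) (hb : ∀ k, k + 1 < g → F.r (b k) = F.s (b (k + 1))) :
    (∑ t, (∏ j ∈ Finset.range g, coeff π (F.η (b j)) (F.ξ (b j)) (w t (j + 1))) • w t 0) *
      p (F.s (b 0)) = 0 := by
  apply hπ
  rw [map_mul, map_zero]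
  apply Matrix.ext_of_mulVec_single
  intro i
  rw [zero_mulVec, ← mulVec_mulVec]
  set x := π (p (F.s (b 0))) *ᵥ Pi.single i 1 with hx
  by_cases hx0 : x = 0
  · rw [hx0, mulVec_zero]
  obtain ⟨c, hc, hc1⟩ := exists_smul_unit hx0
  have := sum_smul_mulVec_eq_zero P p hstar horth hspan π g w hw (fun j => F.s (b j))
    (seqCons (c • x) fun j => F.ξ (b j)) (fun j => F.η (b j))
    (fun j _ => by cases j; exacts [hc1, F.unit_ξ _])
    (fun j _ => F.unit_η _) (fun j _ => F.orth _)
    (fun j hj => by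
      cases j with
      | zero =>
        change _ *ᵥ (c • x) = c • x
        rw [mulVec_smul, hx, mulVec_mulVec, ← map_mul, hidem]
      | succ j => rw [← hb j hj]; exact F.proj_ξ _)
    (fun j _ => F.proj_η _)
  change _ *ᵥ (c • x) = 0 at this
  rw [mulVec_smul, smul_eq_zero_iff_right hc] at this
  exact this

theorem mem_wordSpan_of_separated [Fintype κ] (p : κ → A) (hstar : ∀ i, star (p i) = p i)
    (hidem : ∀ i, p i * p i = p i) (horth : ∀ i k, i ≠ k → p i * p k = 0) (hsum : ∑ i, p i = 1)
    (hspan : ∀ d, ι d ∈ Submodule.span ℂ (Set.range p)) (hrange : ∀ i, ∃ d, ι d = p i)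
    (π : A →⋆ₐ[ℂ] Matrix h h ℂ) (hπ : Function.Injective π) (g : ℕ) {x : P.carrier}
    (hx : ∀ (k : Type) [Fintype k] [DecidableEq k] (φ : P.carrier →⋆ₐ[ℂ] Matrix k k ℂ), φ x = 0)
    (hmem : x ∈ wordSpan (incl P) false (g + 1 + 1)) : x ∈ wordSpan (incl P) false (g + 1) := by
  have hp : ∀ c i, incl P c (p i) = incl P (!c) (p i) := fun c i => by
    obtain ⟨d, hd⟩ := hrange i
    rw [← hd, incl_eq_incl_not]
  have hD : ∀ c, ∀ a ∈ Submodule.span ℂ (Set.range p), incl P c a = incl P (!c) a := by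
    intro c a ha
    induction ha using Submodule.span_induction with
    | mem a ha => obtain ⟨i, rfl⟩ := ha; exact hp c i
    | zero => simp
    | add x y _ _ hx hy => rw [map_add, map_add, hx, hy]
    | smul r x _ hx => rw [map_smul, map_smul, hx]
  obtain ⟨β, _, ⟨F⟩⟩ := exists_frame p hstar hidem horth hsum π hπ
  obtain ⟨m, w, rfl⟩ := exists_eq_sum_altWord _ _ _ hmem
  let f : β → A →ₗ[ℂ] ℂ := fun b => coeff π (F.η b) (F.ξ b)
  have hzero : ∑ t, incl P false (w t 0) *
      altWord (incl P) true (g + 1) (fun k => ∑ b, f b (w t (k + 1)) • F.e b) = 0 := by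
    cases isEmpty_or_nonempty β
    · simp [altWord]
    refine sum_mul_altWord_eq_zero (incl P) f F.e true (g + 1) (fun t => incl P false (w t 0))
      (fun t k => w t (k + 1)) fun b => ?_
    by_cases hb : ∀ k, k + 1 < g + 1 → F.r (b k) = F.s (b (k + 1))
    · have hY := sum_smul_mul_proj_eq_zero P p hstar hidem horth hspan π hπ F (g + 1) w hx b hb
      simp_rw [← smul_mul_assoc, ← map_smul]
      rw [← Finset.sum_mul, ← map_sum, altWord, ← F.left_mul, map_mul, hp true, Bool.not_true,
        ← mul_assoc, ← mul_assoc, ← map_mul]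
      erw [hY]
      rw [map_zero, zero_mul, zero_mul]
    · push Not at hb
      obtain ⟨k, hk, hb⟩ := hb
      refine Finset.sum_eq_zero fun t _ => ?_
      rw [altWord_eq_zero_of_not_composable (incl P) p (hp true) horth F.s F.r F.e F.left_mul
        F.mul_right true (g + 1) b k hk hb, mul_zero, smul_zero]
  rw [← sub_zero (∑ t, altWord (incl P) false (g + 1 + 1) (w t)), ← hzero,
    ← Finset.sum_sub_distrib]
  refine Submodule.sum_mem _ fun t _ => ?_
  have := altWord_zero_sub_mem (incl P) _ hD true (g + 1) (w t 0) (fun k => w t (k + 1))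
    (fun k => ∑ b, f b (w t (k + 1)) • F.e b) fun k => F.sub_mem _
  rwa [mul_sub] at this

theorem eq_zero_of_separated [Fintype κ] (p : κ → A) (hstar : ∀ i, star (p i) = p i)
    (hidem : ∀ i, p i * p i = p i) (horth : ∀ i k, i ≠ k → p i * p k = 0) (hsum : ∑ i, p i = 1)
    (hspan : ∀ d, ι d ∈ Submodule.span ℂ (Set.range p)) (hrange : ∀ i, ∃ d, ι d = p i)
    (π : A →⋆ₐ[ℂ] Matrix h h ℂ) (hπ : Function.Injective π) {x : P.carrier}
    (hx : ∀ (k : Type) [Fintype k] [DecidableEq k] (φ : P.carrier →⋆ₐ[ℂ] Matrix k k ℂ),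
      φ x = 0) : x = 0 := by
  obtain ⟨n, hn⟩ := exists_mem_wordSpan P x
  have hone : x ∈ wordSpan (incl P) false (0 + 1) := by
    replace hn := wordSpan_le_succ _ _ _ hn
    induction n with
    | zero => exact hn
    | succ n ih =>
      exact ih (mem_wordSpan_of_separated P p hstar hidem horth hsum hspan hrange π hπ n hx hn)
  obtain ⟨m, w, rfl⟩ := exists_eq_sum_altWord _ _ _ hone
  have h1 := sum_interlaced_eq_zero P 1 w (hx h) π 1 (star_one _) (one_mul 1)
    fun d => by rw [mul_one, one_mul]
  simp only [interlaced, mul_one] at h1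
  rw [← map_sum] at h1
  have h2 := hπ (h1.trans (map_zero π).symm)
  simp only [altWord, mul_one]
  rw [← map_sum, h2, map_zero]

end Separation

end AmalgamatedSquare

/-- Lemma 2.16 of the paper: if `A` is a finite-dimensional C*-algebra and `D ⊆ A` a
finite-dimensional commutative C*-subalgebra, then `A ∗_D A` is residually
finite-dimensional. -/
theorem starAlgPushout_self_finDim_isRFD (A : Type)
    [Ring A] [Algebra ℂ A] [StarRing A] [StarModule ℂ A]
    (hA : IsFinDimCStar A)
    (D : Type) [CommRing D] [Algebra ℂ D] [StarRing D] [StarModule ℂ D]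
    (hD : IsSpannedByOrthProjections D)
    (ι : D →⋆ₐ[ℂ] A) (hι : Function.Injective ι)
    (P : StarAlgPushout D A A ι ι) : IsRFD P.carrier := by
  obtain ⟨m, p, hstar, hidem, horth, hsum, hspan⟩ := hD
  obtain ⟨h, _, _, π, hπ⟩ := AmalgamatedSquare.exists_injective_matrix_rep hA
  refine AmalgamatedSquare.isRFD_of_separated fun x hx =>
    AmalgamatedSquare.eq_zero_of_separated P (fun i => ι (p i))
      (fun i => by rw [← map_star, hstar]) (fun i => by rw [← map_mul, hidem])
      (fun i k hik => by rw [← map_mul, horth i k hik, map_zero])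
      (by rw [← map_sum, hsum, map_one]) (fun d => ?_) (fun i => ⟨p i, rfl⟩) π hπ hx
  have hd : d ∈ Submodule.span ℂ (Set.range p) := hspan ▸ Submodule.mem_top
  have := Submodule.mem_map_of_mem (f := (ι : D →ₐ[ℂ] A).toLinearMap) hd
  rwa [Submodule.map_span, ← Set.range_comp] at this
end
end

section
/- Let A be a residually finite-dimensional complex *-algebra and let D ⊆ A be a unital commutative *-subalgebra spanned over ℂ by finitely many pairwise orthogonal self-adjoint idempotents summing to 1 (i.e. a finite-dimensional commutative C*-subalgebra). Then the amalgamated free product A ∗_D A is residually finite-dimensional. -/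
noncomputable section

section

open Matrix
open scoped ComplexOrder

theorem exists_finite_dual_family {V : Type*} [AddCommGroup V] [Module ℂ V] [FiniteDimensional ℂ V]
    (S : Set (Module.Dual ℂ V)) :
    ∃ (m : ℕ) (φ : Fin m → Module.Dual ℂ V) (e : Fin m → V), (∀ j, φ j ∈ S) ∧
      ∀ v, ∀ ψ ∈ S, ψ (v - ∑ j, φ j v • e j) = 0 := by
  obtain ⟨b, hbS, hspan, hli⟩ := exists_linearIndependent ℂ S
  classical
  have hfin : Finite b := hli.finite
  obtain ⟨m, ⟨σ⟩⟩ := Finite.exists_equiv_fin b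
  let B := Module.Basis.extend (LinearIndependent.linearIndepOn_id hli)
  let inc : b → ((LinearIndependent.linearIndepOn_id hli).extend (Set.subset_univ _)) := fun x =>
    ⟨x, (LinearIndependent.linearIndepOn_id hli).subset_extend _ (by simp)⟩
  let e : Fin m → V := fun j => (Module.evalEquiv ℂ V).symm (B.coord (inc (σ.symm j)))
  have he : ∀ i j, (σ.symm i : Module.Dual ℂ V) (e j) = if i = j then 1 else 0 := by
    intro i j
    have h1 : (σ.symm i : Module.Dual ℂ V) = B (inc (σ.symm i)) := by simp [B, inc]
    have h2 : ∀ f : Module.Dual ℂ V, f (e j) = B.coord (inc (σ.symm j)) f := by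
      intro f
      simp [e]
    rw [h2, h1, Module.Basis.coord_apply, B.repr_self, Finsupp.single_apply]
    have : inc (σ.symm i) = inc (σ.symm j) ↔ i = j := by
      simp [inc, Subtype.ext_iff, Subtype.val_inj]
    simp [this]
  refine ⟨m, fun j => σ.symm j, e, fun j => hbS (σ.symm j).2, fun v ψ hψ => ?_⟩
  have hψ' : ψ ∈ Submodule.span ℂ b := hspan ▸ Submodule.subset_span hψ
  clear hψ
  induction hψ' using Submodule.span_induction with
  | mem x hx =>
    have := he (σ ⟨x, hx⟩)
    simp only [Equiv.symm_apply_apply] at this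
    simp [this]
  | zero => simp
  | add x y _ _ hx hy => rw [LinearMap.add_apply, hx, hy, add_zero]
  | smul c x _ hx => rw [LinearMap.smul_apply, hx, smul_zero]

theorem exists_smul_dotProduct_eq_one {κ : Type*} [Fintype κ] {v : κ → ℂ} (hv : v ≠ 0) :
    ∃ c : ℂ, c ≠ 0 ∧ star (c • v) ⬝ᵥ (c • v) = 1 := by
  have h0 : 0 < star v ⬝ᵥ v := Matrix.dotProduct_star_self_pos_iff.2 hv
  obtain ⟨r, hr, hrv⟩ : ∃ r : ℝ, 0 < r ∧ star v ⬝ᵥ v = r := by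
    obtain ⟨h1, h2⟩ := Complex.lt_def.1 h0
    exact ⟨(star v ⬝ᵥ v).re, h1, Complex.ext rfl (by simpa using h2.symm)⟩
  have hs : (Real.sqrt r) ≠ 0 := (Real.sqrt_pos.2 hr).ne'
  refine ⟨((Real.sqrt r)⁻¹ : ℝ), by simpa using hs, ?_⟩
  have : (Real.sqrt r)⁻¹ * ((Real.sqrt r)⁻¹ * r) = 1 := by
    field_simp
    rw [Real.sq_sqrt hr.le]
  rw [star_smul, smul_dotProduct, dotProduct_smul, hrv]
  simp only [Complex.star_def, Complex.conj_ofReal, smul_eq_mul]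
  exact_mod_cast this

theorem forall_of_forall_unit {κ : Type*} [Fintype κ] {P R B : Matrix κ κ ℂ} {C : Prop}
    (h : ∀ η ξ : κ → ℂ, P *ᵥ η = η → R *ᵥ ξ = ξ → star η ⬝ᵥ η = 1 → star ξ ⬝ᵥ ξ = 1 →
      (C → star η ⬝ᵥ ξ = 0) → star η ⬝ᵥ (B *ᵥ ξ) = 0)
    (η ξ : κ → ℂ) (hη : P *ᵥ η = η) (hξ : R *ᵥ ξ = ξ) (ho : C → star η ⬝ᵥ ξ = 0) :
    star η ⬝ᵥ (B *ᵥ ξ) = 0 := by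
  by_cases h1 : η = 0
  · simp [h1]
  by_cases h2 : ξ = 0
  · simp [h2]
  obtain ⟨c, hc, hc1⟩ := exists_smul_dotProduct_eq_one h1
  obtain ⟨d, hd, hd1⟩ := exists_smul_dotProduct_eq_one h2
  have := h (c • η) (d • ξ) (by rw [mulVec_smul, hη]) (by rw [mulVec_smul, hξ]) hc1 hd1
    (fun hC => by rw [star_smul, smul_dotProduct, dotProduct_smul, ho hC]; simp)
  rw [star_smul, smul_dotProduct, mulVec_smul, dotProduct_smul] at this
  simpa [hc, hd] using this

theorem dotProduct_mulVec_of_conjTranspose_eq {κ : Type*} [Fintype κ] {P : Matrix κ κ ℂ}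
    (hP : Pᴴ = P) (x y : κ → ℂ) : star (P *ᵥ x) ⬝ᵥ y = star x ⬝ᵥ (P *ᵥ y) := by
  rw [star_mulVec, hP, dotProduct_mulVec]

theorem eq_zero_of_forall_dotProduct {κ : Type*} [Fintype κ] [DecidableEq κ] {P R B : Matrix κ κ ℂ}
    (hR : R * R = R) (hPB : P * B = B) (hBR : B * R = B)
    (h : ∀ η ξ : κ → ℂ, P *ᵥ η = η → R *ᵥ ξ = ξ → star η ⬝ᵥ (B *ᵥ ξ) = 0) : B = 0 := by
  ext i j
  have hk : ∀ v, B *ᵥ v = 0 := fun v => by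
    rw [← dotProduct_star_self_eq_zero]
    have := h (B *ᵥ v) (R *ᵥ v) (by rw [mulVec_mulVec, hPB]) (by rw [mulVec_mulVec, hR])
    rwa [mulVec_mulVec, hBR] at this
  have := congrFun (hk (Pi.single j 1)) i
  simpa using this

theorem exists_eq_smul_of_forall_dotProduct {κ : Type*} [Fintype κ] [DecidableEq κ]
    {P B : Matrix κ κ ℂ} (hP : P * P = P) (hPB : P * B = B) (hBP : B * P = B)
    (h : ∀ η ξ : κ → ℂ, P *ᵥ η = η → P *ᵥ ξ = ξ → star η ⬝ᵥ ξ = 0 → star η ⬝ᵥ (B *ᵥ ξ) = 0) :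
    ∃ c : ℂ, B = c • P := by
  let W := LinearMap.range P.mulVecLin
  have hW : ∀ v ∈ W, P *ᵥ v = v := by
    rintro _ ⟨v, rfl⟩
    simp [hP]
  let f : W →ₗ[ℂ] W := (B.mulVecLin.domRestrict W).codRestrict W
    (fun v => ⟨B *ᵥ v, by simp [hPB]⟩)
  obtain ⟨c, hc⟩ := f.exists_eq_smul_id_of_forall_notLinearIndependent (fun v hv => by
    obtain ⟨v, hvW⟩ := v
    have hPv := hW v hvW
    set s := star v ⬝ᵥ v
    set t := star v ⬝ᵥ (B *ᵥ v)
    set z := s • (B *ᵥ v) - t • v with hz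
    have hzv : star v ⬝ᵥ z = 0 := by
      simp only [hz, dotProduct_sub, dotProduct_smul, smul_eq_mul]
      change s * t - t * s = 0
      ring
    have hvz : star z ⬝ᵥ v = 0 := by rw [star_dotProduct, hzv, star_zero]
    have hPz : P *ᵥ z = z := by
      rw [hz, mulVec_sub, mulVec_smul, mulVec_smul, hPv, mulVec_mulVec, hPB]
    have hBz := h z v hPz hPv hvz
    have hz0 : z = 0 := by
      rw [← dotProduct_star_self_eq_zero]
      nth_rewrite 2 [hz]
      rw [dotProduct_sub, dotProduct_smul, dotProduct_smul, hvz, hBz]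
      simp
    have := LinearIndependent.pair_iff.1 hv (-t) s (by
      ext1
      change -t • v + s • (B *ᵥ v) = 0
      rw [neg_smul, neg_add_eq_sub, ← hz, hz0])
    have hv0 : v = 0 := dotProduct_star_self_eq_zero.1 this.2
    exact hv.ne_zero 0 (Subtype.ext hv0))
  refine ⟨c, ?_⟩
  ext i j
  have := congrArg Subtype.val (LinearMap.congr_fun hc ⟨P *ᵥ Pi.single j 1, ⟨_, rfl⟩⟩)
  change B *ᵥ (P *ᵥ Pi.single j 1) = c • (P *ᵥ Pi.single j 1) at this
  rw [mulVec_mulVec, hBP] at this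
  simpa using congrFun this i

/-- The diagonal embedding of matrices into block diagonal matrices with equal blocks. -/
def amplification (κ o : Type*) [Fintype κ] [DecidableEq κ] [Fintype o] [DecidableEq o] :
    Matrix κ κ ℂ →⋆ₐ[ℂ] Matrix (κ × o) (κ × o) ℂ where
  toFun M := blockDiagonal fun _ => M
  map_one' := blockDiagonal_one
  map_mul' M N := blockDiagonal_mul _ _
  map_zero' := blockDiagonal_zero
  map_add' M N := blockDiagonal_add _ _
  commutes' c := by
    simp only [Algebra.algebraMap_eq_smul_one]
    rw [← blockDiagonal_one, ← blockDiagonal_smul]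
    rfl
  map_star' M := by simp [star_eq_conjTranspose]

theorem amplification_mulVec {κ o : Type*} [Fintype κ] [DecidableEq κ] [Fintype o] [DecidableEq o]
    (M : Matrix κ κ ℂ) (v : κ × o → ℂ) (x : κ) (k : o) :
    (amplification κ o M *ᵥ v) (x, k) = (M *ᵥ fun y => v (y, k)) x := by
  simp [amplification, mulVec, dotProduct, blockDiagonal_apply, Fintype.sum_prod_type]

/-- The direct sum of two finite-dimensional *-representations. -/
def starAlgHomFromBlocks {A κ κ' : Type*} [Ring A] [Algebra ℂ A] [StarRing A]
    [Fintype κ] [DecidableEq κ] [Fintype κ'] [DecidableEq κ']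
    (π : A →⋆ₐ[ℂ] Matrix κ κ ℂ) (π' : A →⋆ₐ[ℂ] Matrix κ' κ' ℂ) :
    A →⋆ₐ[ℂ] Matrix (κ ⊕ κ') (κ ⊕ κ') ℂ where
  toFun a := fromBlocks (π a) 0 0 (π' a)
  map_one' := by simp
  map_mul' a b := by simp [fromBlocks_multiply]
  map_zero' := by simp
  map_add' a b := by simp [fromBlocks_add]
  commutes' c := by
    simp [Algebra.algebraMap_eq_smul_one, ← fromBlocks_one, fromBlocks_smul]
  map_star' a := by simp [star_eq_conjTranspose, fromBlocks_conjTranspose, map_star]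

/-- Conjugation by a self-adjoint unitary. -/
def conjSymmetry {κ : Type*} [Fintype κ] [DecidableEq κ] (u : Matrix κ κ ℂ)
    (hu : u * u = 1) (hs : uᴴ = u) : Matrix κ κ ℂ →⋆ₐ[ℂ] Matrix κ κ ℂ where
  toFun M := u * M * u
  map_one' := by simp [hu]
  map_mul' a b := by
    calc u * (a * b) * u = u * a * 1 * (b * u) := by simp [mul_assoc]
      _ = u * a * u * (u * b * u) := by rw [← hu]; simp only [mul_assoc]
  map_zero' := by simp
  map_add' a b := by simp [mul_add, add_mul]
  commutes' c := by simp [Algebra.algebraMap_eq_smul_one, hu]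
  map_star' a := by simp [star_eq_conjTranspose, hs, mul_assoc]

/-- Reindexing of matrices along an equivalence, as a *-homomorphism. -/
def reindexStarAlgHom {κ κ' : Type*} [Fintype κ] [DecidableEq κ] [Fintype κ'] [DecidableEq κ']
    (e : κ ≃ κ') : Matrix κ κ ℂ →⋆ₐ[ℂ] Matrix κ' κ' ℂ where
  __ := (reindexAlgEquiv ℂ ℂ e).toAlgHom
  map_star' a := by
    simp [star_eq_conjTranspose]

theorem isRFD_of_separating {A : Type} [Ring A] [Algebra ℂ A] [StarRing A]
    (h : ∀ x : A, x ≠ 0 → ∃ (κ : Type) (_ : Fintype κ) (_ : DecidableEq κ)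
      (φ : A →⋆ₐ[ℂ] Matrix κ κ ℂ), φ x ≠ 0) : IsRFD A := by
  have h' : ∀ x : {x : A // x ≠ 0}, ∃ (n : ℕ) (φ : A →⋆ₐ[ℂ] Matrix (Fin n) (Fin n) ℂ),
      φ x ≠ 0 := by
    rintro ⟨x, hx⟩
    obtain ⟨κ, _, _, φ, hφ⟩ := h x hx
    refine ⟨Fintype.card κ, (reindexStarAlgHom (Fintype.equivFin κ)).comp φ, fun h0 => hφ ?_⟩
    exact (reindexAlgEquiv ℂ ℂ (Fintype.equivFin κ)).injective (h0.trans (map_zero _).symm)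
  choose n φ hφ using h'
  refine ⟨{x : A // x ≠ 0}, n,
    { toFun := fun a i => φ i a
      map_one' := by ext1; simp
      map_mul' := fun a b => by ext1; simp
      map_zero' := by ext1; simp
      map_add' := fun a b => by ext1; simp
      commutes' := fun c => by
        ext1 i
        exact AlgHomClass.commutes (φ i) c
      map_star' := fun a => by ext1 i; exact map_star (φ i) a }, fun a b hab => ?_⟩
  by_contra hne
  have h1 := congrFun hab ⟨a - b, sub_ne_zero.2 hne⟩
  refine hφ ⟨a - b, sub_ne_zero.2 hne⟩ ?_
  rw [map_sub, sub_eq_zero]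
  exact h1

theorem IsRFD.exists_apply_ne_zero {A : Type} [Ring A] [Algebra ℂ A] [StarRing A] (h : IsRFD A)
    {a : A} (ha : a ≠ 0) : ∃ (n : ℕ) (φ : A →⋆ₐ[ℂ] Matrix (Fin n) (Fin n) ℂ), φ a ≠ 0 := by
  obtain ⟨I, n, φ, hφ⟩ := h
  by_contra! hc
  refine ha (hφ ?_)
  rw [map_zero]
  ext1 i
  exact hc (n i) ((Pi.evalStarAlgHom ℂ _ i).comp φ)

theorem IsRFD.exists_injOn {A : Type} [Ring A] [Algebra ℂ A] [StarRing A] (h : IsRFD A)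
    (V : Submodule ℂ A) [FiniteDimensional ℂ V] :
    ∃ (κ : Type) (_ : Fintype κ) (_ : DecidableEq κ) (π : A →⋆ₐ[ℂ] Matrix κ κ ℂ),
      ∀ a ∈ V, π a = 0 → a = 0 := by
  induction hd : Module.finrank ℂ V using Nat.strong_induction_on generalizing V with
  | _ d ih =>
    by_cases hV : ∃ a ∈ V, a ≠ 0
    · obtain ⟨a, haV, ha⟩ := hV
      obtain ⟨n, φ, hφ⟩ := h.exists_apply_ne_zero ha
      let V' : Submodule ℂ A := V ⊓ LinearMap.ker (φ : A →ₗ[ℂ] Matrix (Fin n) (Fin n) ℂ)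
      have hlt : V' < V := lt_of_le_of_ne inf_le_left fun he => hφ (by
        have : a ∈ V' := he ▸ haV
        exact this.2)
      have hfin : FiniteDimensional ℂ V' := Submodule.finiteDimensional_of_le hlt.le
      obtain ⟨κ, _, _, π, hπ⟩ := ih _ (hd ▸ Submodule.finrank_lt_finrank_of_lt hlt) V' rfl
      refine ⟨Fin n ⊕ κ, inferInstance, inferInstance, starAlgHomFromBlocks φ π,
        fun b hb h0 => ?_⟩
      have h0' : fromBlocks (φ b) 0 0 (π b) = 0 := h0
      rw [← fromBlocks_zero, fromBlocks_inj] at h0'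
      exact hπ b ⟨hb, h0'.1⟩ h0'.2.2.2
    · push Not at hV
      exact ⟨Fin 0, inferInstance, inferInstance,
        { toFun := fun _ => 0
          map_one' := Subsingleton.elim _ _
          map_mul' := fun _ _ => Subsingleton.elim _ _
          map_zero' := rfl
          map_add' := fun _ _ => Subsingleton.elim _ _
          commutes' := fun _ => Subsingleton.elim _ _
          map_star' := fun _ => Subsingleton.elim _ _ }, fun a ha _ => hV a ha⟩

section Chain

variable {κ : Type*} [Fintype κ]

/-- The vector `v`, placed in the `k`-th of `N` blocks. -/
def blockVec (N k : ℕ) (v : κ → ℂ) : κ × Fin N → ℂ := fun p => if (p.2 : ℕ) = k then v p.1 else 0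

theorem star_blockVec_dotProduct {N k : ℕ} (hk : k < N) (v : κ → ℂ) (w : κ × Fin N → ℂ) :
    star (blockVec N k v) ⬝ᵥ w = star v ⬝ᵥ fun x => w (x, ⟨k, hk⟩) := by
  simp only [blockVec, dotProduct, Fintype.sum_prod_type, Pi.star_apply]
  refine Finset.sum_congr rfl fun x _ => ?_
  rw [Finset.sum_eq_single ⟨k, hk⟩]
  · simp
  · intro b _ hb
    have : (b : ℕ) ≠ k := fun h => hb (Fin.ext h)
    simp [this]
  · simp

/-- The vector linking the `i`-th block to the next one. -/
def linkVec (N : ℕ) (ξ η : ℕ → κ → ℂ) (i : ℕ) : κ × Fin N → ℂ :=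
  blockVec N i (ξ i) - blockVec N (i + 1) (η (i + 1))

theorem star_linkVec_dotProduct {n i : ℕ} (hi : i < n) (ξ η : ℕ → κ → ℂ)
    (w : κ × Fin (n + 1) → ℂ) :
    star (linkVec (n + 1) ξ η i) ⬝ᵥ w =
      (star (ξ i) ⬝ᵥ fun x => w (x, ⟨i, by lia⟩)) -
        star (η (i + 1)) ⬝ᵥ fun x => w (x, ⟨i + 1, by lia⟩) := by
  rw [linkVec, star_sub, sub_dotProduct, star_blockVec_dotProduct (by lia),
    star_blockVec_dotProduct (by lia)]

theorem star_linkVec_dotProduct_linkVec {n : ℕ} {ξ η : ℕ → κ → ℂ}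
    (hξ : ∀ i < n, star (ξ i) ⬝ᵥ ξ i = 1) (hη : ∀ i < n, star (η (i + 1)) ⬝ᵥ η (i + 1) = 1)
    (ho : ∀ i, i + 1 < n → star (η (i + 1)) ⬝ᵥ ξ (i + 1) = 0) {i j : ℕ} (hi : i < n) (hj : j < n) :
    star (linkVec (n + 1) ξ η i) ⬝ᵥ linkVec (n + 1) ξ η j = if i = j then 2 else 0 := by
  rw [star_linkVec_dotProduct hi]
  have key : ∀ (k : ℕ) (hk : k < n + 1), (fun x => linkVec (n + 1) ξ η j (x, ⟨k, hk⟩)) =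
      (if k = j then ξ j else 0) - if k = j + 1 then η (j + 1) else 0 := by
    intro k hk
    ext x
    by_cases h1 : k = j <;> by_cases h2 : k = j + 1 <;> simp [linkVec, blockVec, h1, h2]
  rw [key, key]
  rcases lt_trichotomy i j with h | rfl | h
  · by_cases h' : i + 1 = j
    · subst h'
      have h2 : i ≠ i + 1 + 1 := by lia
      simp [ho i hj, h2]
    · have h1 : i ≠ j := by lia
      have h2 : i ≠ j + 1 := by lia
      simp [h', h1, h2]
  · simp [hξ i hi, hη i hi]
    norm_num
  · by_cases h' : i = j + 1
    · subst h'
      have := ho j hi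
      rw [star_dotProduct, star_eq_zero] at this
      have h2 : j + 1 + 1 ≠ j := by lia
      simp [this, h2]
    · have h1 : i ≠ j := by lia
      have h2 : i + 1 ≠ j := by lia
      simp [h', h1, h2]

/-- The product of the matrix coefficients of the matrices in a list, the first being taken
between `η i` and `ξ i`. -/
def coeffProd (ξ η : ℕ → κ → ℂ) : ℕ → List (Matrix κ κ ℂ) → ℂ
  | _, [] => 1
  | i, M :: l => (star (η i) ⬝ᵥ (M *ᵥ ξ i)) * coeffProd ξ η (i + 1) l

theorem coeffProd_ofFn (ξ η : ℕ → κ → ℂ) {n : ℕ} (i : ℕ) (M : Fin n → Matrix κ κ ℂ) :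
    coeffProd ξ η i (List.ofFn M) = ∏ j : Fin n, star (η (i + j)) ⬝ᵥ (M j *ᵥ ξ (i + j)) := by
  induction n generalizing i with
  | zero => simp [coeffProd]
  | succ n ih => simp [coeffProd, List.ofFn_succ, Fin.prod_univ_succ, ih, add_assoc, add_comm 1]

variable [DecidableEq κ]

theorem amplification_mulVec_blockVec {N k : ℕ} (M : Matrix κ κ ℂ) (v : κ → ℂ) :
    amplification κ (Fin N) M *ᵥ blockVec N k v = blockVec N k (M *ᵥ v) := by
  ext ⟨x, j⟩
  rw [amplification_mulVec]
  by_cases h : (j : ℕ) = k <;> simp [blockVec, h, mulVec, dotProduct]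

/-- The symmetry exchanging `ξ i` in the `i`-th block with `η (i + 1)` in the next block. -/
def linkSymmetry (n : ℕ) (ξ η : ℕ → κ → ℂ) : Matrix (κ × Fin (n + 1)) (κ × Fin (n + 1)) ℂ :=
  1 - ∑ i ∈ Finset.range n, vecMulVec (linkVec (n + 1) ξ η i) (star (linkVec (n + 1) ξ η i))

theorem linkSymmetry_conjTranspose {κ : Type*} [DecidableEq κ] (n : ℕ)
    (ξ η : ℕ → κ → ℂ) : (linkSymmetry n ξ η)ᴴ = linkSymmetry n ξ η := by
  simp [linkSymmetry, conjTranspose_sub, conjTranspose_sum, conjTranspose_vecMulVec]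

theorem linkSymmetry_mul_self {n : ℕ} {ξ η : ℕ → κ → ℂ}
    (hξ : ∀ i < n, star (ξ i) ⬝ᵥ ξ i = 1) (hη : ∀ i < n, star (η (i + 1)) ⬝ᵥ η (i + 1) = 1)
    (ho : ∀ i, i + 1 < n → star (η (i + 1)) ⬝ᵥ ξ (i + 1) = 0) :
    linkSymmetry n ξ η * linkSymmetry n ξ η = 1 := by
  set Q := ∑ i ∈ Finset.range n, vecMulVec (linkVec (n + 1) ξ η i) (star (linkVec (n + 1) ξ η i))
    with hQ
  have hQQ : Q * Q = 2 • Q := by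
    rw [hQ, Finset.sum_mul, Finset.smul_sum]
    refine Finset.sum_congr rfl fun i hi => ?_
    rw [Finset.mul_sum, Finset.sum_eq_single i]
    · rw [vecMulVec_mul_vecMulVec, star_linkVec_dotProduct_linkVec hξ hη ho
        (Finset.mem_range.1 hi) (Finset.mem_range.1 hi), if_pos rfl, vecMulVec_smul]
      simp [two_smul]
    · intro j hj hne
      rw [vecMulVec_mul_vecMulVec, star_linkVec_dotProduct_linkVec hξ hη ho
        (Finset.mem_range.1 hi) (Finset.mem_range.1 hj), if_neg hne.symm]
      simp
    · exact fun h => absurd hi h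
  change (1 - Q) * (1 - Q) = 1
  rw [sub_mul, mul_sub, mul_sub, hQQ, two_smul]
  simp

theorem linkSymmetry_commute {n : ℕ} {ξ η : ℕ → κ → ℂ} {p : Matrix κ κ ℂ} (hp : pᴴ = p)
    (h : ∀ i < n, ∃ c : ℂ, star c = c ∧ p *ᵥ ξ i = c • ξ i ∧ p *ᵥ η (i + 1) = c • η (i + 1)) :
    Commute (linkSymmetry n ξ η) (amplification κ (Fin (n + 1)) p) := by
  refine (Commute.one_left _).sub_left (Commute.sum_left _ _ _ fun i hi => ?_)
  obtain ⟨c, hc, hpξ, hpη⟩ := h i (Finset.mem_range.1 hi)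
  have h1 : amplification κ (Fin (n + 1)) p *ᵥ linkVec (n + 1) ξ η i =
      c • linkVec (n + 1) ξ η i := by
    rw [linkVec, mulVec_sub, amplification_mulVec_blockVec, amplification_mulVec_blockVec, hpξ,
      hpη, smul_sub]
    congr 1 <;> ext x <;> simp [blockVec]
  have hps : (amplification κ (Fin (n + 1)) p)ᴴ = amplification κ (Fin (n + 1)) p := by
    rw [← star_eq_conjTranspose, ← map_star, star_eq_conjTranspose, hp]
  have h2 : star (linkVec (n + 1) ξ η i) ᵥ* amplification κ (Fin (n + 1)) p =
      c • star (linkVec (n + 1) ξ η i) := by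
    nth_rewrite 1 [← hps]
    rw [← star_mulVec, h1, star_smul, hc]
  rw [Commute, SemiconjBy, mul_vecMulVec, vecMulVec_mul, h1, h2, smul_vecMulVec, vecMulVec_smul]

theorem linkSymmetry_mulVec_apply {n : ℕ} {ξ η : ℕ → κ → ℂ} {w : κ × Fin (n + 1) → ℂ} {i : ℕ}
    (hi : i < n) (hw : ∀ (k : ℕ) (hk : k < n + 1), k ≤ i → (fun x => w (x, ⟨k, hk⟩)) = 0) :
    (∀ (k : ℕ) (hk : k < n + 1), k < i →
        (fun x => (linkSymmetry n ξ η *ᵥ w) (x, ⟨k, hk⟩)) = 0) ∧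
      (fun x => (linkSymmetry n ξ η *ᵥ w) (x, ⟨i, by lia⟩)) =
        (star (η (i + 1)) ⬝ᵥ fun x => w (x, ⟨i + 1, by lia⟩)) • ξ i := by
  have key : ∀ x k, (linkSymmetry n ξ η *ᵥ w) (x, k) = w (x, k) -
      ∑ j ∈ Finset.range n,
        (star (linkVec (n + 1) ξ η j) ⬝ᵥ w) * linkVec (n + 1) ξ η j (x, k) := by
    intro x k
    rw [linkSymmetry, sub_mulVec, one_mulVec, sum_mulVec]
    simp [vecMulVec_mulVec, Finset.sum_apply, mul_comm]
  have hsmall : ∀ j < i, star (linkVec (n + 1) ξ η j) ⬝ᵥ w = 0 := by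
    intro j hj
    rw [star_linkVec_dotProduct (by lia), hw j _ (by lia), hw (j + 1) _ (by lia)]
    simp
  constructor
  · intro k hk hki
    ext x
    rw [key, congrFun (hw k hk (by lia)) x, Finset.sum_eq_zero, Pi.zero_apply, sub_zero]
    intro j hj
    by_cases hji : j < i
    · rw [hsmall j hji, zero_mul]
    · have h1 : k ≠ j := by lia
      have h2 : k ≠ j + 1 := by lia
      simp [linkVec, blockVec, h1, h2]
  · ext x
    rw [key, congrFun (hw i (by lia) le_rfl) x, Finset.sum_eq_single i]
    · rw [star_linkVec_dotProduct hi, hw i _ le_rfl]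
      simp [linkVec, blockVec]
    · intro j hj hne
      by_cases hji : j < i
      · rw [hsmall j hji, zero_mul]
      · have h1 : i ≠ j := by lia
        have h2 : i ≠ j + 1 := by lia
        simp [linkVec, blockVec, h1, h2]
    · exact fun h => absurd (Finset.mem_range.2 hi) h

/-- The vector obtained by applying the matrices of a list alternately with `u` to `v`. -/
def alternatingApply {o : Type*} [Fintype o] [DecidableEq o] (u : Matrix (κ × o) (κ × o) ℂ)
    (v : κ × o → ℂ) : List (Matrix κ κ ℂ) → κ × o → ℂ
  | [] => u *ᵥ v
  | M :: l => amplification κ o M *ᵥ (u *ᵥ alternatingApply u v l)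

theorem alternatingApply_apply {n : ℕ} {ξ η : ℕ → κ → ℂ} {u : Matrix _ _ ℂ}
    (hu : u = linkSymmetry n ξ η) (huu : u * u = 1) (M : Matrix κ κ ℂ) (l : List (Matrix κ κ ℂ))
    {i : ℕ} (hi : i + l.length = n) :
    (∀ (k : ℕ) (hk : k < n + 1), k < i → (fun x =>
        alternatingApply u (blockVec (n + 1) n (ξ n)) (M :: l) (x, ⟨k, hk⟩)) = 0) ∧
      (fun x => alternatingApply u (blockVec (n + 1) n (ξ n)) (M :: l) (x, ⟨i, by lia⟩)) =
        coeffProd ξ η (i + 1) l • (M *ᵥ ξ i) := by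
  induction l generalizing i M with
  | nil =>
    obtain rfl : i = n := by simpa using hi
    rw [alternatingApply, alternatingApply, mulVec_mulVec _ u u, huu, one_mulVec,
      amplification_mulVec_blockVec]
    refine ⟨fun k hk hki => ?_, ?_⟩
    · ext x
      simp [blockVec, hki.ne]
    · ext x
      simp [blockVec, coeffProd]
  | cons M' l ih =>
    have hi' : i + 1 + l.length = n := by simpa [add_assoc, add_comm 1] using hi
    obtain ⟨h1, h2⟩ := ih M' hi'
    obtain ⟨h3, h4⟩ := linkSymmetry_mulVec_apply (ξ := ξ) (η := η) (i := i) (by lia)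
      (fun k hk hki => h1 k hk (by lia))
    rw [← hu] at h3 h4
    rw [alternatingApply]
    simp only [amplification_mulVec]
    refine ⟨fun k hk hki => ?_, ?_⟩
    · rw [h3 k hk hki]
      simp
      rfl
    · rw [h4, h2, mulVec_smul, dotProduct_smul, coeffProd, smul_eq_mul, mul_comm]

end Chain

namespace StarAlgPushout

variable {A : Type} [Ring A] [Algebra ℂ A] [StarRing A] [StarModule ℂ A]
  {D : Type} [CommRing D] [Algebra ℂ D] [StarRing D] [StarModule ℂ D] {ι : D →⋆ₐ[ℂ] A}
  (P : StarAlgPushout D A A ι ι)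

/-- The inclusion of the left factor for even `n` and of the right factor for odd `n`. -/
def side (n : ℕ) : A →⋆ₐ[ℂ] P.carrier := if Even n then P.inl else P.inr

/-- The alternating product of the elements of a list, the last one being taken in the left
factor. -/
def word : List A → P.carrier
  | [] => 1
  | a :: l => P.side l.length a * word l

/-- The span of the alternating products of `n` factors. -/
def wordSpan (n : ℕ) : Submodule ℂ P.carrier :=
  Submodule.span ℂ (Set.range fun a : Fin n → A => P.word (List.ofFn a))

theorem side_apply_base (n : ℕ) (d : D) : P.side n (ι d) = P.inl (ι d) := by
  by_cases h : Even n
  · simp [side, h]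
  · simpa [side, h] using (DFunLike.congr_fun P.comm d).symm

theorem side_add_two (n : ℕ) : P.side (n + 2) = P.side n := by
  simp [side, Nat.even_add]

theorem word_mem_wordSpan {l : List A} {n : ℕ} (h : l.length = n) : P.word l ∈ P.wordSpan n := by
  subst h
  exact Submodule.subset_span ⟨l.get, by simp⟩

theorem wordSpan_le_succ (n : ℕ) : P.wordSpan n ≤ P.wordSpan (n + 1) := by
  refine Submodule.span_le.2 ?_
  rintro _ ⟨a, rfl⟩
  have h : P.word (List.ofFn a) = P.word (1 :: List.ofFn a) := by simp [word]
  change P.word (List.ofFn a) ∈ _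
  rw [h]
  exact P.word_mem_wordSpan (by simp)

theorem wordSpan_mono : Monotone P.wordSpan := monotone_nat_of_le_succ P.wordSpan_le_succ

theorem word_append_base (l l' : List A) (x y : A) (d : D) :
    P.word (l ++ x :: ι d :: y :: l') = P.word (l ++ (x * ι d * y) :: l') := by
  induction l with
  | nil =>
    simp only [List.nil_append, word, List.length_cons, side_add_two, map_mul, side_apply_base,
      mul_assoc]
  | cons a l ih =>
    have h : (l ++ x :: ι d :: y :: l').length = (l ++ (x * ι d * y) :: l').length + 2 := by
      simp
      lia
    rw [List.cons_append, List.cons_append, word, word, ih, h, side_add_two]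

theorem word_append_eq_zero (l l' : List A) (x y : A) {d d' : D} (hd : d * d' = 0) :
    P.word (l ++ (x * ι d) :: (ι d' * y) :: l') = 0 := by
  induction l with
  | nil =>
    simp only [List.nil_append, word, map_mul, side_apply_base]
    rw [mul_assoc, mul_assoc, ← mul_assoc (P.inl (ι d)), ← map_mul, ← map_mul, hd]
    simp
  | cons a l ih => rw [List.cons_append, word, ih, mul_zero]

theorem exists_ofFn_eq_append {α : Type*} {n : ℕ} (a : Fin (n + 2) → α) (i : Fin (n + 1)) :
    ∃ l l' : List α, List.ofFn a = l ++ a i.castSucc :: a i.succ :: l' := by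
  have hi : (i : ℕ) < (List.ofFn a).length := by rw [List.length_ofFn]; lia
  have hi' : (i : ℕ) + 1 < (List.ofFn a).length := by rw [List.length_ofFn]; lia
  have h : (List.ofFn a)[(i : ℕ)] = a i.castSucc := List.getElem_ofFn _
  have h' : (List.ofFn a)[(i : ℕ) + 1] = a i.succ := List.getElem_ofFn _
  refine ⟨(List.ofFn a).take i, (List.ofFn a).drop (i + 2), ?_⟩
  rw [← h, ← h', List.getElem_cons_drop, List.getElem_cons_drop, List.take_append_drop]

theorem word_ofFn_eq_zero {n : ℕ} (a : Fin (n + 2) → A) (i : Fin (n + 1)) {d d' : D}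
    (hd : d * d' = 0) (h : a i.castSucc * ι d = a i.castSucc) (h' : ι d' * a i.succ = a i.succ) :
    P.word (List.ofFn a) = 0 := by
  obtain ⟨l, l', hl⟩ := exists_ofFn_eq_append a i
  rw [hl, ← h, ← h', word_append_eq_zero _ _ _ _ _ hd]

theorem word_ofFn_mem_wordSpan {n : ℕ} (a : Fin (n + 3) → A) (i : Fin (n + 1))
    (h : a i.succ.castSucc ∈ Set.range ι) : P.word (List.ofFn a) ∈ P.wordSpan (n + 1) := by
  obtain ⟨d, hd⟩ := h
  have hi : (i : ℕ) < (List.ofFn a).length := by rw [List.length_ofFn]; lia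
  have hi' : (i : ℕ) + 1 < (List.ofFn a).length := by rw [List.length_ofFn]; lia
  have hi'' : (i : ℕ) + 2 < (List.ofFn a).length := by rw [List.length_ofFn]; lia
  have h : (List.ofFn a)[(i : ℕ) + 1] = a i.succ.castSucc := List.getElem_ofFn _
  have hl : List.ofFn a = (List.ofFn a).take i ++ (List.ofFn a)[(i : ℕ)] :: ι d ::
      (List.ofFn a)[(i : ℕ) + 2] :: (List.ofFn a).drop (i + 3) := by
    rw [hd, ← h, List.getElem_cons_drop, List.getElem_cons_drop, List.getElem_cons_drop,
      List.take_append_drop]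
  rw [hl, word_append_base]
  exact P.word_mem_wordSpan (by simp; lia)

/-- Alternating products of `n` factors, as a multilinear map. -/
def wordMultilinear (n : ℕ) : MultilinearMap ℂ (fun _ : Fin n => A) P.carrier :=
  (MultilinearMap.mkPiAlgebraFin ℂ n P.carrier).compLinearMap
    fun i => (P.side (n - (i + 1)) : A →ₗ[ℂ] P.carrier)

theorem wordMultilinear_apply {n : ℕ} (a : Fin n → A) :
    P.wordMultilinear n a = P.word (List.ofFn a) := by
  have h : P.wordMultilinear n a = (List.ofFn fun i : Fin n => P.side (n - (i + 1)) (a i)).prod :=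
    by simp [wordMultilinear]
  rw [h]
  clear h
  induction n with
  | zero => simp [word]
  | succ n ih =>
    rw [List.ofFn_succ, List.ofFn_succ, List.prod_cons, word, ← ih]
    simp

theorem side_mul_mem (n : ℕ) (a : A) {m : ℕ} {x : P.carrier} (hx : x ∈ P.wordSpan m) :
    P.side n a * x ∈ P.wordSpan (m + 2) := by
  induction hx using Submodule.span_induction with
  | mem x hx =>
    obtain ⟨b, rfl⟩ := hx
    by_cases h : Even n ↔ Even m
    · have : P.side n a * P.word (List.ofFn b) = P.word (a :: List.ofFn b) := by
        simp [word, side, h]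
      change P.side n a * P.word (List.ofFn b) ∈ _
      rw [this]
      exact P.wordSpan_le_succ _ (P.word_mem_wordSpan (by simp))
    · have h' : Even n ↔ Even (m + 1) := by
        rw [Nat.even_add_one]
        tauto
      have : P.side n a * P.word (List.ofFn b) = P.word (a :: 1 :: List.ofFn b) := by
        simp [word, side, h']
      change P.side n a * P.word (List.ofFn b) ∈ _
      rw [this]
      exact P.word_mem_wordSpan (by simp)
  | zero => simp
  | add x y _ _ hx hy => rw [mul_add]; exact add_mem hx hy
  | smul c x _ hx => rw [mul_smul_comm]; exact Submodule.smul_mem _ _ hx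

theorem mem_adjoin (x : P.carrier) :
    x ∈ StarAlgebra.adjoin ℂ (Set.range P.inl ∪ Set.range P.inr) := by
  set S := StarAlgebra.adjoin ℂ (Set.range P.inl ∪ Set.range P.inr)
  let jl : A →⋆ₐ[ℂ] S := P.inl.codRestrict S fun a => StarAlgebra.subset_adjoin _ _ (.inl ⟨a, rfl⟩)
  let jr : A →⋆ₐ[ℂ] S := P.inr.codRestrict S fun a => StarAlgebra.subset_adjoin _ _ (.inr ⟨a, rfl⟩)
  obtain ⟨φ, ⟨hl, hr⟩, -⟩ := P.univ S jl jr (by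
    ext d
    exact DFunLike.congr_fun P.comm d)
  obtain ⟨ψ, -, hψ⟩ := P.univ P.carrier P.inl P.inr P.comm
  have h1 := hψ (S.subtype.comp φ) ⟨by rw [StarAlgHom.comp_assoc, hl]; rfl,
    by rw [StarAlgHom.comp_assoc, hr]; rfl⟩
  have h2 := hψ (StarAlgHom.id ℂ P.carrier) ⟨StarAlgHom.id_comp _, StarAlgHom.id_comp _⟩
  have h3 : ((φ x : S) : P.carrier) = x := DFunLike.congr_fun (h1.trans h2.symm) x
  exact h3 ▸ (φ x).2

theorem exists_mem_wordSpan (x : P.carrier) : ∃ n, x ∈ P.wordSpan (n + 1) := by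
  have key : (∀ m, ∀ y ∈ P.wordSpan m, ∃ n, x * y ∈ P.wordSpan n) ∧
      ∀ m, ∀ y ∈ P.wordSpan m, ∃ n, star x * y ∈ P.wordSpan n := by
    induction P.mem_adjoin x using StarAlgebra.adjoin_induction with
    | mem x hx =>
      obtain ⟨k, a, rfl⟩ : ∃ k a, P.side k a = x := by
        rcases hx with ⟨a, rfl⟩ | ⟨a, rfl⟩
        · exact ⟨0, a, by simp [side]⟩
        · exact ⟨1, a, by simp [side]⟩
      refine ⟨fun m y hy => ⟨_, P.side_mul_mem k a hy⟩, fun m y hy => ?_⟩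
      rw [← map_star]
      exact ⟨_, P.side_mul_mem k _ hy⟩
    | algebraMap r =>
      refine ⟨fun m y hy => ⟨m, ?_⟩, fun m y hy => ⟨m, ?_⟩⟩
      · rw [← Algebra.smul_def]
        exact Submodule.smul_mem _ _ hy
      · rw [← algebraMap_star_comm, ← Algebra.smul_def]
        exact Submodule.smul_mem _ _ hy
    | add x y _ _ hx hy =>
      refine ⟨fun m z hz => ?_, fun m z hz => ?_⟩
      · obtain ⟨n, hn⟩ := hx.1 m z hz
        obtain ⟨n', hn'⟩ := hy.1 m z hz
        exact ⟨max n n', by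
          rw [add_mul]
          exact add_mem (P.wordSpan_mono (le_max_left _ _) hn)
            (P.wordSpan_mono (le_max_right _ _) hn')⟩
      · obtain ⟨n, hn⟩ := hx.2 m z hz
        obtain ⟨n', hn'⟩ := hy.2 m z hz
        exact ⟨max n n', by
          rw [star_add, add_mul]
          exact add_mem (P.wordSpan_mono (le_max_left _ _) hn)
            (P.wordSpan_mono (le_max_right _ _) hn')⟩
    | mul x y _ _ hx hy =>
      refine ⟨fun m z hz => ?_, fun m z hz => ?_⟩
      · obtain ⟨n, hn⟩ := hy.1 m z hz
        rw [mul_assoc]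
        exact hx.1 n _ hn
      · obtain ⟨n, hn⟩ := hx.2 m z hz
        rw [star_mul, mul_assoc]
        exact hy.2 n _ hn
    | star x _ hx => exact ⟨hx.2, by simpa using hx.1⟩
  obtain ⟨n, hn⟩ := key.1 0 1 (P.word_mem_wordSpan (l := []) rfl)
  exact ⟨n, P.wordSpan_le_succ n (by simpa using hn)⟩

end StarAlgPushout

theorem MultilinearMap.eq_of_forall_sub_mem {R ι M N : Type*} [CommRing R] [Fintype ι]
    [AddCommGroup M] [Module R M] [AddCommGroup N] [Module R N]
    (g : MultilinearMap R (fun _ : ι => M) N) (K : ι → Submodule R M)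
    (hg : ∀ m i, m i ∈ K i → g m = 0) {m m' : ι → M} (h : ∀ i, m i - m' i ∈ K i) :
    g m = g m' := by
  classical
  have key : ∀ s : Finset ι, g m = g (s.piecewise m' m) := by
    intro s
    induction s using Finset.induction with
    | empty => simp
    | insert i s hi ih =>
      have h1 : s.piecewise m' m = Function.update (s.piecewise m' m) i (m i) := by
        rw [← Finset.piecewise_eq_of_notMem s m' m hi, Function.update_eq_self]
      rw [ih, Finset.piecewise_insert, h1, Function.update_idem, ← sub_eq_zero,
        ← g.map_update_sub]
      exact hg _ i (by simpa using h i)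
  simpa using key Finset.univ

namespace StarAlgPushout

variable {A : Type} [Ring A] [Algebra ℂ A] [StarRing A] [StarModule ℂ A]
  {D : Type} [CommRing D] [Algebra ℂ D] [StarRing D] [StarModule ℂ D] {ι : D →⋆ₐ[ℂ] A}
  (P : StarAlgPushout D A A ι ι)

theorem exists_rep {κ o : Type} [Fintype κ] [DecidableEq κ] [Fintype o] [DecidableEq o]
    (π : A →⋆ₐ[ℂ] Matrix κ κ ℂ) {u : Matrix (κ × o) (κ × o) ℂ} (huu : u * u = 1) (hu : uᴴ = u)
    (hcomm : ∀ d, Commute u (amplification κ o (π (ι d)))) :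
    ∃ ρ : P.carrier →⋆ₐ[ℂ] Matrix (κ × o) (κ × o) ℂ, ∀ (v : κ × o → ℂ) (l : List A),
      (if Even l.length then u else 1) *ᵥ (ρ (P.word l) *ᵥ v) =
        alternatingApply u v (l.map π) := by
  obtain ⟨ρ, ⟨hl, hr⟩, -⟩ := P.univ (Matrix (κ × o) (κ × o) ℂ) ((amplification κ o).comp π)
    ((conjSymmetry u huu hu).comp ((amplification κ o).comp π)) (by
      ext1 d
      change amplification κ o (π (ι d)) = u * amplification κ o (π (ι d)) * u
      rw [(hcomm d).eq, mul_assoc, huu, mul_one])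
  have hl' : ∀ a, ρ (P.inl a) = amplification κ o (π a) := DFunLike.congr_fun hl
  have hr' : ∀ a, ρ (P.inr a) = u * amplification κ o (π a) * u := DFunLike.congr_fun hr
  refine ⟨ρ, fun v l => ?_⟩
  induction l with
  | nil => simp [word, alternatingApply]
  | cons a l ih =>
    rw [List.map_cons, alternatingApply, ← ih, word, map_mul, List.length_cons]
    by_cases h : Even l.length
    · rw [if_neg (by simpa [Nat.even_add_one] using h), if_pos h, side, if_pos h, hl', one_mulVec,
        mulVec_mulVec _ u u, huu, one_mulVec, mulVec_mulVec]
    · rw [if_pos (by simpa [Nat.even_add_one] using h), if_neg h, side, if_neg h, hr', one_mulVec,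
        ← mulVec_mulVec, mulVec_mulVec _ u, ← mul_assoc, ← mul_assoc, huu, one_mul, ← mulVec_mulVec]

theorem sum_prod_coeff_eq_zero {m n : ℕ} {p : Fin m → D} (hps : ∀ i, star (p i) = p i)
    (hpo : ∀ i j, i ≠ j → p i * p j = 0) (hspan : Submodule.span ℂ (Set.range p) = ⊤)
    {κ : Type} [Fintype κ] [DecidableEq κ] (π : A →⋆ₐ[ℂ] Matrix κ κ ℂ)
    {ξ η : Fin (n + 1) → κ → ℂ} (hξ : ∀ i, star (ξ i) ⬝ᵥ ξ i = 1)
    (hη : ∀ i, star (η i) ⬝ᵥ η i = 1)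
    (ho : ∀ i, i ≠ 0 → i ≠ Fin.last n → star (η i) ⬝ᵥ ξ i = 0)
    (hr : ∀ i : Fin n, ∃ r, π (ι (p r)) *ᵥ ξ i.castSucc = ξ i.castSucc ∧
      π (ι (p r)) *ᵥ η i.succ = η i.succ)
    {x : P.carrier}
    (hx : ∀ (κ : Type) [Fintype κ] [DecidableEq κ] (φ : P.carrier →⋆ₐ[ℂ] Matrix κ κ ℂ), φ x = 0)
    {T : Type*} (s : Finset T) (c : T → ℂ) (a : T → Fin (n + 1) → A)
    (hxa : ∑ t ∈ s, c t • P.word (List.ofFn (a t)) = x) :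
    ∑ t ∈ s, c t * ∏ i, star (η i) ⬝ᵥ (π (a t i) *ᵥ ξ i) = 0 := by
  let ξ' : ℕ → κ → ℂ := fun i => if h : i < n + 1 then ξ ⟨i, h⟩ else 0
  let η' : ℕ → κ → ℂ := fun i => if h : i < n + 1 then η ⟨i, h⟩ else 0
  have hξ' : ∀ (i : ℕ) (h : i < n + 1), ξ' i = ξ ⟨i, h⟩ := fun i h => dif_pos h
  have hη' : ∀ (i : ℕ) (h : i < n + 1), η' i = η ⟨i, h⟩ := fun i h => dif_pos h
  set u := linkSymmetry n ξ' η' with hu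
  have huu : u * u = 1 := by
    refine linkSymmetry_mul_self (fun i hi => ?_) (fun i hi => ?_) fun i hi => ?_
    · rw [hξ' i (by lia), hξ]
    · rw [hη' (i + 1) (by lia), hη]
    · rw [hη' (i + 1) (by lia), hξ' (i + 1) (by lia), ho]
      · exact fun h => by simpa using congrArg Fin.val h
      · exact fun h => by
          have := congrArg Fin.val h
          simp at this
          lia
  have hcomm : ∀ d, Commute u (amplification κ (Fin (n + 1)) (π (ι d))) := by
    intro d
    have hd : d ∈ Submodule.span ℂ (Set.range p) := hspan ▸ Submodule.mem_top
    induction hd using Submodule.span_induction with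
    | mem d hd =>
      obtain ⟨r', rfl⟩ := hd
      refine linkSymmetry_commute ?_ fun i hi => ?_
      · rw [← star_eq_conjTranspose, ← map_star, ← map_star, hps]
      · obtain ⟨r, h1, h2⟩ := hr ⟨i, hi⟩
        rw [hξ' i (by lia), hη' (i + 1) (by lia)]
        change π (ι (p r)) *ᵥ ξ ⟨i, by lia⟩ = ξ ⟨i, by lia⟩ at h1
        change π (ι (p r)) *ᵥ η ⟨i + 1, by lia⟩ = η ⟨i + 1, by lia⟩ at h2
        by_cases hrr : r' = r
        · subst hrr
          exact ⟨1, by simp, by rw [h1, one_smul], by rw [h2, one_smul]⟩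
        · refine ⟨0, by simp, ?_, ?_⟩
          · rw [← h1, mulVec_mulVec, ← map_mul, ← map_mul, hpo _ _ hrr]
            simp
          · rw [← h2, mulVec_mulVec, ← map_mul, ← map_mul, hpo _ _ hrr]
            simp
    | zero => simp
    | add d d' _ _ h h' => simpa using h.add_right h'
    | smul c d _ h => simpa using h.smul_right c
  obtain ⟨ρ, hρ⟩ := P.exists_rep π huu (linkSymmetry_conjTranspose _ _ _) hcomm
  set v := blockVec (n + 1) n (ξ' n)
  set w := blockVec (n + 1) 0 (η 0)
  set U := if Even (n + 1) then u else 1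
  have hL : ∀ b : Fin (n + 1) → A, star w ⬝ᵥ (U *ᵥ (ρ (P.word (List.ofFn b)) *ᵥ v)) =
      ∏ i, star (η i) ⬝ᵥ (π (b i) *ᵥ ξ i) := by
    intro b
    have h1 := hρ v (List.ofFn b)
    have h2 : (List.ofFn b).map π = π (b 0) :: List.ofFn fun i : Fin n => π (b i.succ) := by
      rw [List.ofFn_succ, List.map_cons, List.map_ofFn]
      rfl
    rw [h2, List.length_ofFn] at h1
    rw [h1, star_blockVec_dotProduct n.succ_pos,
      (alternatingApply_apply hu huu _ _ (i := 0) (by simp)).2, dotProduct_smul,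
      coeffProd_ofFn, Fin.prod_univ_succ, smul_eq_mul, mul_comm, hξ' 0 n.succ_pos]
    congr 1
    refine Finset.prod_congr rfl fun j _ => ?_
    rw [zero_add, add_comm 1 (j : ℕ), hη' (j + 1) (by lia), hξ' (j + 1) (by lia)]
    rfl
  have hx0 : star w ⬝ᵥ (U *ᵥ (ρ x *ᵥ v)) = 0 := by
    rw [hx _ ρ, zero_mulVec, mulVec_zero, dotProduct_zero]
  rw [← hx0, ← hxa, map_sum, sum_mulVec, mulVec_sum, dotProduct_sum]
  refine Finset.sum_congr rfl fun t _ => ?_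
  rw [map_smul, smul_mulVec, mulVec_smul, dotProduct_smul, hL, smul_eq_mul]

end StarAlgPushout

/-- The matrix coefficient of a finite-dimensional representation between two vectors. -/
def matrixCoeff {A κ : Type*} [Ring A] [Algebra ℂ A] [StarRing A] [Fintype κ] [DecidableEq κ]
    (π : A →⋆ₐ[ℂ] Matrix κ κ ℂ) (η ξ : κ → ℂ) : A →ₗ[ℂ] ℂ where
  toFun a := star η ⬝ᵥ (π a *ᵥ ξ)
  map_add' a b := by rw [map_add, add_mulVec, dotProduct_add]
  map_smul' c a := by rw [map_smul, smul_mulVec, dotProduct_smul, RingHom.id_apply]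

theorem exists_matrixCoeff_expansion {A κ : Type*} [Ring A] [Algebra ℂ A] [StarRing A] [Fintype κ]
    [DecidableEq κ] (π : A →⋆ₐ[ℂ] Matrix κ κ ℂ) (W : Submodule ℂ A) [FiniteDimensional ℂ W]
    (Q : (κ → ℂ) → (κ → ℂ) → Prop) (N : Submodule ℂ A)
    (hN : ∀ b ∈ W, (∀ η ξ, Q η ξ → matrixCoeff π η ξ b = 0) → b ∈ N) :
    ∃ (k : ℕ) (η ξ : Fin k → κ → ℂ) (f : Fin k → A), (∀ j, Q (η j) (ξ j)) ∧ (∀ j, f j ∈ W) ∧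
      ∀ a ∈ W, a - ∑ j, matrixCoeff π (η j) (ξ j) a • f j ∈ N := by
  let S : Set (Module.Dual ℂ W) :=
    {ψ | ∃ η ξ : κ → ℂ, Q η ξ ∧ (matrixCoeff π η ξ).domRestrict W = ψ}
  obtain ⟨k, φ, e, hφ, he⟩ := exists_finite_dual_family S
  choose η ξ h hφ using hφ
  refine ⟨k, η, ξ, fun j => e j, h, fun j => (e j).2, fun a ha => ?_⟩
  have hsum : ((⟨a, ha⟩ - ∑ j, φ j ⟨a, ha⟩ • e j : W) : A) =
      a - ∑ j, matrixCoeff π (η j) (ξ j) a • (e j : A) := by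
    simp [← hφ]
  rw [← hsum]
  refine hN _ (Subtype.mem _) fun η' ξ' hQ => he ⟨a, ha⟩ _ ⟨η', ξ', hQ, rfl⟩

theorem exists_matrixCoeff_expansion_of_sum_eq_one {A κ : Type*} [Ring A] [Algebra ℂ A] [StarRing A]
    [Fintype κ] [DecidableEq κ] (π : A →⋆ₐ[ℂ] Matrix κ κ ℂ) {m : ℕ} {p : Fin m → A}
    (hps : ∀ i, star (p i) = p i) (hpi : ∀ i, p i * p i = p i) (hp1 : ∑ i, p i = 1)
    (V : Submodule ℂ A) [FiniteDimensional ℂ V] (C : Prop) (N : Submodule ℂ A)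
    (hN : ∀ r s, ∀ b ∈ V.map (LinearMap.mulLeftRight ℂ (p r, p s)), p r * b = b → b * p s = b →
      (∀ η ξ : κ → ℂ, π (p r) *ᵥ η = η → π (p s) *ᵥ ξ = ξ → star η ⬝ᵥ η = 1 → star ξ ⬝ᵥ ξ = 1 →
        (C → star η ⬝ᵥ ξ = 0) → star η ⬝ᵥ (π b *ᵥ ξ) = 0) → b ∈ N) :
    ∃ (J : Type) (_ : Fintype J) (η ξ : J → κ → ℂ) (r s : J → Fin m) (f : J → A),
      (∀ j, π (p (r j)) *ᵥ η j = η j ∧ π (p (s j)) *ᵥ ξ j = ξ j ∧ star (η j) ⬝ᵥ η j = 1 ∧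
        star (ξ j) ⬝ᵥ ξ j = 1 ∧ (C → star (η j) ⬝ᵥ ξ j = 0)) ∧
      (∀ j, p (r j) * f j = f j) ∧ (∀ j, f j * p (s j) = f j) ∧
      ∀ a ∈ V, a - ∑ j, matrixCoeff π (η j) (ξ j) a • f j ∈ N := by
  have hWl : ∀ r s, ∀ b ∈ V.map (LinearMap.mulLeftRight ℂ (p r, p s)), p r * b = b := by
    rintro r s _ ⟨a, -, rfl⟩
    rw [LinearMap.mulLeftRight_apply, ← mul_assoc, ← mul_assoc, hpi]
  have hWr : ∀ r s, ∀ b ∈ V.map (LinearMap.mulLeftRight ℂ (p r, p s)), b * p s = b := by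
    rintro r s _ ⟨a, -, rfl⟩
    rw [LinearMap.mulLeftRight_apply, mul_assoc, hpi]
  have key := fun r s => exists_matrixCoeff_expansion π
    (V.map (LinearMap.mulLeftRight ℂ (p r, p s)))
    (fun η ξ => π (p r) *ᵥ η = η ∧ π (p s) *ᵥ ξ = ξ ∧ star η ⬝ᵥ η = 1 ∧ star ξ ⬝ᵥ ξ = 1 ∧
      (C → star η ⬝ᵥ ξ = 0)) N fun b hb h => hN r s b hb (hWl r s b hb) (hWr r s b hb)
        fun η ξ h1 h2 h3 h4 h5 => h η ξ ⟨h1, h2, h3, h4, h5⟩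
  choose k η ξ f h hf hexp using key
  refine ⟨Σ r : Fin m, Σ s : Fin m, Fin (k r s), inferInstance, fun j => η j.1 j.2.1 j.2.2,
    fun j => ξ j.1 j.2.1 j.2.2, fun j => j.1, fun j => j.2.1, fun j => f j.1 j.2.1 j.2.2,
    fun j => h _ _ _, fun j => hWl _ _ _ (hf _ _ _), fun j => hWr _ _ _ (hf _ _ _),
    fun a ha => ?_⟩
  have hsum : ∑ r, ∑ s, p r * a * p s = a := by
    simp only [← Finset.mul_sum, ← Finset.sum_mul, hp1, one_mul, mul_one]
  have hcoeff : ∀ r s j, matrixCoeff π (η r s j) (ξ r s j) (p r * a * p s) =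
      matrixCoeff π (η r s j) (ξ r s j) a := by
    intro r s j
    have hr : (π (p r))ᴴ = π (p r) := by rw [← star_eq_conjTranspose, ← map_star, hps]
    change star _ ⬝ᵥ (π (p r * a * p s) *ᵥ _) = star _ ⬝ᵥ (π a *ᵥ _)
    rw [map_mul, map_mul, ← mulVec_mulVec, (h r s j).2.1, ← mulVec_mulVec,
      ← dotProduct_mulVec_of_conjTranspose_eq hr, (h r s j).1]
  have hsub : ∑ r, ∑ s, (p r * a * p s -
      ∑ j, matrixCoeff π (η r s j) (ξ r s j) (p r * a * p s) • f r s j) ∈ N :=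
    sum_mem fun r _ => sum_mem fun s _ => hexp r s _ ⟨a, ha, LinearMap.mulLeftRight_apply _ _ _⟩
  simp only [hcoeff, Finset.sum_sub_distrib, hsum] at hsub
  simpa only [Fintype.sum_sigma] using hsub

theorem mem_of_forall_dotProduct_eq_zero {A κ : Type*} [Ring A] [Algebra ℂ A] [StarRing A]
    [Fintype κ] [DecidableEq κ] (π : A →⋆ₐ[ℂ] Matrix κ κ ℂ) {m : ℕ} {p : Fin m → A}
    (hps : ∀ i, star (p i) = p i) (hpi : ∀ i, p i * p i = p i)
    (hpo : ∀ i j, i ≠ j → p i * p j = 0) {V N : Submodule ℂ A} (hpV : ∀ i, p i ∈ V)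
    (hπ : ∀ a ∈ V, π a = 0 → a = 0) {C : Prop} (hN : C → ∀ i, p i ∈ N) {r s : Fin m} {b : A}
    (hb : b ∈ V) (hl : p r * b = b) (hr : b * p s = b)
    (h : ∀ η ξ : κ → ℂ, π (p r) *ᵥ η = η → π (p s) *ᵥ ξ = ξ → star η ⬝ᵥ η = 1 → star ξ ⬝ᵥ ξ = 1 →
      (C → star η ⬝ᵥ ξ = 0) → star η ⬝ᵥ (π b *ᵥ ξ) = 0) : b ∈ N := by
  have h' := forall_of_forall_unit h
  have hπi : ∀ i, π (p i) * π (p i) = π (p i) := fun i => by rw [← map_mul, hpi]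
  have hπl : π (p r) * π b = π b := by rw [← map_mul, hl]
  have hπr : π b * π (p s) = π b := by rw [← map_mul, hr]
  by_cases hC : C
  · by_cases hrs : r = s
    · subst hrs
      obtain ⟨c, hc⟩ := exists_eq_smul_of_forall_dotProduct (hπi r) hπl hπr
        fun η ξ hη hξ h0 => h' η ξ hη hξ fun _ => h0
      have := hπ (b - c • p r) (sub_mem hb (V.smul_mem _ (hpV r))) (by
        rw [map_sub, map_smul, hc, sub_self])
      rw [sub_eq_zero.1 this]
      exact N.smul_mem _ (hN hC r)
    · have hadj : (π (p r))ᴴ = π (p r) := by rw [← star_eq_conjTranspose, ← map_star, hps]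
      have h0 : π b = 0 := eq_zero_of_forall_dotProduct (hπi s) hπl hπr fun η ξ hη hξ =>
        h' η ξ hη hξ fun _ => by
          rw [← hη, dotProduct_mulVec_of_conjTranspose_eq hadj, ← hξ, mulVec_mulVec, ← map_mul,
            hpo r s hrs]
          simp
      rw [hπ b hb h0]
      exact N.zero_mem
  · have h0 : π b = 0 := eq_zero_of_forall_dotProduct (hπi s) hπl hπr fun η ξ hη hξ =>
      h' η ξ hη hξ fun hC' => absurd hC' hC
    rw [hπ b hb h0]
    exact N.zero_mem

namespace StarAlgPushout

variable {A : Type} [Ring A] [Algebra ℂ A] [StarRing A] [StarModule ℂ A]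
  {D : Type} [CommRing D] [Algebra ℂ D] [StarRing D] [StarModule ℂ D] {ι : D →⋆ₐ[ℂ] A}
  (P : StarAlgPushout D A A ι ι)

theorem word_ofFn_mem_wordSpan_of_interior {n : ℕ} (a : Fin (n + 2) → A) {i : Fin (n + 2)}
    (h0 : i ≠ 0) (hl : i ≠ Fin.last (n + 1)) (h : a i ∈ Set.range ι) :
    P.word (List.ofFn a) ∈ P.wordSpan (n + 1) := by
  obtain ⟨i, rfl⟩ := Fin.exists_castSucc_eq.2 hl
  have h0' : i ≠ 0 := fun hi => h0 (by rw [hi, Fin.castSucc_zero])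
  obtain _ | n := n
  · exact absurd (Subsingleton.elim (α := Fin 1) i 0) h0'
  · obtain ⟨j, rfl⟩ := Fin.exists_succ_eq.2 h0'
    exact P.wordSpan_le_succ _ (P.word_ofFn_mem_wordSpan a j h)

theorem mem_wordSpan_of_forall_apply_eq_zero (hA : IsRFD A) {m : ℕ} {p : Fin m → D}
    (hps : ∀ i, star (p i) = p i) (hpi : ∀ i, p i * p i = p i)
    (hpo : ∀ i j, i ≠ j → p i * p j = 0) (hp1 : ∑ i, p i = 1)
    (hspan : Submodule.span ℂ (Set.range p) = ⊤) {n : ℕ} {x : P.carrier}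
    (hx : ∀ (κ : Type) [Fintype κ] [DecidableEq κ] (φ : P.carrier →⋆ₐ[ℂ] Matrix κ κ ℂ), φ x = 0)
    (hxn : x ∈ P.wordSpan (n + 2)) : x ∈ P.wordSpan (n + 1) := by
  obtain ⟨c, hc⟩ := Finsupp.mem_span_range_iff_exists_finsupp.1 hxn
  let V : Submodule ℂ A := Submodule.span ℂ (⋃ a ∈ c.support, Set.range a)
  have hV : ∀ a ∈ c.support, ∀ i, a i ∈ V := fun a ha i =>
    Submodule.subset_span (Set.mem_biUnion ha ⟨i, rfl⟩)
  have hVfin : FiniteDimensional ℂ V := FiniteDimensional.span_of_finite ℂ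
    (c.support.finite_toSet.biUnion fun a _ => Set.finite_range a)
  let q : Fin m → A := fun i => ι (p i)
  have hqs : ∀ i, star (q i) = q i := fun i => by rw [← map_star, hps]
  have hqi : ∀ i, q i * q i = q i := fun i => by rw [← map_mul, hpi]
  have hqo : ∀ i j, i ≠ j → q i * q j = 0 := fun i j hij => by
    rw [← map_mul, hpo i j hij, map_zero]
  have hq1 : ∑ i, q i = 1 := by rw [← map_sum, hp1, map_one]
  let V' : Submodule ℂ A := (⨆ rs : Fin m × Fin m,
    V.map (LinearMap.mulLeftRight ℂ (q rs.1, q rs.2))) ⊔ Submodule.span ℂ (Set.range q)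
  have hfin' : FiniteDimensional ℂ (Submodule.span ℂ (Set.range q)) :=
    FiniteDimensional.span_of_finite ℂ (Set.finite_range q)
  have hVV' : ∀ r s, V.map (LinearMap.mulLeftRight ℂ (q r, q s)) ≤ V' := fun r s =>
    (le_iSup (fun rs : Fin m × Fin m => V.map (LinearMap.mulLeftRight ℂ (q rs.1, q rs.2)))
      (r, s)).trans le_sup_left
  have hqV' : ∀ i, q i ∈ V' := fun i => Submodule.mem_sup_right (Submodule.subset_span ⟨i, rfl⟩)
  obtain ⟨κ, _, _, π, hπ⟩ := hA.exists_injOn V'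
  let N : Fin (n + 2) → Submodule ℂ A := fun i =>
    if i ≠ 0 ∧ i ≠ Fin.last (n + 1) then LinearMap.range (ι : D →ₗ[ℂ] A) else ⊥
  have key := fun i : Fin (n + 2) => exists_matrixCoeff_expansion_of_sum_eq_one π hqs hqi hq1 V
    (i ≠ 0 ∧ i ≠ Fin.last (n + 1)) (N i) fun r s b hb hl hr h =>
      mem_of_forall_dotProduct_eq_zero π hqs hqi hqo hqV' hπ
        (fun hi j => by
          simp only [N, if_pos hi]
          exact ⟨p j, rfl⟩) (hVV' r s hb) hl hr h
  choose 𝒥 _ η ξ r s f h hfl hfr hexp using key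
  let g := (P.wordSpan (n + 1)).mkQ.compMultilinearMap (P.wordMultilinear (n + 2))
  have hg : ∀ a, g a = (P.wordSpan (n + 1)).mkQ (P.word (List.ofFn a)) := fun a => by
    rw [← wordMultilinear_apply]
    rfl
  have hgN : ∀ a i, a i ∈ N i → g a = 0 := by
    intro a i hi
    by_cases hC : i ≠ 0 ∧ i ≠ Fin.last (n + 1)
    · simp only [N, if_pos hC] at hi
      rw [hg, Submodule.mkQ_apply, Submodule.Quotient.mk_eq_zero]
      exact P.word_ofFn_mem_wordSpan_of_interior a hC.1 hC.2 hi
    · simp only [N, if_neg hC, Submodule.mem_bot] at hi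
      exact g.map_coord_zero i hi
  have hgexp : ∀ a ∈ c.support, g a = ∑ J : ∀ i, 𝒥 i,
      (∏ i, matrixCoeff π (η i (J i)) (ξ i (J i)) (a i)) • g fun i => f i (J i) := by
    intro a ha
    rw [MultilinearMap.eq_of_forall_sub_mem g N hgN fun i => hexp i (a i) (hV a ha i), g.map_sum]
    exact Finset.sum_congr rfl fun J _ => g.map_smul_univ _ _
  have hJ : ∀ J : ∀ i, 𝒥 i, ∑ a ∈ c.support, (c a *
      ∏ i, matrixCoeff π (η i (J i)) (ξ i (J i)) (a i)) • g (fun i => f i (J i)) = 0 := by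
    intro J
    rw [← Finset.sum_smul]
    by_cases hlink : ∀ i : Fin (n + 1), s i.castSucc (J i.castSucc) = r i.succ (J i.succ)
    · have := P.sum_prod_coeff_eq_zero hps hpo hspan π (n := n + 1) (ξ := fun i => ξ i (J i))
        (η := fun i => η i (J i)) (fun i => (h i (J i)).2.2.2.1) (fun i => (h i (J i)).2.2.1)
        (fun i h0 hl => (h i (J i)).2.2.2.2 ⟨h0, hl⟩)
        (fun i => ⟨_, (h i.castSucc (J i.castSucc)).2.1, hlink i ▸ (h i.succ (J i.succ)).1⟩)
        hx c.support c id hc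
      exact (congrArg (· • _) this).trans (zero_smul _ _)
    · push Not at hlink
      obtain ⟨i, hi⟩ := hlink
      rw [hg, P.word_ofFn_eq_zero _ i (hpo _ _ hi) (hfr _ _) (hfl _ _), map_zero, smul_zero]
  have hx0 : (P.wordSpan (n + 1)).mkQ x = 0 := by
    rw [← hc, Finsupp.sum, map_sum, ← Finset.sum_eq_zero (s := Finset.univ) fun J _ => hJ J,
      Finset.sum_comm]
    refine Finset.sum_congr rfl fun a ha => ?_
    rw [map_smul, ← hg, hgexp a ha, Finset.smul_sum]
    simp only [smul_smul]
  rwa [Submodule.mkQ_apply, Submodule.Quotient.mk_eq_zero] at hx0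

theorem eq_zero_of_mem_wordSpan_one (hA : IsRFD A) {x : P.carrier}
    (hx : ∀ (κ : Type) [Fintype κ] [DecidableEq κ] (φ : P.carrier →⋆ₐ[ℂ] Matrix κ κ ℂ), φ x = 0)
    (hx1 : x ∈ P.wordSpan 1) : x = 0 := by
  have hle : P.wordSpan 1 ≤ LinearMap.range (P.inl : A →ₗ[ℂ] P.carrier) :=
    Submodule.span_le.2 fun _ ⟨a, ha⟩ => ⟨a 0, by simp [← ha, word, side]⟩
  obtain ⟨a, rfl⟩ := hle hx1
  have ha : a = 0 := by
    by_contra ha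
    obtain ⟨n, φ, hφ⟩ := hA.exists_apply_ne_zero ha
    obtain ⟨ψ, ⟨hl, -⟩, -⟩ := P.univ _ φ φ rfl
    exact hφ ((DFunLike.congr_fun hl a).symm.trans (hx _ ψ))
  rw [ha, map_zero]

end StarAlgPushout

end

/-- Proposition 2.15 of the paper: if `A` is a residually finite-dimensional
*-algebra and `D ⊆ A` a finite-dimensional commutative C*-subalgebra, then
`A ∗_D A` is residually finite-dimensional. -/
theorem starAlgPushout_self_isRFD (A : Type)
    [Ring A] [Algebra ℂ A] [StarRing A] [StarModule ℂ A]
    (hA : IsRFD A)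
    (D : Type) [CommRing D] [Algebra ℂ D] [StarRing D] [StarModule ℂ D]
    (hD : IsSpannedByOrthProjections D)
    (ι : D →⋆ₐ[ℂ] A) (hι : Function.Injective ι)
    (P : StarAlgPushout D A A ι ι) : IsRFD P.carrier := by
  obtain ⟨m, p, hps, hpi, hpo, hp1, hspan⟩ := hD
  have key : ∀ n, ∀ x ∈ P.wordSpan (n + 1), (∀ (κ : Type) [Fintype κ] [DecidableEq κ]
      (φ : P.carrier →⋆ₐ[ℂ] Matrix κ κ ℂ), φ x = 0) → x = 0 := by
    intro n
    induction n with
    | zero => exact fun x hxn hx => P.eq_zero_of_mem_wordSpan_one hA hx hxn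
    | succ n ih =>
      intro x hxn hx
      exact ih x (P.mem_wordSpan_of_forall_apply_eq_zero hA hps hpi hpo hp1 hspan hx hxn) hx
  refine isRFD_of_separating fun x hx => ?_
  by_contra! hx'
  obtain ⟨n, hn⟩ := P.exists_mem_wordSpan x
  exact hx (key n x hn fun κ _ _ φ => hx' κ _ _ φ)
end
end

section
/- Let B be a residually finite-dimensional complex *-algebra, let D ⊆ B be a unital commutative *-subalgebra spanned over ℂ by finitely many pairwise orthogonal self-adjoint idempotents summing to 1, and let C be a finite-dimensional C*-algebra (a complex *-algebra *-isomorphic to a finite product of complex matrix algebras). Then the quotient of the free product C ∗ B by the two-sided ideal generated by all commutators [ι_C(c), ι_B(d)] with c ∈ C and d ∈ D is residually finite-dimensional. -/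
noncomputable section

/-- The quotient of the free product `C ∗ B` by the two-sided ideal generated by the
commutators `[ι_C(c), ι_B(ι(d))]` with `c ∈ C`, `d ∈ D` (for `ι : D → B` a
*-subalgebra inclusion), characterized by its universal property. -/
structure CommutantsProd (C B D : Type)
    [Ring C] [Algebra ℂ C] [StarRing C] [StarModule ℂ C]
    [Ring B] [Algebra ℂ B] [StarRing B] [StarModule ℂ B]
    [CommRing D] [Algebra ℂ D] [StarRing D] [StarModule ℂ D]
    (ι : D →⋆ₐ[ℂ] B) where
  carrier : Type
  [ringP : Ring carrier]
  [algP : Algebra ℂ carrier]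
  [starP : StarRing carrier]
  [smodP : StarModule ℂ carrier]
  jC : C →⋆ₐ[ℂ] carrier
  jB : B →⋆ₐ[ℂ] carrier
  commutes : ∀ (c : C) (d : D), jC c * jB (ι d) = jB (ι d) * jC c
  univ : ∀ (T : Type) [Ring T] [Algebra ℂ T] [StarRing T] [StarModule ℂ T]
      (kC : C →⋆ₐ[ℂ] T) (kB : B →⋆ₐ[ℂ] T),
      (∀ (c : C) (d : D), kC c * kB (ι d) = kB (ι d) * kC c) →
      ∃! φ : carrier →⋆ₐ[ℂ] T, φ.comp jC = kC ∧ φ.comp jB = kB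

attribute [instance] CommutantsProd.ringP CommutantsProd.algP CommutantsProd.starP
  CommutantsProd.smodP

namespace FreeProductRFD

open Matrix
open scoped ComplexOrder Kronecker

section Representations

variable {A : Type} [Ring A] [Algebra ℂ A] [StarRing A]
variable {X Y : Type} [Fintype X] [DecidableEq X] [Fintype Y] [DecidableEq Y]

/-- The direct sum of two matrix representations of a *-algebra. -/
def directSum (π : A →⋆ₐ[ℂ] Matrix X X ℂ) (σ : A →⋆ₐ[ℂ] Matrix Y Y ℂ) :
    A →⋆ₐ[ℂ] Matrix (X ⊕ Y) (X ⊕ Y) ℂ where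
  toFun a := fromBlocks (π a) 0 0 (σ a)
  map_one' := by simp [fromBlocks_one]
  map_mul' a b := by simp [fromBlocks_multiply]
  map_zero' := by simp
  map_add' a b := by simp [fromBlocks_add]
  commutes' r := by
    simp only [AlgHomClass.commutes]
    simp only [Algebra.algebraMap_eq_smul_one, ← fromBlocks_one,
      fromBlocks_smul, smul_zero]
  map_star' a := by simp [star_eq_conjTranspose, fromBlocks_conjTranspose, map_star]

theorem directSum_apply (π : A →⋆ₐ[ℂ] Matrix X X ℂ) (σ : A →⋆ₐ[ℂ] Matrix Y Y ℂ) (a : A) :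
    directSum π σ a = fromBlocks (π a) 0 0 (σ a) := rfl

theorem directSum_mulVec (π : A →⋆ₐ[ℂ] Matrix X X ℂ) (σ : A →⋆ₐ[ℂ] Matrix Y Y ℂ) (a : A)
    (v : X → ℂ) (w : Y → ℂ) :
    directSum π σ a *ᵥ Sum.elim v w = Sum.elim (π a *ᵥ v) (σ a *ᵥ w) := by
  simp [directSum_apply, fromBlocks_mulVec]

/-- Renaming the index set of a matrix representation. -/
def reindexRep (e : X ≃ Y) (π : A →⋆ₐ[ℂ] Matrix X X ℂ) : A →⋆ₐ[ℂ] Matrix Y Y ℂ where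
  toFun a := (π a).submatrix e.symm e.symm
  map_one' := by simp
  map_mul' a b := by simp [submatrix_mul_equiv]
  map_zero' := by simp
  map_add' a b := by simp [submatrix_add]
  commutes' r := by
    simp only [AlgHomClass.commutes]
    simp only [Algebra.algebraMap_eq_smul_one, submatrix_smul,
      Pi.smul_apply, submatrix_one_equiv]
  map_star' a := by simp [star_eq_conjTranspose, map_star]

/-- The amplification `a ↦ π a ⊗ 1`. -/
def ampLeft (Y : Type) [Fintype Y] [DecidableEq Y] (π : A →⋆ₐ[ℂ] Matrix X X ℂ) :
    A →⋆ₐ[ℂ] Matrix (X × Y) (X × Y) ℂ where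
  toFun a := π a ⊗ₖ (1 : Matrix Y Y ℂ)
  map_one' := by simp
  map_mul' a b := by simp [← mul_kronecker_mul]
  map_zero' := by simp
  map_add' a b := by simp [add_kronecker]
  commutes' r := by
    simp only [AlgHomClass.commutes]
    simp only [Algebra.algebraMap_eq_smul_one, smul_kronecker,
      one_kronecker_one]
  map_star' a := by simp [star_eq_conjTranspose, map_star, conjTranspose_kronecker]

/-- The amplification `a ↦ 1 ⊗ π a`. -/
def ampRight (Y : Type) [Fintype Y] [DecidableEq Y] (π : A →⋆ₐ[ℂ] Matrix X X ℂ) :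
    A →⋆ₐ[ℂ] Matrix (Y × X) (Y × X) ℂ where
  toFun a := (1 : Matrix Y Y ℂ) ⊗ₖ π a
  map_one' := by simp
  map_mul' a b := by simp [← mul_kronecker_mul]
  map_zero' := by simp
  map_add' a b := by simp [kronecker_add]
  commutes' r := by
    simp only [AlgHomClass.commutes]
    simp only [Algebra.algebraMap_eq_smul_one, kronecker_smul,
      one_kronecker_one]
  map_star' a := by simp [star_eq_conjTranspose, map_star, conjTranspose_kronecker]

/-- An element is invisible if every matrix representation maps it to zero. -/
def Invisible (a : A) : Prop :=
  ∀ (X : Type) [Fintype X] [DecidableEq X] (π : A →⋆ₐ[ℂ] Matrix X X ℂ), π a = 0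

theorem isRFD_of_invisible (h : ∀ a : A, Invisible a → a = 0) : IsRFD A := by
  refine ⟨Σ n : ℕ, A →⋆ₐ[ℂ] Matrix (Fin n) (Fin n) ℂ, fun i => i.1,
    { toFun := fun a i => i.2 a
      map_one' := by ext1 i; simp
      map_mul' := fun a b => by ext1 i; simp
      map_zero' := by ext1 i; simp
      map_add' := fun a b => by ext1 i; simp
      commutes' := fun r => by ext1 i; exact AlgHomClass.commutes _ _
      map_star' := fun a => by ext1 i; simp [map_star] }, ?_⟩
  refine (injective_iff_map_eq_zero _).2 fun a ha => h a fun X _ _ π => ?_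
  have h1 := congrFun ha ⟨Fintype.card X, reindexRep (Fintype.equivFin X) π⟩
  have h2 : (π a).submatrix (Fintype.equivFin X).symm (Fintype.equivFin X).symm = 0 := h1
  ext x y
  have h3 := congrFun (congrFun h2 (Fintype.equivFin X x)) (Fintype.equivFin X y)
  simpa using h3

omit [DecidableEq X] in
theorem exists_eq_smul_of_orthogonal (e T : Matrix X X ℂ) (hTe : T * e = T) (heT : e * T = T)
    (h : ∀ v w : X → ℂ, e *ᵥ v = v → e *ᵥ w = w → star v ⬝ᵥ w = 0 → star v ⬝ᵥ (T *ᵥ w) = 0)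
    (he : e * e = e) : ∃ c : ℂ, T = c • e := by
  have hmem : ∀ v, v ∈ LinearMap.range e.mulVecLin ↔ e *ᵥ v = v := by
    intro v
    constructor
    · rintro ⟨u, rfl⟩
      simp [he]
    · intro hv
      exact ⟨v, by simpa using hv⟩
  have hT : ∀ v, e *ᵥ (T *ᵥ v) = T *ᵥ v := fun v => by rw [mulVec_mulVec, heT]
  have hmaps : ∀ v ∈ LinearMap.range e.mulVecLin, T.mulVecLin v ∈ LinearMap.range e.mulVecLin :=
    fun v _ => (hmem _).2 (hT v)
  obtain ⟨c, hc⟩ := LinearMap.exists_eq_smul_id_of_forall_notLinearIndependent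
    (f := T.mulVecLin.restrict hmaps) (by
      rintro ⟨w, hw⟩ hli
      rw [hmem] at hw
      by_cases hw0 : w = 0
      · subst hw0
        exact hli.ne_zero 0 (by simp)
      have hN : star w ⬝ᵥ w ≠ 0 := fun h0 => hw0 (dotProduct_star_self_eq_zero.1 h0)
      set k := (star w ⬝ᵥ (T *ᵥ w)) / (star w ⬝ᵥ w) with hk
      have hkey : T *ᵥ w - k • w = 0 := by
        have h1 : star w ⬝ᵥ (T *ᵥ w - k • w) = 0 := by
          rw [dotProduct_sub, dotProduct_smul, smul_eq_mul, hk, div_mul_cancel₀ _ hN, sub_self]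
        have h2 : star (T *ᵥ w - k • w) ⬝ᵥ w = 0 := by
          rw [star_dotProduct, h1, star_zero]
        have h3 := h _ w (by rw [mulVec_sub, hT, mulVec_smul, hw]) hw h2
        rw [← dotProduct_star_self_eq_zero, dotProduct_sub, h3, dotProduct_smul, h2]
        simp
      rw [LinearIndependent.pair_iff] at hli
      have := hli k (-1) (by
        ext1
        change k • w + (-1 : ℂ) • (T *ᵥ w) = 0
        rw [neg_one_smul, ← sub_eq_add_neg, ← neg_sub, hkey, neg_zero])
      simpa using this.2)
  refine ⟨c, ext_iff_mulVec.2 fun v => ?_⟩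
  have h4 := congrArg Subtype.val (LinearMap.congr_fun hc ⟨e *ᵥ v, (hmem _).2 (by simp [he])⟩)
  simp only [LinearMap.restrict_apply, mulVecLin_apply, LinearMap.smul_apply, Module.End.one_apply,
    Submodule.coe_smul, mulVec_mulVec, hTe] at h4
  rw [h4, smul_mulVec]

end Representations

section Corner

variable {A : Type} [Ring A] [Algebra ℂ A] [StarRing A] {m : ℕ} (q : Fin m → A)

theorem exists_invisible_sub_smul (hs : ∀ i, star (q i) = q i) (hid : ∀ i, q i * q i = q i)
    (ho : ∀ i j, i ≠ j → q i * q j = 0) (hsum : ∑ i, q i = 1) (i : Fin m) (a : A)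
    (h : ∀ (Y : Type) [Fintype Y] [DecidableEq Y] (π : A →⋆ₐ[ℂ] Matrix Y Y ℂ) (j : Fin m)
      (v w : Y → ℂ), π (q i) *ᵥ v = v → π (q j) *ᵥ w = w → star v ⬝ᵥ w = 0 →
        star v ⬝ᵥ (π a *ᵥ w) = 0) :
    ∃ c : ℂ, Invisible (q i * a - c • q i) := by
  have hloc : ∀ (Y : Type) [Fintype Y] [DecidableEq Y] (π : A →⋆ₐ[ℂ] Matrix Y Y ℂ),
      ∃ c : ℂ, π (q i * a) = c • π (q i) := by
    intro Y _ _ π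
    have hsa : ∀ x y : Y → ℂ, star x ⬝ᵥ (π (q i) *ᵥ y) = star (π (q i) *ᵥ x) ⬝ᵥ y := by
      intro x y
      rw [star_mulVec, ← dotProduct_mulVec, ← star_eq_conjTranspose, ← map_star, hs]
    have hzero : ∀ j, j ≠ i → π (q i * a * q j) = 0 := by
      intro j hj
      refine ext_iff_mulVec.2 fun y => ?_
      rw [zero_mulVec, ← dotProduct_star_self_eq_zero]
      set x := π (q i * a * q j) *ᵥ y with hx
      have h1 := h Y π j (π (q i) *ᵥ x) (π (q j) *ᵥ y) (by rw [mulVec_mulVec, ← map_mul, hid])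
        (by rw [mulVec_mulVec, ← map_mul, hid])
        (by rw [← hsa, mulVec_mulVec, ← map_mul, ho _ _ hj.symm]; simp)
      rw [← hsa, mulVec_mulVec, mulVec_mulVec, ← map_mul, ← map_mul] at h1
      exact h1
    have hTe : π (q i * a) = π (q i * a * q i) := by
      calc π (q i * a) = π (q i * a * ∑ j, q j) := by rw [hsum, mul_one]
        _ = ∑ j, π (q i * a * q j) := by rw [Finset.mul_sum, map_sum]
        _ = _ := Finset.sum_eq_single i (fun j _ hj => hzero j hj) (by simp)
    refine exists_eq_smul_of_orthogonal _ _ (by rw [← map_mul, ← hTe])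
      (by rw [← map_mul, ← mul_assoc, hid]) (fun v w hv hw hvw => ?_) (by rw [← map_mul, hid])
    rw [map_mul, ← mulVec_mulVec, hsa, hv]
    exact h Y π i v w hv hw hvw
  by_cases hq : Invisible (q i)
  · refine ⟨0, fun X _ _ π => ?_⟩
    rw [zero_smul, sub_zero, map_mul, hq X π, zero_mul]
  · simp only [Invisible, not_forall] at hq
    obtain ⟨X₀, _, _, π₀, h₀⟩ := hq
    obtain ⟨c, hc⟩ := hloc X₀ π₀
    refine ⟨c, fun X _ _ π => ?_⟩
    obtain ⟨c', hc'⟩ := hloc _ (directSum π₀ π)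
    simp only [directSum_apply, fromBlocks_smul, fromBlocks_inj] at hc'
    have hcc : c' = c := smul_left_injective ℂ h₀ (hc'.1.symm.trans hc)
    rw [map_sub, map_smul, hc'.2.2.2, hcc, sub_self]

end Corner

section Reflection

variable {X : Type} [Fintype X] [DecidableEq X]

/-- The matrix `1 - N⁻¹ u u*`; it is the reflection along `u` when `u* u = 2 N`. -/
def reflection (u : X → ℂ) (N : ℂ) : Matrix X X ℂ := 1 - N⁻¹ • vecMulVec u (star u)

theorem star_reflection (u : X → ℂ) {N : ℂ} (hN : star N = N) :
    star (reflection u N) = reflection u N := by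
  rw [reflection, star_sub, star_one, star_smul, star_inv₀, hN, star_eq_conjTranspose,
    conjTranspose_vecMulVec, star_star]

theorem reflection_mul_self (u : X → ℂ) {N : ℂ} (hN : N ≠ 0) (hu : star u ⬝ᵥ u = 2 * N) :
    reflection u N * reflection u N = 1 := by
  have h : vecMulVec u (star u) * vecMulVec u (star u) = (2 * N) • vecMulVec u (star u) := by
    rw [vecMulVec_mul_vecMulVec, hu, vecMulVec_smul]
  simp only [reflection, sub_mul, mul_sub, one_mul, mul_one, smul_mul_assoc, mul_smul_comm, h,
    smul_smul]
  rw [show N⁻¹ * (2 * N) = 2 by field_simp, two_smul]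
  simp

theorem vecMul_reflection (r u : X → ℂ) (N : ℂ) :
    r ᵥ* reflection u N = r - (N⁻¹ * (r ⬝ᵥ u)) • star u := by
  rw [reflection, vecMul_sub, vecMul_one, vecMul_smul, vecMul_vecMulVec, smul_smul]

theorem reflection_mulVec (u x : X → ℂ) (N : ℂ) :
    reflection u N *ᵥ x = x - (N⁻¹ * (star u ⬝ᵥ x)) • u := by
  rw [reflection, sub_mulVec, one_mulVec, smul_mulVec, vecMulVec_mulVec, op_smul_eq_smul,
    smul_smul]

theorem commute_reflection {M : Matrix X X ℂ} {u : X → ℂ} {μ : ℂ} (N : ℂ)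
    (h₁ : M *ᵥ u = μ • u) (h₂ : star u ᵥ* M = μ • star u) : Commute M (reflection u N) := by
  refine (Commute.one_right M).sub_right (Commute.smul_right ?_ _)
  rw [Commute, SemiconjBy, mul_vecMulVec, vecMulVec_mul, h₁, h₂, smul_vecMulVec, vecMulVec_smul]

end Reflection

section Words

variable {C B D : Type}
    [Ring C] [Algebra ℂ C] [StarRing C] [StarModule ℂ C]
    [Ring B] [Algebra ℂ B] [StarRing B] [StarModule ℂ B]
    [CommRing D] [Algebra ℂ D] [StarRing D] [StarModule ℂ D]
    {ι : D →⋆ₐ[ℂ] B} (P : CommutantsProd C B D ι)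

/-- The image of `C` for even `n` and the image of `B` for odd `n`. -/
def letters (n : ℕ) : Subalgebra ℂ P.carrier :=
  if Even n then P.jC.toAlgHom.range else P.jB.toAlgHom.range

/-- The span of the alternating words `b₀ c₁ b₁ ⋯` in at most `n` letters. -/
def words : ℕ → Submodule ℂ P.carrier
  | 0 => ⊥
  | 1 => Subalgebra.toSubmodule P.jB.toAlgHom.range
  | n + 2 => words (n + 1) * Subalgebra.toSubmodule (letters P n)

theorem letters_of_even {n : ℕ} (h : Even n) : letters P n = P.jC.toAlgHom.range := if_pos h

theorem letters_of_not_even {n : ℕ} (h : ¬ Even n) : letters P n = P.jB.toAlgHom.range := if_neg h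

theorem letters_eq_of_even_iff {m n : ℕ} (h : Even m ↔ Even n) : letters P m = letters P n := by
  simp only [letters, h]

theorem words_zero : words P 0 = ⊥ := by rw [words]

theorem words_one : words P 1 = Subalgebra.toSubmodule P.jB.toAlgHom.range := by rw [words]

theorem words_add_two (n : ℕ) :
    words P (n + 2) = words P (n + 1) * Subalgebra.toSubmodule (letters P n) := by rw [words]

theorem words_le_succ (n : ℕ) : words P n ≤ words P (n + 1) := by
  rcases n with _ | n
  · simp [words_zero]
  · intro x hx
    rw [words_add_two, ← mul_one x]
    exact Submodule.mul_mem_mul hx (one_mem (letters P n))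

theorem words_mono : Monotone (words P) := monotone_nat_of_le_succ (words_le_succ P)

theorem mul_mem_words {n : ℕ} {x a : P.carrier} (hx : x ∈ words P n) (ha : a ∈ letters P n) :
    x * a ∈ words P n := by
  rcases n with _ | _ | n
  · rw [words_zero, Submodule.mem_bot] at hx ⊢
    rw [hx, zero_mul]
  · rw [words_one] at hx ⊢
    rw [letters_of_not_even P (by decide)] at ha
    exact mul_mem (S := Subalgebra ℂ P.carrier) hx ha
  · rw [words_add_two] at hx ⊢
    rw [letters_eq_of_even_iff P (n := n) (by simp [parity_simps])] at ha
    have := Submodule.mul_mem_mul hx (show a ∈ Subalgebra.toSubmodule (letters P n) from ha)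
    rwa [mul_assoc, (Subalgebra.isIdempotentElem_toSubmodule (letters P n)).eq] at this

theorem one_mem_words_one : (1 : P.carrier) ∈ words P 1 := by
  rw [words_one]
  exact one_mem P.jB.toAlgHom.range

theorem mul_mem_words_add_two {n k : ℕ} {x a : P.carrier} (hx : x ∈ words P n)
    (ha : a ∈ letters P k) : x * a ∈ words P (n + 2) := by
  by_cases h : Even k ↔ Even n
  · rw [letters_eq_of_even_iff P h] at ha
    exact words_mono P (by lia) (mul_mem_words P hx ha)
  · rw [letters_eq_of_even_iff P (n := n + 1) (by simp only [parity_simps]; tauto)] at ha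
    exact mul_mem_words P (words_mono P (Nat.le_succ n) hx) ha |> words_mono P (Nat.le_succ _)

theorem mul_base_mem_words {n : ℕ} {x : P.carrier} (hx : x ∈ words P n) (d : D) :
    x * P.jB (ι d) ∈ words P n := by
  by_cases hn : Even n
  · rcases n with _ | _ | n
    · rw [words_zero, Submodule.mem_bot] at hx ⊢
      rw [hx, zero_mul]
    · exact absurd hn (by decide)
    · rw [words_add_two] at hx ⊢
      induction hx using Submodule.mul_induction_on' with
      | mem_mul_mem s hs a ha =>
        rw [letters_of_even P (by simpa [parity_simps] using hn)] at ha ⊢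
        obtain ⟨c, rfl⟩ := ha
        change s * P.jC c * P.jB (ι d) ∈ _
        rw [mul_assoc, P.commutes, ← mul_assoc]
        refine Submodule.mul_mem_mul (mul_mem_words P hs ?_) ⟨c, rfl⟩
        rw [letters_of_not_even P (by simpa [parity_simps] using hn)]
        exact ⟨_, rfl⟩
      | add x _ y _ hx hy => rw [add_mul]; exact add_mem hx hy
  · refine mul_mem_words P hx ?_
    rw [letters_of_not_even P hn]
    exact ⟨_, rfl⟩

theorem hom_ext {T : Type} [Ring T] [Algebra ℂ T] [StarRing T] [StarModule ℂ T]
    {f g : P.carrier →⋆ₐ[ℂ] T} (hC : f.comp P.jC = g.comp P.jC) (hB : f.comp P.jB = g.comp P.jB) :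
    f = g :=
  (P.univ T (g.comp P.jC) (g.comp P.jB) fun c d => by
    simp only [StarAlgHom.comp_apply, ← map_mul, P.commutes]).unique ⟨hC, hB⟩ ⟨rfl, rfl⟩

theorem adjoin_eq_top :
    StarAlgebra.adjoin ℂ (Set.range P.jC ∪ Set.range P.jB) = ⊤ := by
  set S := StarAlgebra.adjoin ℂ (Set.range P.jC ∪ Set.range P.jB) with hS
  have hCS : ∀ c, P.jC c ∈ S := fun c =>
    StarAlgebra.subset_adjoin ℂ _ (Or.inl ⟨c, rfl⟩)
  have hBS : ∀ b, P.jB b ∈ S := fun b =>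
    StarAlgebra.subset_adjoin ℂ _ (Or.inr ⟨b, rfl⟩)
  obtain ⟨φ, ⟨hφC, hφB⟩, -⟩ := P.univ S (P.jC.codRestrict S hCS) (P.jB.codRestrict S hBS)
    fun c d => Subtype.ext (P.commutes c d)
  have hid : S.subtype.comp φ = StarAlgHom.id ℂ P.carrier := by
    refine hom_ext P ?_ ?_
    · ext c
      exact congrArg Subtype.val (DFunLike.congr_fun hφC c)
    · ext b
      exact congrArg Subtype.val (DFunLike.congr_fun hφB b)
  refine eq_top_iff.2 fun x _ => ?_
  have hx : ((φ x : S) : P.carrier) = x := DFunLike.congr_fun hid x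
  rw [← hx]
  exact (φ x).2

theorem exists_mem_words (x : P.carrier) : ∃ n, x ∈ words P n := by
  have hx : x ∈ StarAlgebra.adjoin ℂ (Set.range P.jC ∪ Set.range P.jB) := by
    rw [adjoin_eq_top]; trivial
  suffices h : ∀ n, ∀ s ∈ words P n, ∃ k, s * x ∈ words P k by
    simpa using h 1 1 (one_mem_words_one P)
  have hstar : star (Set.range P.jC ∪ Set.range P.jB) = Set.range P.jC ∪ Set.range P.jB := by
    have hr : ∀ {E : Type} [Ring E] [Algebra ℂ E] [StarRing E] (f : E →⋆ₐ[ℂ] P.carrier),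
        star (Set.range f) = Set.range f := by
      intro E _ _ _ f
      ext y
      constructor
      · rintro ⟨e, he⟩
        exact ⟨star e, by rw [map_star, he, star_star]⟩
      · rintro ⟨e, rfl⟩
        exact ⟨star e, map_star f e⟩
    rw [Set.union_star, hr, hr]
  rw [StarAlgebra.adjoin_eq_starClosure_adjoin, ← StarSubalgebra.mem_toSubalgebra] at hx
  rw [Subalgebra.starClosure_toSubalgebra, Subalgebra.star_adjoin_comm, hstar, sup_idem] at hx
  induction hx using Algebra.adjoin_induction with
  | mem y hy =>
    intro n s hs
    rcases hy with ⟨c, rfl⟩ | ⟨b, rfl⟩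
    · exact ⟨_, mul_mem_words_add_two P (k := 0) hs
        (by rw [letters_of_even P (by decide)]; exact ⟨c, rfl⟩)⟩
    · exact ⟨_, mul_mem_words_add_two P (k := 1) hs
        (by rw [letters_of_not_even P (by decide)]; exact ⟨b, rfl⟩)⟩
  | algebraMap z =>
    intro n s hs
    refine ⟨n, ?_⟩
    rw [Algebra.algebraMap_eq_smul_one, mul_smul_comm, mul_one]
    exact Submodule.smul_mem _ _ hs
  | add y z _ _ hy hz =>
    intro n s hs
    obtain ⟨k, hk⟩ := hy n s hs
    obtain ⟨l, hl⟩ := hz n s hs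
    refine ⟨max k l, ?_⟩
    rw [mul_add]
    exact add_mem (words_mono P (le_max_left _ _) hk) (words_mono P (le_max_right _ _) hl)
  | mul y z _ _ hy hz =>
    intro n s hs
    obtain ⟨k, hk⟩ := hy n s hs
    obtain ⟨l, hl⟩ := hz k _ hk
    exact ⟨l, by rwa [← mul_assoc]⟩

variable {X : Type} [Fintype X] [DecidableEq X]

theorem exists_conj_rep (π : P.carrier →⋆ₐ[ℂ] Matrix X X ℂ) (U : Matrix X X ℂ) (hU : star U = U)
    (hUU : U * U = 1) (hcomm : ∀ d, Commute (π (P.jB (ι d))) U) (n : ℕ) :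
    ∃ π' : P.carrier →⋆ₐ[ℂ] Matrix X X ℂ, (∀ a ∈ letters P n, π' a = U * π a * U) ∧
      (∀ a ∈ letters P (n + 1), π' a = π a) ∧ ∀ d, π' (P.jB (ι d)) = π (P.jB (ι d)) := by
  let u : unitary (Matrix X X ℂ) :=
    ⟨U, Unitary.mem_iff.2 ⟨by rw [hU, hUU], by rw [hU, hUU]⟩⟩
  let ψ : Matrix X X ℂ →⋆ₐ[ℂ] Matrix X X ℂ :=
    (Unitary.conjStarAlgAut ℂ (Matrix X X ℂ) u : _ →⋆ₐ[ℂ] _)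
  have hψ : ∀ x, ψ x = U * x * U := fun x => by
    change U * x * star U = _
    rw [hU]
  have hψD : ∀ d, ψ (π (P.jB (ι d))) = π (P.jB (ι d)) := fun d => by
    rw [hψ, ← (hcomm d).eq, mul_assoc, hUU, mul_one]
  by_cases hn : Even n
  · obtain ⟨π', ⟨hC, hB⟩, -⟩ := P.univ (Matrix X X ℂ) (ψ.comp (π.comp P.jC)) (π.comp P.jB)
      (fun c d => by
        simp only [StarAlgHom.comp_apply]
        rw [← hψD d, ← map_mul, ← map_mul, ← map_mul, ← map_mul, P.commutes])
    have hC' : ∀ c, π' (P.jC c) = ψ (π (P.jC c)) := DFunLike.congr_fun hC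
    have hB' : ∀ b, π' (P.jB b) = π (P.jB b) := DFunLike.congr_fun hB
    refine ⟨π', ?_, ?_, fun d => hB' _⟩
    · rw [letters_of_even P hn]
      rintro _ ⟨c, rfl⟩
      exact (hC' c).trans (hψ _)
    · rw [letters_of_not_even P (by simpa [parity_simps] using hn)]
      rintro _ ⟨b, rfl⟩
      exact hB' b
  · obtain ⟨π', ⟨hC, hB⟩, -⟩ := P.univ (Matrix X X ℂ) (π.comp P.jC) (ψ.comp (π.comp P.jB))
      (fun c d => by
        simp only [StarAlgHom.comp_apply]
        rw [hψD d, ← map_mul, ← map_mul, P.commutes])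
    have hC' : ∀ c, π' (P.jC c) = π (P.jC c) := DFunLike.congr_fun hC
    have hB' : ∀ b, π' (P.jB b) = ψ (π (P.jB b)) := DFunLike.congr_fun hB
    refine ⟨π', ?_, ?_, fun d => (hB' _).trans (hψD d)⟩
    · rw [letters_of_not_even P hn]
      rintro _ ⟨b, rfl⟩
      exact (hB' b).trans (hψ _)
    · rw [letters_of_even P (by simpa [parity_simps] using hn)]
      rintro _ ⟨c, rfl⟩
      exact hC' c

theorem exists_rep_mul_eq (π : P.carrier →⋆ₐ[ℂ] Matrix X X ℂ) {n : ℕ} {r v w z : X → ℂ} {N : ℂ}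
    (hN : N ≠ 0) (hv : star v ⬝ᵥ v = N) (hw : star w ⬝ᵥ w = N) (hvw : star v ⬝ᵥ w = 0)
    (hwz : star w ⬝ᵥ z = 0) (hcomm : ∀ d, Commute (π (P.jB (ι d))) (reflection (v - w) N))
    (hrv : ∀ x ∈ words P n, r ⬝ᵥ (π x *ᵥ v) = 0) (hrw : ∀ x, r ⬝ᵥ (π x *ᵥ w) = 0)
    (hrz : ∀ x, r ⬝ᵥ (π x *ᵥ z) = 0) (hvz : ∀ x, star v ⬝ᵥ (π x *ᵥ z) = 0) :
    ∃ π' : P.carrier →⋆ₐ[ℂ] Matrix X X ℂ, (∀ d, π' (P.jB (ι d)) = π (P.jB (ι d))) ∧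
      ∀ s ∈ words P (n + 1), ∀ a ∈ letters P n,
        r ⬝ᵥ (π' (s * a) *ᵥ z) = N⁻¹ * (r ⬝ᵥ (π s *ᵥ v)) * (star w ⬝ᵥ (π a *ᵥ z)) := by
  have hNs : star N = N := by rw [← hv, ← star_dotProduct]
  have hwv : star w ⬝ᵥ v = 0 := by rw [star_dotProduct, hvw, star_zero]
  set U := reflection (v - w) N with hU
  obtain ⟨π', hconj, hsame, hD⟩ := exists_conj_rep P π U (star_reflection _ hNs)
    (reflection_mul_self _ hN (by
      simp only [star_sub, sub_dotProduct, dotProduct_sub, hv, hw, hvw, hwv]; ring)) hcomm n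
  refine ⟨π', hD, ?_⟩
  have hrow : ∀ x, (r ᵥ* π x) ⬝ᵥ (v - w) = r ⬝ᵥ (π x *ᵥ v) := fun x => by
    rw [dotProduct_sub, ← dotProduct_mulVec, ← dotProduct_mulVec, hrw, sub_zero]
  have hfix : ∀ x ∈ words P n, r ᵥ* π x ᵥ* U = r ᵥ* π x := fun x hx => by
    rw [hU, vecMul_reflection, hrow, hrv x hx, mul_zero, zero_smul, sub_zero]
  have hconj_step : ∀ t ∈ words P n, ∀ a ∈ letters P n, r ᵥ* π' t = r ᵥ* π t →
      r ᵥ* π' (t * a) = r ᵥ* π (t * a) := by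
    intro t ht a ha h
    rw [map_mul, ← vecMul_vecMul, h, hconj a ha, ← vecMul_vecMul, ← vecMul_vecMul, hfix t ht,
      vecMul_vecMul _ (π t), ← map_mul, hfix _ (mul_mem_words P ht ha)]
  have hsame_step : ∀ t, ∀ a ∈ letters P (n + 1), r ᵥ* π' t = r ᵥ* π t →
      r ᵥ* π' (t * a) = r ᵥ* π (t * a) := by
    intro t a ha h
    rw [map_mul, ← vecMul_vecMul, h, hsame a ha, vecMul_vecMul, ← map_mul]
  have hmain : ∀ k, k ≤ n + 1 → ∀ x ∈ words P k, r ᵥ* π' x = r ᵥ* π x := by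
    intro k
    induction k using Nat.twoStepInduction with
    | zero =>
      intro _ x hx
      rw [words_zero, Submodule.mem_bot] at hx
      rw [hx, map_zero, map_zero]
    | one =>
      intro hk x hx
      rw [words_one, ← letters_of_not_even P (n := 1) (by decide)] at hx
      rw [← one_mul x]
      by_cases h : Even n
      · refine hsame_step 1 x ?_ (by rw [map_one, map_one])
        rwa [letters_eq_of_even_iff P (n := 1) (by simpa [parity_simps] using h)]
      · refine hconj_step 1 (words_mono P ?_ (one_mem_words_one P)) x ?_ (by rw [map_one, map_one])
        · exact Nat.one_le_iff_ne_zero.2 (by rintro rfl; exact h (by decide))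
        · rwa [letters_eq_of_even_iff P (n := 1) (by simpa using h)]
    | more k _ ih =>
      intro hk x hx
      rw [words_add_two] at hx
      induction hx using Submodule.mul_induction_on' with
      | mem_mul_mem t ht a ha =>
        by_cases h : Even k ↔ Even n
        · have hkn : k + 2 ≤ n := by
            rcases Nat.lt_or_ge n (k + 2) with h1 | h1
            · obtain rfl : n = k + 1 := by lia
              simp only [parity_simps] at h
              tauto
            · exact h1
          rw [Subalgebra.mem_toSubmodule, letters_eq_of_even_iff P h] at ha
          exact hconj_step t (words_mono P (by lia) ht) a ha (ih (by lia) t ht)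
        · rw [Subalgebra.mem_toSubmodule, letters_eq_of_even_iff P (n := n + 1)
            (by simp only [parity_simps]; tauto)] at ha
          exact hsame_step t a ha (ih (by lia) t ht)
      | add x _ y _ hx hy => rw [map_add, map_add, vecMul_add, vecMul_add, hx, hy]
  intro s hs a ha
  have hUz : U *ᵥ z = z := by
    have h1 := hvz 1
    rw [map_one, one_mulVec] at h1
    rw [hU, reflection_mulVec, star_sub, sub_dotProduct, h1, hwz, sub_zero, mul_zero, zero_smul,
      sub_zero]
  have hsa := hrz (s * a)
  rw [map_mul, ← mulVec_mulVec, dotProduct_mulVec] at hsa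
  rw [map_mul, ← mulVec_mulVec, dotProduct_mulVec, hmain _ le_rfl s hs, hconj a ha,
    ← mulVec_mulVec, hUz, ← mulVec_mulVec, dotProduct_mulVec, hU, vecMul_reflection, hrow,
    sub_dotProduct, hsa, smul_dotProduct, star_sub, sub_dotProduct, hvz, smul_eq_mul]
  ring

theorem eq_zero_or_eq_zero_of_invisible (hC : IsFinDimCStar C) (hB : IsRFD B) {b : B} {c : C}
    (h : Invisible (P.jB b * P.jC c)) : b = 0 ∨ c = 0 := by
  by_contra! hbc
  obtain ⟨I, k, φ, hφ⟩ := hB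
  obtain ⟨l, k', ⟨ψ⟩⟩ := hC
  obtain ⟨i, hi⟩ := Function.ne_iff.1 fun h0 => hbc.1 ((map_eq_zero_iff φ hφ).1 h0)
  obtain ⟨j, hj⟩ := Function.ne_iff.1 fun h0 => hbc.2 ((map_eq_zero_iff ψ ψ.injective).1 h0)
  let σ : B →⋆ₐ[ℂ] Matrix (Fin (k i)) (Fin (k i)) ℂ :=
    (Pi.evalStarAlgHom ℂ (fun i => Matrix (Fin (k i)) (Fin (k i)) ℂ) i).comp φ
  let τ : C →⋆ₐ[ℂ] Matrix (Fin (k' j)) (Fin (k' j)) ℂ :=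
    (Pi.evalStarAlgHom ℂ (fun j => Matrix (Fin (k' j)) (Fin (k' j)) ℂ) j).comp
      (ψ : C →⋆ₐ[ℂ] ∀ j, Matrix (Fin (k' j)) (Fin (k' j)) ℂ)
  obtain ⟨π, ⟨hπC, hπB⟩, -⟩ := P.univ _ (ampRight (Fin (k i)) τ) (ampLeft (Fin (k' j)) σ)
    (fun c d => by
      change (1 ⊗ₖ τ c) * (σ (ι d) ⊗ₖ 1) = (σ (ι d) ⊗ₖ 1) * (1 ⊗ₖ τ c)
      simp [← mul_kronecker_mul])
  have h0 : σ b ⊗ₖ τ c = 0 := by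
    have h1 := h _ π
    rw [map_mul, show π (P.jB b) = σ b ⊗ₖ 1 from DFunLike.congr_fun hπB b,
      show π (P.jC c) = 1 ⊗ₖ τ c from DFunLike.congr_fun hπC c, ← mul_kronecker_mul, mul_one,
      one_mul] at h1
    exact h1
  have hσ : σ b ≠ 0 := hi
  have hτ : τ c ≠ 0 := hj
  obtain ⟨x, hx⟩ := Function.ne_iff.1 hσ
  obtain ⟨y, hy⟩ := Function.ne_iff.1 hx
  obtain ⟨x', hx'⟩ := Function.ne_iff.1 hτ
  obtain ⟨y', hy'⟩ := Function.ne_iff.1 hx'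
  exact mul_ne_zero hy hy' (congrFun (congrFun h0 (x, x')) (y, y'))

theorem eq_zero_of_invisible_base (hC : IsFinDimCStar C) (hB : IsRFD B) {b : B}
    (h : Invisible (P.jB b)) : P.jB b = 0 := by
  rcases eq_zero_or_eq_zero_of_invisible P hC hB (b := b) (c := 1) (by rwa [map_one, mul_one])
    with h0 | h0
  · rw [h0, map_zero]
  · rw [← mul_one (P.jB b), ← map_one P.jC, h0, map_zero, mul_zero]

theorem mem_span_of_invisible (hC : IsFinDimCStar C) (hB : IsRFD B) {n : ℕ} {a : P.carrier}
    (ha : a ∈ letters P n) (b : B) {z : ℂ} (h : Invisible (P.jB b * a - z • P.jB b)) :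
    P.jB b * a = z • P.jB b := by
  rw [← sub_eq_zero]
  by_cases hn : Even n
  · rw [letters_of_even P hn] at ha
    obtain ⟨c, rfl⟩ := ha
    change Invisible (P.jB b * P.jC c - z • P.jB b) at h
    change P.jB b * P.jC c - z • P.jB b = 0
    have heq : P.jB b * P.jC c - z • P.jB b = P.jB b * P.jC (c - z • 1) := by
      rw [map_sub, map_smul, map_one, mul_sub, mul_smul_comm, mul_one]
    rw [heq] at h ⊢
    rcases eq_zero_or_eq_zero_of_invisible P hC hB h with h0 | h0
    · rw [h0, map_zero, zero_mul]
    · rw [h0, map_zero, mul_zero]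
  · rw [letters_of_not_even P hn] at ha
    obtain ⟨b', rfl⟩ := ha
    change Invisible (P.jB b * P.jB b' - z • P.jB b) at h
    change P.jB b * P.jB b' - z • P.jB b = 0
    have heq : P.jB b * P.jB b' - z • P.jB b = P.jB (b * b' - z • b) := by
      rw [map_sub, map_smul, map_mul]
    rw [heq] at h ⊢
    exact eq_zero_of_invisible_base P hC hB h

theorem commute_base_of_span {k : ℕ} {p : Fin k → D}
    (hspan : Submodule.span ℂ (Set.range p) = ⊤) (π : P.carrier →⋆ₐ[ℂ] Matrix X X ℂ)
    (U : Matrix X X ℂ) (h : ∀ j, Commute (π (P.jB (ι (p j)))) U) (d : D) :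
    Commute (π (P.jB (ι d))) U := by
  have hd : d ∈ Submodule.span ℂ (Set.range p) := hspan ▸ trivial
  induction hd using Submodule.span_induction with
  | mem x hx =>
    obtain ⟨j, rfl⟩ := hx
    exact h j
  | zero => simp
  | add x y _ _ hx hy =>
    simp only [map_add]
    exact hx.add_left hy
  | smul z x _ hx =>
    simp only [map_smul]
    exact hx.smul_left z

theorem exists_linearIndependent_lifts {T W : Type*} [Finite T] [AddCommGroup W] [Module ℂ W]
    (W₀ : Submodule ℂ W) (a : T → W) :
    ∃ (k : ℕ) (e : Fin k → W) (c : T → Fin k → ℂ), LinearIndependent ℂ (fun j => W₀.mkQ (e j)) ∧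
      ∀ t, a t - ∑ j, c t j • e j ∈ W₀ := by
  set S := Submodule.span ℂ (Set.range fun t => W₀.mkQ (a t)) with hS
  have : FiniteDimensional ℂ S := FiniteDimensional.span_of_finite ℂ (Set.finite_range _)
  let β := Module.finBasis ℂ S
  choose e he using fun j => W₀.mkQ_surjective (β j)
  refine ⟨_, e, fun t j => β.repr ⟨W₀.mkQ (a t), Submodule.subset_span ⟨t, rfl⟩⟩ j, ?_, fun t => ?_⟩
  · simp only [he]
    exact β.linearIndependent.map' S.subtype (Submodule.ker_subtype S)
  · suffices h : W₀.mkQ (a t -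
        ∑ j, β.repr ⟨W₀.mkQ (a t), Submodule.subset_span ⟨t, rfl⟩⟩ j • e j) = 0
      from (Submodule.Quotient.mk_eq_zero W₀).1 h
    rw [map_sub, map_sum, sub_eq_zero]
    simp only [map_smul, he]
    have h := congrArg Subtype.val (β.sum_repr ⟨W₀.mkQ (a t), Submodule.subset_span ⟨t, rfl⟩⟩)
    simp only [Submodule.coe_sum, Submodule.coe_smul] at h
    exact h.symm

theorem exists_sum_of_mem_mul {R : Type*} [Ring R] [Algebra ℂ R] {M N : Submodule ℂ R} {x : R}
    (hx : x ∈ M * N) :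
    ∃ (T : Type) (_ : Fintype T) (s : T → R) (a : T → N), (∀ t, s t ∈ M) ∧
      x = ∑ t, s t * (a t : R) := by
  induction hx using Submodule.mul_induction_on' with
  | mem_mul_mem s hs a ha => exact ⟨Unit, inferInstance, fun _ => s, fun _ => ⟨a, ha⟩, by simp [hs]⟩
  | add x _ y _ hx hy =>
    obtain ⟨T, _, s, a, hs, rfl⟩ := hx
    obtain ⟨T', _, s', a', hs', rfl⟩ := hy
    exact ⟨T ⊕ T', inferInstance, Sum.elim s s', Sum.elim a a',
      by rintro (t | t) <;> simp [hs, hs'], by simp⟩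

omit [DecidableEq X] in
theorem exists_smul_dotProduct_self_eq {Y : Type} [Fintype Y] {v : Y → ℂ} (hv : v ≠ 0)
    (w : X → ℂ) (hw : w ≠ 0) :
    ∃ α : ℂ, α ≠ 0 ∧ star (α • v) ⬝ᵥ (α • v) = star w ⬝ᵥ w := by
  have key : ∀ {Z : Type} [Fintype Z] (u : Z → ℂ), u ≠ 0 →
      ∃ x : ℝ, 0 < x ∧ star u ⬝ᵥ u = x := by
    intro Z _ u hu
    have h := dotProduct_star_self_pos_iff.2 hu
    rw [Complex.pos_iff] at h
    exact ⟨_, h.1, Complex.ext rfl h.2.symm⟩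
  obtain ⟨x, hx, hxv⟩ := key v hv
  obtain ⟨y, hy, hyw⟩ := key w hw
  have hpos : 0 < Real.sqrt (y / x) := Real.sqrt_pos.2 (div_pos hy hx)
  refine ⟨(Real.sqrt (y / x) : ℝ), by exact_mod_cast hpos.ne', ?_⟩
  have hα : star ((Real.sqrt (y / x) : ℝ) : ℂ) = (Real.sqrt (y / x) : ℝ) := Complex.conj_ofReal _
  rw [star_smul, smul_dotProduct, dotProduct_smul, hxv, hyw, hα, smul_eq_mul, smul_eq_mul,
    ← mul_assoc]
  norm_cast
  rw [Real.mul_self_sqrt (div_pos hy hx).le, div_mul_cancel₀ _ hx.ne']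

section Separation

variable {k : ℕ} {p : Fin k → D} (hs : ∀ i, star (p i) = p i) (hid : ∀ i, p i * p i = p i)
  (ho : ∀ i j, i ≠ j → p i * p j = 0) (hsum : ∑ i, p i = 1)
  (hspan : Submodule.span ℂ (Set.range p) = ⊤)

/-- The functional `x ↦ r ⬝ᵥ (π x *ᵥ w)` is supported at the `i`-th projection of the base and
vanishes on `words P n`. -/
structure Separates (p : Fin k → D) (n : ℕ) (i : Fin k) (π : P.carrier →⋆ₐ[ℂ] Matrix X X ℂ)
    (r w : X → ℂ) : Prop where
  mulVec_eq : π (P.jB (ι (p i))) *ᵥ w = w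
  eq_zero : ∀ y ∈ words P n, r ⬝ᵥ (π y *ᵥ w) = 0

/-- The separating functionals detect membership in `words P n` inside `words P (n + 1)`. -/
def IsSeparated (p : Fin k → D) (n : ℕ) : Prop :=
  ∀ x ∈ words P (n + 1), (∀ (i : Fin k) (X : Type) [Fintype X] [DecidableEq X]
    (π : P.carrier →⋆ₐ[ℂ] Matrix X X ℂ) (r w : X → ℂ), Separates P p n i π r w →
      r ⬝ᵥ (π x *ᵥ w) = 0) → x ∈ words P n

include hid hsum in
theorem isSeparated_zero (hC : IsFinDimCStar C) (hB : IsRFD B) : IsSeparated P p 0 := by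
  intro x hx h
  suffices hinv : Invisible x by
    rw [words_one] at hx
    obtain ⟨b, rfl⟩ := hx
    rw [words_zero, Submodule.mem_bot]
    exact eq_zero_of_invisible_base P hC hB hinv
  intro X _ _ π
  have hπ : ∀ r v : X → ℂ, r ⬝ᵥ (π x *ᵥ v) = 0 := by
    intro r v
    have hv : v = ∑ i, π (P.jB (ι (p i))) *ᵥ v := by
      rw [← sum_mulVec, ← map_sum, ← map_sum, ← map_sum, hsum, map_one, map_one, map_one,
        one_mulVec]
    rw [hv, mulVec_sum, dotProduct_sum]
    refine Finset.sum_eq_zero fun i _ => h i X π r _ ⟨?_, ?_⟩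
    · rw [mulVec_mulVec, ← map_mul, ← map_mul, ← map_mul, hid]
    · intro y hy
      rw [words_zero, Submodule.mem_bot] at hy
      rw [hy, map_zero, zero_mulVec, dotProduct_zero]
  refine Matrix.ext_iff_mulVec.2 fun v => ?_
  refine dotProduct_eq _ _ fun r => ?_
  rw [dotProduct_comm, hπ, zero_mulVec, zero_dotProduct]

include hs ho hspan in
theorem exists_separates_mul_eq {n : ℕ} {i j : Fin k} {π : P.carrier →⋆ₐ[ℂ] Matrix X X ℂ}
    {r w : X → ℂ} (h : Separates P p n i π r w) (hw : w ≠ 0) {Y : Type} [Fintype Y]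
    [DecidableEq Y] (σ : P.carrier →⋆ₐ[ℂ] Matrix Y Y ℂ) {v z : Y → ℂ} (hv₀ : v ≠ 0)
    (hv : σ (P.jB (ι (p i))) *ᵥ v = v) (hz : σ (P.jB (ι (p j))) *ᵥ z = z)
    (hvz : star v ⬝ᵥ z = 0) :
    ∃ (γ : ℂ) (π' : P.carrier →⋆ₐ[ℂ] Matrix (X ⊕ Y) (X ⊕ Y) ℂ) (r' z' : X ⊕ Y → ℂ), γ ≠ 0 ∧
      Separates P p (n + 1) j π' r' z' ∧ ∀ s ∈ words P (n + 1), ∀ a ∈ letters P n,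
        r' ⬝ᵥ (π' (s * a) *ᵥ z') = γ * ((r ⬝ᵥ (π s *ᵥ w)) * (star v ⬝ᵥ (σ a *ᵥ z))) := by
  obtain ⟨α, hα, hαv⟩ := exists_smul_dotProduct_self_eq hv₀ w hw
  have hN : star w ⬝ᵥ w ≠ 0 := fun h0 => hw (dotProduct_star_self_eq_zero.1 h0)
  have hqs : ∀ l, star (P.jB (ι (p l))) = P.jB (ι (p l)) := fun l => by
    rw [← map_star, ← map_star, hs]
  have hq : ∀ {Z : Type} [Fintype Z] [DecidableEq Z] (ρ : P.carrier →⋆ₐ[ℂ] Matrix Z Z ℂ)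
      (u : Z → ℂ), ρ (P.jB (ι (p i))) *ᵥ u = u →
      ∀ l, ρ (P.jB (ι (p l))) *ᵥ u = (if l = i then (1 : ℂ) else 0) • u := by
    intro Z _ _ ρ u hu l
    split_ifs with hl
    · rw [hl, hu, one_smul]
    · rw [← hu, mulVec_mulVec, ← map_mul, ← map_mul, ← map_mul, ho l i hl, map_zero, map_zero,
        map_zero, zero_mulVec, zero_smul]
  have hαv' : σ (P.jB (ι (p i))) *ᵥ (α • v) = α • v := by rw [mulVec_smul, hv]
  obtain ⟨π', hD, hπ'⟩ := exists_rep_mul_eq P (directSum π σ) (n := n) (r := Sum.elim r 0)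
    (v := Sum.elim w 0) (w := Sum.elim 0 (α • v)) (z := Sum.elim 0 z) hN
    (by simp [Function.star_sumElim, sumElim_dotProduct_sumElim])
    (by rw [← hαv]; simp [Function.star_sumElim, sumElim_dotProduct_sumElim])
    (by simp [Function.star_sumElim, sumElim_dotProduct_sumElim])
    (by simp [Function.star_sumElim, sumElim_dotProduct_sumElim, star_smul, hvz])
    (by
      refine commute_base_of_span P hspan _ _ fun l => ?_
      have h1 : directSum π σ (P.jB (ι (p l))) *ᵥ (Sum.elim w 0 - Sum.elim (0 : X → ℂ) (α • v)) =
          (if l = i then (1 : ℂ) else 0) • (Sum.elim w 0 - Sum.elim (0 : X → ℂ) (α • v)) :=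
        hq _ _ (by
          rw [mulVec_sub, directSum_mulVec, directSum_mulVec, h.mulVec_eq, hαv', mulVec_zero,
            mulVec_zero]) l
      refine commute_reflection _ h1 ?_
      have h2 := congrArg star h1
      rw [star_mulVec, ← star_eq_conjTranspose, ← map_star, hqs, star_smul] at h2
      rw [h2]
      split_ifs <;> simp)
    (fun x hx => by
      rw [directSum_mulVec, sumElim_dotProduct_sumElim, h.eq_zero x hx]
      simp)
    (fun x => by rw [directSum_mulVec, sumElim_dotProduct_sumElim]; simp)
    (fun x => by rw [directSum_mulVec, sumElim_dotProduct_sumElim]; simp)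
    (fun x => by
      rw [directSum_mulVec, Function.star_sumElim, sumElim_dotProduct_sumElim]; simp)
  have key : ∀ s ∈ words P (n + 1), ∀ a ∈ letters P n,
      Sum.elim r 0 ⬝ᵥ (π' (s * a) *ᵥ Sum.elim 0 z) =
        (star w ⬝ᵥ w)⁻¹ * star α * ((r ⬝ᵥ (π s *ᵥ w)) * (star v ⬝ᵥ (σ a *ᵥ z))) := by
    intro s hs' a ha
    rw [hπ' s hs' a ha, directSum_mulVec, directSum_mulVec, Function.star_sumElim,
      sumElim_dotProduct_sumElim, sumElim_dotProduct_sumElim]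
    simp only [zero_dotProduct, star_zero, mulVec_zero, add_zero, zero_add, star_smul,
      smul_dotProduct, smul_eq_mul]
    ring
  refine ⟨_, π', _, _, mul_ne_zero (inv_ne_zero hN) (star_ne_zero.2 hα), ⟨?_, fun y hy => ?_⟩, key⟩
  · rw [hD, directSum_mulVec, hz, mulVec_zero]
  · rw [← mul_one y, key y hy 1 (one_mem _), map_one, one_mulVec, hvz, mul_zero, mul_zero]

include hs hid ho hsum hspan in
theorem isSeparated_succ (hC : IsFinDimCStar C) (hB : IsRFD B) {n : ℕ}
    (ih : IsSeparated P p n) : IsSeparated P p (n + 1) := by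
  intro x hx hsep
  rw [words_add_two] at hx
  obtain ⟨T, _, s, a, hsw, rfl⟩ := exists_sum_of_mem_mul hx
  set q : Fin k → P.carrier := fun i => P.jB (ι (p i)) with hq
  have hqs : ∀ i, star (q i) = q i := fun i => by simp only [hq, ← map_star, hs]
  have hqi : ∀ i, q i * q i = q i := fun i => by simp only [hq, ← map_mul, hid]
  have hqo : ∀ i j, i ≠ j → q i * q j = 0 := fun i j hij => by
    simp only [hq, ← map_mul, ho i j hij, map_zero]
  have hqsum : ∑ i, q i = 1 := by simp only [hq, ← map_sum, hsum, map_one]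
  have hterm : ∀ i, ∑ t, s t * q i * (a t : P.carrier) ∈ words P (n + 1) := by
    intro i
    let W₀ : Submodule ℂ (Subalgebra.toSubmodule (letters P n)) :=
      (Submodule.span ℂ {q i}).comap
        ((LinearMap.mulLeft ℂ (q i)).comp (Subalgebra.toSubmodule (letters P n)).subtype)
    obtain ⟨d, e, c, hli, hc⟩ := exists_linearIndependent_lifts W₀ a
    have hrel : ∀ (X : Type) [Fintype X] [DecidableEq X] (π : P.carrier →⋆ₐ[ℂ] Matrix X X ℂ)
        (r w : X → ℂ), Separates P p n i π r w → ∑ t, (r ⬝ᵥ (π (s t) *ᵥ w)) • a t ∈ W₀ := by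
      intro X _ _ π r w h
      by_cases hw : w = 0
      · simp [hw]
      set y := ∑ t, (r ⬝ᵥ (π (s t) *ᵥ w)) • a t with hy
      obtain ⟨z, hz⟩ := exists_invisible_sub_smul q hqs hqi hqo hqsum i (y : P.carrier) (by
        intro Y _ _ σ j v w₁ hv hw₁ hvw
        by_cases hv₀ : v = 0
        · simp [hv₀]
        obtain ⟨γ, π', r', z', hγ, hsep', hmul⟩ :=
          exists_separates_mul_eq P hs ho hspan h hw σ hv₀ hv hw₁ hvw
        have h0 := hsep j _ π' r' z' hsep'
        rw [map_sum, sum_mulVec, dotProduct_sum,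
          Finset.sum_congr rfl fun t _ => hmul (s t) (hsw t) (a t) (a t).2, ← Finset.mul_sum] at h0
        rw [← (mul_eq_zero.1 h0).resolve_left hγ, hy]
        simp only [Submodule.coe_sum, Submodule.coe_smul, map_sum, map_smul, sum_mulVec,
          dotProduct_sum, smul_mulVec, dotProduct_smul, smul_eq_mul])
      exact Submodule.mem_span_singleton.2 ⟨z, (mem_span_of_invisible P hC hB y.2 _ hz).symm⟩
    have hv : ∀ j, (∑ t, c t j • s t) * q i ∈ words P n := by
      intro j
      refine ih _ (mul_base_mem_words P (Submodule.sum_smul_mem _ _ fun t _ => hsw t) _) ?_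
      intro i' X _ _ π r w h
      rw [map_mul, ← mulVec_mulVec]
      by_cases hi : i' = i
      · subst hi
        rw [show π (q i') *ᵥ w = w from h.mulVec_eq]
        have h0 : ∑ j, (∑ t, c t j * (r ⬝ᵥ (π (s t) *ᵥ w))) • W₀.mkQ (e j) = 0 := by
          have h1 : ∑ t, (r ⬝ᵥ (π (s t) *ᵥ w)) • W₀.mkQ (a t) = 0 := by
            simp only [← map_smul, ← map_sum]
            exact (Submodule.Quotient.mk_eq_zero W₀).2 (hrel X π r w h)
          rw [← h1]
          have h2 : ∀ t, W₀.mkQ (a t) = ∑ j, c t j • W₀.mkQ (e j) := fun t => by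
            rw [← sub_eq_zero]
            simp only [← map_smul, ← map_sum, ← map_sub]
            exact (Submodule.Quotient.mk_eq_zero W₀).2 (hc t)
          simp only [h2, Finset.smul_sum, Finset.sum_smul, smul_smul]
          rw [Finset.sum_comm]
          simp only [mul_comm]
        have h3 := Fintype.linearIndependent_iff.1 hli _ h0 j
        simpa only [map_sum, map_smul, sum_mulVec, dotProduct_sum, smul_mulVec, dotProduct_smul,
          smul_eq_mul] using h3
      · rw [← h.mulVec_eq, mulVec_mulVec _ (π (q i)), ← map_mul,
          show q i * P.jB (ι (p i')) = 0 from hqo i i' (Ne.symm hi), map_zero, zero_mulVec,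
          mulVec_zero, dotProduct_zero]
    have hsplit : ∑ t, s t * q i * (a t : P.carrier) =
        ∑ t, s t * (q i * ((a t - ∑ j, c t j • e j : Subalgebra.toSubmodule (letters P n)) :
          P.carrier)) + ∑ j, (∑ t, c t j • s t) * q i * (e j : P.carrier) := by
      simp only [Submodule.coe_sub, Submodule.coe_sum, Submodule.coe_smul, mul_sub,
        Finset.sum_sub_distrib, Finset.mul_sum, Finset.sum_mul, mul_assoc, smul_mul_assoc,
        mul_smul_comm]
      rw [Finset.sum_comm, sub_add_cancel]
    rw [hsplit]
    refine add_mem (sum_mem fun t _ => ?_) (sum_mem fun j _ => ?_)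
    · obtain ⟨z, hz⟩ := Submodule.mem_span_singleton.1 (hc t)
      rw [show q i * ((a t - ∑ j, c t j • e j : Subalgebra.toSubmodule (letters P n)) :
        P.carrier) = z • q i from hz.symm, mul_smul_comm]
      exact Submodule.smul_mem _ _ (mul_base_mem_words P (hsw t) _)
    · exact words_le_succ P n (mul_mem_words P (hv j) (e j).2)
  have hx' : ∑ t, s t * (a t : P.carrier) = ∑ i, ∑ t, s t * q i * (a t : P.carrier) := by
    rw [Finset.sum_comm]
    refine Finset.sum_congr rfl fun t _ => ?_
    rw [← Finset.sum_mul, ← Finset.mul_sum, hqsum, mul_one]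
  rw [hx']
  exact sum_mem fun i _ => hterm i

include hs hid ho hsum hspan in
theorem eq_zero_of_invisible (hC : IsFinDimCStar C) (hB : IsRFD B) {x : P.carrier}
    (hx : Invisible x) : x = 0 := by
  have hsep : ∀ n, IsSeparated P p n := fun n => by
    induction n with
    | zero => exact isSeparated_zero P hid hsum hC hB
    | succ n ih => exact isSeparated_succ P hs hid ho hsum hspan hC hB ih
  obtain ⟨n, hn⟩ := exists_mem_words P x
  induction n with
  | zero => rwa [words_zero, Submodule.mem_bot] at hn
  | succ n ih =>
    refine ih (hsep n x hn fun i X _ _ π r w _ => ?_)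
    rw [hx X π, zero_mulVec, dotProduct_zero]

end Separation

end Words

end FreeProductRFD

/-- Proposition 2.18 of the paper: if `B` is a residually finite-dimensional
*-algebra, `D ⊆ B` a finite-dimensional commutative C*-subalgebra and `C` a
finite-dimensional C*-algebra, then `C ∗ B / [C, D]` is residually
finite-dimensional. -/
theorem commutantsProd_isRFD (C B D : Type)
    [Ring C] [Algebra ℂ C] [StarRing C] [StarModule ℂ C]
    [Ring B] [Algebra ℂ B] [StarRing B] [StarModule ℂ B]
    [CommRing D] [Algebra ℂ D] [StarRing D] [StarModule ℂ D]
    (hC : IsFinDimCStar C) (hB : IsRFD B)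
    (hD : IsSpannedByOrthProjections D)
    (ι : D →⋆ₐ[ℂ] B) (hι : Function.Injective ι)
    (P : CommutantsProd C B D ι) : IsRFD P.carrier := by
  obtain ⟨m, p, hs, hid, ho, hsum, hspan⟩ := hD
  exact FreeProductRFD.isRFD_of_invisible fun _ =>
    FreeProductRFD.eq_zero_of_invisible P hs hid ho hsum hspan hC hB
end
end

section
/- For every N ≥ 4 there exists a matrix P = (P_{ij})_{1≤i,j≤N} of elements of M_N(ℂ) such that every entry P_{ij} is a self-adjoint idempotent of rank one, ∑_{j=1}^N P_{ij} = 1 = ∑_{i=1}^N P_{ij} for all i and j, and there exist indices i,j,k,l with P_{ij}P_{kl} ≠ P_{kl}P_{ij}. (Equivalently, the inclusion X_N^{class} ⊆ X_N of the commuting bistochastic matrices of rank-one projections into all such matrices is proper for N ≥ 4.) -/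
noncomputable section

open Matrix

/-- A Latin square `L` on `α` containing a `2 × 2` Latin subsquare (an intercalate), located in the
rows `r₁ ≠ r₂` and the columns `c₁ ≠ c₂`. -/
structure IsIntercalate {α : Type*} (L : α → α → α) (r₁ r₂ c₁ c₂ : α) : Prop where
  injective_row : ∀ i, Function.Injective (L i)
  injective_col : ∀ j, Function.Injective fun i => L i j
  row_ne : r₁ ≠ r₂
  col_ne : c₁ ≠ c₂
  diag : L r₁ c₁ = L r₂ c₂
  antidiag : L r₁ c₂ = L r₂ c₁

theorem IsIntercalate.conj {α β : Type*} {L : α → α → α} {r₁ r₂ c₁ c₂ : α}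
    (h : IsIntercalate L r₁ r₂ c₁ c₂) (e : α ≃ β) :
    IsIntercalate (fun i j => e (L (e.symm i) (e.symm j))) (e r₁) (e r₂) (e c₁) (e c₂) where
  injective_row i _ _ hxy := e.symm.injective (h.injective_row _ (e.injective hxy))
  injective_col j _ _ hxy := e.symm.injective (h.injective_col (e.symm j) (e.injective hxy))
  row_ne hr := h.row_ne (e.injective hr)
  col_ne hc := h.col_ne (e.injective hc)
  diag := by simp [h.diag]
  antidiag := by simp [h.antidiag]

/-- The addition table of a group with an involution contains an intercalate. -/
theorem isIntercalate_add {A : Type*} [AddCommGroup A] {t : A} (ht : t ≠ 0) (htt : t + t = 0) :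
    IsIntercalate (fun i j : A => i + j) 0 t 0 t where
  injective_row := add_right_injective
  injective_col := add_left_injective
  row_ne := ht.symm
  col_ne := ht.symm
  diag := by simp [htt]
  antidiag := by simp

/-- The prolongation of the addition table of `A` along the two transversals `j = i` and
`j = i + 1`. -/
def prolongation {A : Type*} [CommRing A] [DecidableEq A] : A ⊕ Bool → A ⊕ Bool → A ⊕ Bool
  | .inl i, .inl j =>
    if j = i then .inr false else if j = i + 1 then .inr true else .inl (i + j)
  | .inl i, .inr false => .inl (i + i)
  | .inl i, .inr true => .inl (i + i + 1)
  | .inr false, .inl j => .inl (j + j)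
  | .inr true, .inl j => .inl (j + j - 1)
  | .inr b, .inr c => .inr (xor b c)

theorem isIntercalate_prolongation {A : Type*} [CommRing A] [Nontrivial A] [DecidableEq A]
    (hA : ∀ x y : A, x + x = y + y → x = y) :
    IsIntercalate (prolongation (A := A)) (.inr false) (.inr true) (.inr false) (.inr true) where
  injective_row i x y h := by
    have hsub (x y : A) (e : x + x - 1 = y + y - 1) : x = y := hA x y (sub_left_inj.mp e)
    have hne (x : A) : x + x ≠ x + x + 1 := by simp
    rcases i with i | (_ | _) <;> rcases x with x | (_ | _) <;> rcases y with y | (_ | _) <;>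
      simp only [prolongation] at h <;> grind
  injective_col j x y h := by
    have hadd (x y : A) (e : x + x + 1 = y + y + 1) : x = y := hA x y (add_right_cancel e)
    have hne (x : A) : x + x ≠ x + x - 1 := by simp [eq_sub_iff_add_eq]
    rcases j with j | (_ | _) <;> rcases x with x | (_ | _) <;> rcases y with y | (_ | _) <;>
      simp only [prolongation] at h <;> grind
  row_ne := by simp
  col_ne := by simp
  diag := rfl
  antidiag := rfl

theorem exists_isIntercalate_fin (N : ℕ) (hN : 4 ≤ N) :
    ∃ (L : Fin N → Fin N → Fin N) (r₁ r₂ c₁ c₂ : Fin N), IsIntercalate L r₁ r₂ c₁ c₂ := by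
  rcases Nat.even_or_odd' N with ⟨m, rfl | rfl⟩
  · have : NeZero (2 * m) := ⟨by omega⟩
    have ht : (m : ZMod (2 * m)) ≠ 0 := by
      rw [Ne, ZMod.natCast_eq_zero_iff]
      exact fun h => absurd (Nat.le_of_dvd (by omega) h) (by omega)
    have htt : (m : ZMod (2 * m)) + m = 0 := by
      rw [← two_mul]
      exact_mod_cast ZMod.natCast_self (2 * m)
    have e : ZMod (2 * m) ≃ Fin (2 * m) := Fintype.equivFinOfCardEq (ZMod.card _)
    exact ⟨_, _, _, _, _, (isIntercalate_add ht htt).conj e⟩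
  · obtain ⟨k, rfl⟩ : ∃ k, m = k + 2 := ⟨m - 2, by omega⟩
    have : Fact (1 < 2 * k + 3) := ⟨by omega⟩
    have e : ZMod (2 * k + 3) ⊕ Bool ≃ Fin (2 * (k + 2) + 1) :=
      Fintype.equivFinOfCardEq (by simp [ZMod.card]; ring)
    have hn : (2 * k + 3 : ZMod (2 * k + 3)) = 0 := by
      exact_mod_cast ZMod.natCast_self (2 * k + 3)
    refine ⟨_, _, _, _, _, (isIntercalate_prolongation fun x y h => ?_).conj e⟩
    linear_combination (-(k : ZMod (2 * k + 3)) - 1) * h + (x - y) * hn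

theorem rank_vecMulVec_eq_one {n : Type*} [Fintype n] {v w : n → ℂ}
    (hv : v ≠ 0) (hw : w ≠ 0) : (vecMulVec v w).rank = 1 := by
  refine le_antisymm (rank_vecMulVec_le v w) (Nat.one_le_iff_ne_zero.mpr ?_)
  intro h
  classical
  rw [Matrix.rank, Submodule.finrank_eq_zero, LinearMap.range_eq_bot, ← toLin'_apply',
    LinearEquiv.map_eq_zero_iff] at h
  exact vecMulVec_ne_zero hv hw h

/-- `A` is a rank-one orthogonal projection. -/
def IsRankOneProj {n : Type*} [Fintype n] (A : Matrix n n ℂ) : Prop :=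
  star A = A ∧ A * A = A ∧ A.rank = 1

theorem isRankOneProj_vecMulVec {n : Type*} [Fintype n] {v : n → ℂ}
    (hv : star v ⬝ᵥ v = 1) : IsRankOneProj (vecMulVec v (star v)) := by
  have hv0 : v ≠ 0 := by
    rintro rfl
    simp at hv
  refine ⟨?_, ?_, rank_vecMulVec_eq_one hv0 (star_ne_zero.mpr hv0)⟩
  · rw [star_eq_conjTranspose, conjTranspose_vecMulVec, star_star]
  · rw [vecMulVec_mul_vecMulVec, hv, one_smul]

theorem isRankOneProj_single {n : Type*} [Fintype n] [DecidableEq n] (a : n) :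
    IsRankOneProj (single a a (1 : ℂ)) := by
  have h := isRankOneProj_vecMulVec (v := Pi.single a (1 : ℂ)) (by simp)
  have e : vecMulVec (Pi.single a (1 : ℂ)) (star (Pi.single a (1 : ℂ))) = single a a 1 := by
    ext i j
    simp [vecMulVec_apply, single_apply, Pi.single_apply, @eq_comm _ i, @eq_comm _ j, ← ite_and, and_comm]
  rwa [e] at h

/-- The difference between the projection onto `(3 e_a + 4 e_b) / 5` and the one onto `e_a`. -/
def tilt {n : Type*} [DecidableEq n] (a b : n) : Matrix n n ℂ :=
  single a a (-16 / 25) + single a b (12 / 25) + single b a (12 / 25) + single b b (16 / 25)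

theorem isRankOneProj_single_add_tilt {n : Type*} [Fintype n] [DecidableEq n] {a b : n}
    (hab : a ≠ b) : IsRankOneProj (single a a 1 + tilt a b) := by
  have h := isRankOneProj_vecMulVec (v := Pi.single a (3 / 5 : ℂ) + Pi.single b (4 / 5)) (by
    simp [hab, hab.symm]
    norm_num)
  convert h using 1
  ext i j
  simp only [tilt, vecMulVec_apply, single_apply, Pi.single_apply, Matrix.add_apply, Pi.add_apply,
    Pi.star_apply, star_add, apply_ite star]
  by_cases h1 : i = a <;> by_cases h2 : j = a <;> by_cases h3 : i = b <;> by_cases h4 : j = b <;>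
    simp_all [eq_comm] <;> norm_num

theorem isRankOneProj_single_sub_tilt {n : Type*} [Fintype n] [DecidableEq n] {a b : n}
    (hab : a ≠ b) : IsRankOneProj (single b b 1 - tilt a b) := by
  have h := isRankOneProj_vecMulVec (v := Pi.single a (4 / 5 : ℂ) + Pi.single b (-3 / 5)) (by
    simp [hab, hab.symm]
    norm_num)
  convert h using 1
  ext i j
  simp only [tilt, vecMulVec_apply, single_apply, Pi.single_apply, Matrix.add_apply, Pi.add_apply,
    Matrix.sub_apply, Pi.star_apply, star_add, apply_ite star]
  by_cases h1 : i = a <;> by_cases h2 : j = a <;> by_cases h3 : i = b <;> by_cases h4 : j = b <;>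
    simp_all [eq_comm] <;> norm_num

theorem single_add_tilt_not_commute {n : Type*} [Fintype n] [DecidableEq n] {a b : n}
    (hab : a ≠ b) :
    (single a a 1 + tilt a b) * single a a 1 ≠ single a a 1 * (single a a 1 + tilt a b) := by
  intro h
  have := congrFun (congrFun h a) b
  norm_num [tilt, hab, hab.symm] at this

/-- The signed indicator `1_{r} - 1_{s}`. -/
def signedIndicator {n : Type*} [DecidableEq n] (r s : n) : n → ℂ :=
  Pi.single r 1 - Pi.single s 1

theorem sum_signedIndicator {n : Type*} [Fintype n] [DecidableEq n] (r s : n) :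
    ∑ i, signedIndicator r s i = 0 := by
  simp [signedIndicator]

/-- The matrix of projections onto the basis vectors prescribed by `L`, tilted on the
intercalate. -/
def tiltedSquare {n : Type*} [DecidableEq n] (L : n → n → n) (r₁ r₂ c₁ c₂ : n) (i j : n) :
    Matrix n n ℂ :=
  single (L i j) (L i j) 1 +
    (signedIndicator r₁ r₂ i * signedIndicator c₁ c₂ j) • tilt (L r₁ c₁) (L r₁ c₂)

theorem sum_single_of_injective {n : Type*} [Fintype n] [DecidableEq n] {f : n → n}
    (hf : Function.Injective f) : ∑ i, single (f i) (f i) (1 : ℂ) = 1 := by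
  rw [(Finite.injective_iff_bijective.mp hf).sum_comp fun k => single k k (1 : ℂ)]
  exact sum_single_one

namespace IsIntercalate

variable {n : Type*} {L : n → n → n} {r₁ r₂ c₁ c₂ : n}

theorem symbol_ne (h : IsIntercalate L r₁ r₂ c₁ c₂) : L r₁ c₁ ≠ L r₁ c₂ :=
  fun e => h.col_ne (h.injective_row r₁ e)

variable [Fintype n] [DecidableEq n]

theorem isRankOneProj_tiltedSquare (h : IsIntercalate L r₁ r₂ c₁ c₂) (i j : n) :
    IsRankOneProj (tiltedSquare L r₁ r₂ c₁ c₂ i j) := by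
  have h0 := isRankOneProj_single (L i j)
  have hadd := isRankOneProj_single_add_tilt h.symbol_ne
  have hsub := isRankOneProj_single_sub_tilt h.symbol_ne
  have hr := h.row_ne
  have hc := h.col_ne
  by_cases h1 : i = r₁
  · subst h1
    by_cases h3 : j = c₁
    · subst h3
      simpa [tiltedSquare, signedIndicator, hr, hc] using hadd
    by_cases h4 : j = c₂
    · subst h4
      simpa [tiltedSquare, signedIndicator, hr, h3, sub_eq_add_neg] using hsub
    simpa [tiltedSquare, signedIndicator, h3, h4] using h0
  by_cases h2 : i = r₂
  · subst h2
    by_cases h3 : j = c₁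
    · subst h3
      simpa [tiltedSquare, signedIndicator, h1, hc, sub_eq_add_neg, ← h.antidiag] using hsub
    by_cases h4 : j = c₂
    · subst h4
      simpa [tiltedSquare, signedIndicator, h1, h3, ← h.diag] using hadd
    simpa [tiltedSquare, signedIndicator, h3, h4] using h0
  simpa [tiltedSquare, signedIndicator, h1, h2] using h0

theorem sum_row_tiltedSquare (h : IsIntercalate L r₁ r₂ c₁ c₂) (i : n) :
    ∑ j, tiltedSquare L r₁ r₂ c₁ c₂ i j = 1 := by
  simp only [tiltedSquare, Finset.sum_add_distrib, sum_single_of_injective (h.injective_row i),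
    ← Finset.sum_smul, ← Finset.mul_sum, sum_signedIndicator, mul_zero, zero_smul, add_zero]

theorem sum_col_tiltedSquare (h : IsIntercalate L r₁ r₂ c₁ c₂) (j : n) :
    ∑ i, tiltedSquare L r₁ r₂ c₁ c₂ i j = 1 := by
  simp only [tiltedSquare, Finset.sum_add_distrib, sum_single_of_injective (h.injective_col j),
    ← Finset.sum_smul, ← Finset.sum_mul, sum_signedIndicator, zero_mul, zero_smul, add_zero]

theorem exists_not_commute_tiltedSquare (h : IsIntercalate L r₁ r₂ c₁ c₂)
    (hn : 2 < Fintype.card n) :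
    ∃ i j k l, tiltedSquare L r₁ r₂ c₁ c₂ i j * tiltedSquare L r₁ r₂ c₁ c₂ k l ≠
      tiltedSquare L r₁ r₂ c₁ c₂ k l * tiltedSquare L r₁ r₂ c₁ c₂ i j := by
  obtain ⟨k, hk⟩ : ∃ k, k ∉ ({r₁, r₂} : Finset n) := by
    by_contra! hall
    have := Finset.card_le_card fun k (_ : k ∈ Finset.univ) => hall k
    exact absurd (this.trans Finset.card_le_two) (by simpa using hn)
  obtain ⟨l, hl⟩ := Finite.surjective_of_injective (h.injective_row k) (L r₁ c₁)
  simp only [Finset.mem_insert, Finset.mem_singleton, not_or] at hk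
  refine ⟨r₁, c₁, k, l, ?_⟩
  simpa [tiltedSquare, signedIndicator, hk.1, hk.2, hl, h.row_ne, h.col_ne] using
    single_add_tilt_not_commute h.symbol_ne

end IsIntercalate

/-- Lemma 4.5 of the paper: for `N ≥ 4`, the inclusion `X_N^{class} ⊆ X_N` is proper;
i.e. there is an N×N bistochastic matrix of rank-one orthogonal projections in
`M_N(ℂ)` whose entries do not all commute. -/
theorem exists_noncommuting_flat_matrix (N : ℕ) (hN : 4 ≤ N) :
    ∃ P : Fin N → Fin N → Matrix (Fin N) (Fin N) ℂ,
      (∀ i j, star (P i j) = P i j) ∧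
      (∀ i j, P i j * P i j = P i j) ∧
      (∀ i j, (P i j).rank = 1) ∧
      (∀ i, ∑ j, P i j = 1) ∧
      (∀ j, ∑ i, P i j = 1) ∧
      ∃ i j k l, P i j * P k l ≠ P k l * P i j := by
  obtain ⟨L, r₁, r₂, c₁, c₂, h⟩ := exists_isIntercalate_fin N hN
  have hP := h.isRankOneProj_tiltedSquare
  exact ⟨tiltedSquare L r₁ r₂ c₁ c₂, fun i j => (hP i j).1, fun i j => (hP i j).2.1,
    fun i j => (hP i j).2.2, h.sum_row_tiltedSquare, h.sum_col_tiltedSquare,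
    h.exists_not_commute_tiltedSquare (by simpa using by omega)⟩
end
end
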